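/- Let k be a differential field of characteristic zero whose field of constants C is algebraically closed, let E be a Picard–Vessiot extension of k for a monic linear differential operator L over k, let y ∈ E be a nonzero solution of L(y) = 0, and set d := trdeg(k⟨y⟩|k). If d = 1, then k⟨y⟩ is a 1⁺-solvable extension of k; and if 2 ≤ d ≤ 4, then k⟨y⟩ is a d-solvable extension of k. -/

import Mathlib

universe u

/-- A bundled differential field of characteristic zero: a field together with a derivation,
given as a raw function satisfying additivity and the Leibniz rule. -/
structure DFld : Type (u + 1) where
  carrier : Type u
  [fieldInst : Field carrier]
  [charZeroInst : CharZero carrier]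
  deriv : carrier → carrier
  deriv_add : ∀ a b, deriv (a + b) = deriv a + deriv b
  deriv_mul : ∀ a b, deriv (a * b) = deriv a * b + a * deriv b

attribute [instance] DFld.fieldInst DFld.charZeroInst

/-- The result of applying the monic linear differential operator
`∂^n + a_{n-1} ∂^{n-1} + ⋯ + a_1 ∂ + a_0` (with coefficients `a`) to `y`,
where the derivation is given by `D`. -/
def LApply {E : Type u} [Field E] (D : E → E) (n : ℕ) (a : Fin n → E) (y : E) : E :=
  D^[n] y + ∑ i : Fin n, a i * D^[(i : ℕ)] y

/-- `diffGen D k S` is the smallest differential subfield (w.r.t. the derivation `D`)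
containing the subfield `k` and the set `S`; i.e. the differential field `k⟨S⟩`. -/
def diffGen {E : Type u} [Field E] (D : E → E) (k : Subfield E) (S : Set E) : Subfield E :=
  sInf {F : Subfield E | k ≤ F ∧ S ⊆ ↑F ∧ ∀ x ∈ F, D x ∈ F}

/-- The subfield of constants of a differential subfield `k`: `{x ∈ k | D x = 0}`. -/
def constantsOf {E : Type u} [Field E] (D : Derivation ℤ E E) (k : Subfield E) : Subfield E where
  carrier := {x | x ∈ k ∧ D x = 0}
  zero_mem' := ⟨k.zero_mem, map_zero D⟩
  one_mem' := ⟨k.one_mem, D.map_one_eq_zero⟩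
  add_mem' := by
    rintro a b ⟨hak, ha0⟩ ⟨hbk, hb0⟩
    exact ⟨k.add_mem hak hbk, by rw [map_add, ha0, hb0, add_zero]⟩
  neg_mem' := by
    rintro a ⟨hak, ha0⟩
    exact ⟨k.neg_mem hak, by rw [map_neg, ha0, neg_zero]⟩
  mul_mem' := by
    rintro a b ⟨hak, ha0⟩ ⟨hbk, hb0⟩
    exact ⟨k.mul_mem hak hbk, by
      rw [Derivation.leibniz, ha0, hb0, smul_zero, smul_zero, add_zero]⟩
  inv_mem' := by
    rintro x ⟨hxk, hx0⟩
    refine ⟨k.inv_mem hxk, ?_⟩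
    by_cases h : x = 0
    · simp [h]
    · have h1 : D (x * x⁻¹) = 0 := by rw [mul_inv_cancel₀ h, D.map_one_eq_zero]
      rw [Derivation.leibniz, hx0, smul_zero, add_zero, smul_eq_mul] at h1
      exact (mul_eq_zero.mp h1).resolve_left h

/-- `F` is a Picard–Vessiot extension of `k` (inside a common differential field) for the
monic linear differential operator of order `n` with (lower-order) coefficients `a`:
both are differential subfields, the constants of `F` equal the constants of `k`,
the coefficients lie in `k`, and `F` is differentially generated over `k` by an
`n`-dimensional vector space (over the constants) of solutions. -/
def IsPVWith {E : Type u} [Field E] (D : E → E) (k F : Subfield E) (n : ℕ)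
    (a : Fin n → E) : Prop :=
  k ≤ F ∧ (∀ x ∈ k, D x ∈ k) ∧ (∀ x ∈ F, D x ∈ F) ∧
  (∀ x ∈ F, D x = 0 → x ∈ k) ∧
  (∀ i, a i ∈ k) ∧
  ∃ y : Fin n → E,
    (∀ i, y i ∈ F) ∧
    (∀ i, LApply D n a (y i) = 0) ∧
    (∀ c : Fin n → E, (∀ i, c i ∈ k ∧ D (c i) = 0) → (∑ i, c i * y i) = 0 → ∀ i, c i = 0) ∧
    diffGen D k (Set.range y) = F

/-- `F` is a Picard–Vessiot extension of `k` for some monic linear differential operator. -/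
def IsPV {E : Type u} [Field E] (D : E → E) (k F : Subfield E) : Prop :=
  ∃ (n : ℕ) (a : Fin n → E), IsPVWith D k F n a

/-- Relative version: the differential subfield `F` is a Picard–Vessiot extension
of the differential subfield `kb ≤ F`. -/
def IsPVRel {E : Type u} [Field E] (D : E → E) (kb F : Subfield E)
    (hF : ∀ x ∈ F, D x ∈ F) : Prop :=
  IsPV (fun x : ↥F => (⟨D ↑x, hF ↑x x.2⟩ : ↥F)) (Subfield.comap F.subtype kb) ⊤

/-- The ambient differential field (with derivation `D`) is a strongly normal extension of
its differential subfield `k`: it is finitely generated as a field extension of `k`, has no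
new constants, and every differential embedding over `k` into a differential field extension
`M` lands in the compositum of the image of the base copy with the constants of `M`. -/
def IsSN {E : Type u} [Field E] (D : E → E) (k : Subfield E) : Prop :=
  (∀ x ∈ k, D x ∈ k) ∧
  (∃ s : Finset E, Subfield.closure (↑k ∪ ↑s) = (⊤ : Subfield E)) ∧
  (∀ x : E, D x = 0 → x ∈ k) ∧
  ∀ (M : DFld.{u}) (ι σ : E →+* M.carrier),
    (∀ x, ι (D x) = M.deriv (ι x)) →
    (∀ x, σ (D x) = M.deriv (σ x)) →
    (∀ x ∈ k, σ x = ι x) →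
    ∀ e : E, σ e ∈ Subfield.closure (Set.range ι ∪ {m : M.carrier | M.deriv m = 0})

/-- Relative version: the differential subfield `F` is a strongly normal extension of the
differential subfield `kb ≤ F`. -/
def IsSNRel {E : Type u} [Field E] (D : E → E) (kb F : Subfield E)
    (hF : ∀ x ∈ F, D x ∈ F) : Prop :=
  IsSN (fun x : ↥F => (⟨D ↑x, hF ↑x x.2⟩ : ↥F)) (Subfield.comap F.subtype kb)

/-- `K` is a finite field extension of the subfield `M`. -/
def FinExt {E : Type u} [Field E] (M K : Subfield E) : Prop :=
  ∃ h : M ≤ K,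
    letI : Algebra ↥M ↥K := (Subfield.inclusion h).toAlgebra
    Module.Finite ↥M ↥K

/-- The transcendence degree of the subfield `K` over the subfield `k`, as the supremum of the
cardinalities of subsets of `K` that are algebraically independent over `k`. -/
noncomputable def trdegOf {E : Type u} [Field E] (k K : Subfield E) : Cardinal.{u} :=
  ⨆ s : {s : Set E // s ⊆ (K : Set E) ∧ AlgebraicIndependent ↥k (fun x : ↥s => (x : E))},
    Cardinal.mk ↥(s.1)

/-- `K` and `M` are free over `k`: every finite subset of `K` that is algebraically
independent over `k` remains algebraically independent over `M`. -/
def FreeOver {E : Type u} [Field E] (k K M : Subfield E) : Prop :=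
  ∀ s : Finset E, (↑s : Set E) ⊆ (K : Set E) →
    AlgebraicIndependent ↥k (fun x : ↥(↑s : Set E) => (x : E)) →
    AlgebraicIndependent ↥M (fun x : ↥(↑s : Set E) => (x : E))

/-- `K` is a `k`-irreducible differential field: it is a finitely generated differential field
extension of `k` of transcendence degree at least 1, and every intermediate differential field
`k ⊂ M ⊆ K` has transcendence degree `0` or `trdeg(K|k)` over `k`. -/
def IsIrred {E : Type u} [Field E] (D : E → E) (k K : Subfield E) : Prop :=
  (∃ s : Finset E, diffGen D k ↑s = K) ∧
  1 ≤ trdegOf k K ∧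
  ∀ M : Subfield E, (∀ x ∈ M, D x ∈ M) → k < M → M ≤ K →
    trdegOf k M = 0 ∨ trdegOf k M = trdegOf k K

/-- `Kf` is a `d`-solvable extension of `k`: there is a tower of differential fields starting
at (a copy of) `k`, each step being a finite algebraic extension or a Picard–Vessiot extension
for an operator of order at most `d`, whose top contains (the copy of) `Kf`. -/
def IsDSolvable {E : Type u} [Field E] (D : E → E) (k Kf : Subfield E) (d : ℕ) : Prop :=
  ∃ (Ω : DFld.{u}) (j : E →+* Ω.carrier),
    (∀ x, j (D x) = Ω.deriv (j x)) ∧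
    ∃ (r : ℕ) (T : Fin (r + 1) → Subfield Ω.carrier),
      T 0 = Subfield.map j k ∧
      Subfield.map j Kf ≤ T (Fin.last r) ∧
      (∀ i, ∀ x ∈ T i, Ω.deriv x ∈ T i) ∧
      ∀ i : Fin r,
        FinExt (T i.castSucc) (T i.succ) ∨
        ∃ n ≤ d, ∃ a : Fin n → Ω.carrier, IsPVWith Ω.deriv (T i.castSucc) (T i.succ) n a

/-- `Kn` is generated over `kb`, as a differential field with the same constants, by one
solution `z` of an inhomogeneous equation `L(y) = b` (with `L` monic over `kb` of order
`n ≤ d` and `b ∈ kb`) together with an `n`-dimensional space (over the constants) of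
solutions of `L(y) = 0`. -/
def IsPVInhomLe {E : Type u} [Field E] (D : E → E) (kb Kn : Subfield E) (d : ℕ) : Prop :=
  kb ≤ Kn ∧ (∀ x ∈ kb, D x ∈ kb) ∧ (∀ x ∈ Kn, D x ∈ Kn) ∧
  (∀ x ∈ Kn, D x = 0 → x ∈ kb) ∧
  ∃ n, n ≤ d ∧ ∃ (a : Fin n → E) (b z : E) (y : Fin n → E),
    (∀ i, a i ∈ kb) ∧ b ∈ kb ∧ z ∈ Kn ∧ (∀ i, y i ∈ Kn) ∧
    LApply D n a z = b ∧
    (∀ i, LApply D n a (y i) = 0) ∧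
    (∀ c : Fin n → E, (∀ i, c i ∈ kb ∧ D (c i) = 0) → (∑ i, c i * y i) = 0 → ∀ i, c i = 0) ∧
    diffGen D kb (insert z (Set.range y)) = Kn

/-- `Kf` is a `d⁺`-solvable extension of `k`. -/
def IsDPlusSolvable {E : Type u} [Field E] (D : E → E) (k Kf : Subfield E) (d : ℕ) : Prop :=
  ∃ (Ω : DFld.{u}) (j : E →+* Ω.carrier),
    (∀ x, j (D x) = Ω.deriv (j x)) ∧
    ∃ (r : ℕ) (T : Fin (r + 1) → Subfield Ω.carrier),
      T 0 = Subfield.map j k ∧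
      Subfield.map j Kf ≤ T (Fin.last r) ∧
      (∀ i, ∀ x ∈ T i, Ω.deriv x ∈ T i) ∧
      ∀ i : Fin r,
        FinExt (T i.castSucc) (T i.succ) ∨ IsPVInhomLe Ω.deriv (T i.castSucc) (T i.succ) d

/-- `TSet D kb K` is the set of elements of `K` annihilated by some monic linear differential
operator with coefficients in `kb`. -/
def TSet {E : Type u} [Field E] (D : E → E) (kb K : Subfield E) : Set E :=
  {x | x ∈ K ∧ ∃ (n : ℕ) (a : Fin n → E), (∀ i, a i ∈ kb) ∧ LApply D n a x = 0}


section PartA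
variable {C Ω : Type u} [Field C] [Field Ω] [Algebra C Ω]
theorem wr_aux (D : Derivation C Ω Ω) (hD : ∀ x, D x = 0 → ∃ c, algebraMap C Ω c = x) :
    ∀ (m : ℕ) (w : Fin m → Ω), LinearIndependent C w → ∀ c : Fin m → Ω,
      (∀ i < m, ∑ j, c j * D^[i] (w j) = 0) → c = 0 := by
  intro m
  induction m with
  | zero => intro w _ c _; exact Subsingleton.elim _ _
  | succ m ih =>
    intro w hw c hc
    by_contra hne
    obtain ⟨p, hp⟩ : ∃ p, c p ≠ 0 := by
      by_contra h; push Not at h; exact hne (funext h)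
    set b : Fin (m + 1) → Ω := fun j => c j / c p with hb
    have hb1 : b p = 1 := by simp [hb, hp]
    have hbs : ∀ i < m + 1, ∑ j, b j * D^[i] (w j) = 0 := by
      intro i hi
      have := hc i hi
      have h2 : ∑ j, b j * D^[i] (w j) = (∑ j, c j * D^[i] (w j)) / c p := by
        rw [Finset.sum_div]; exact Finset.sum_congr rfl fun j _ => by simp [hb]; ring
      rw [h2, this, zero_div]
    have hd : ∀ i < m, ∑ j, D (b j) * D^[i] (w j) = 0 := by
      intro i hi
      have h1 := congrArg D (hbs i (by omega))
      rw [map_sum, map_zero] at h1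
      have h2 := hbs (i + 1) (by omega)
      have : ∀ j, D (b j * D^[i] (w j)) = b j * D^[i+1] (w j) + D (b j) * D^[i] (w j) := by
        intro j
        rw [Derivation.leibniz, Function.iterate_succ_apply']; simp only [smul_eq_mul]; ring
      simp only [this, Finset.sum_add_distrib, h2, zero_add] at h1
      exact h1
    have h3 := ih (w ∘ p.succAbove) (hw.comp _ p.succAbove_right_injective)
      (fun j => D (b (p.succAbove j))) (by
        intro i hi
        have := hd i hi
        rw [Fin.sum_univ_succAbove _ p, hb1, D.map_one_eq_zero, zero_mul, zero_add] at this
        simpa using this)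
    have h4 : ∀ j, D (b j) = 0 := by
      intro j
      rcases Fin.eq_self_or_eq_succAbove p j with h | ⟨i, h⟩
      · rw [h, hb1, D.map_one_eq_zero]
      · rw [h]; exact congrFun h3 i
    choose e he using fun j => hD _ (h4 j)
    have h5 := hbs 0 (by omega)
    simp only [Function.iterate_zero, id] at h5
    have h6 := Fintype.linearIndependent_iff.1 hw e (by
      rw [← h5]; exact Finset.sum_congr rfl fun j _ => by rw [Algebra.smul_def, he])
    have h7 := he p
    rw [h6 p, hb1, map_zero] at h7
    exact zero_ne_one h7
def wrM (D : Derivation C Ω Ω) {m : ℕ} (w : Fin m → Ω) : Matrix (Fin m) (Fin m) Ω :=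
  Matrix.of fun i j => D^[(i : ℕ)] (w j)
theorem wrM_det (D : Derivation C Ω Ω) (hD : ∀ x, D x = 0 → ∃ c, algebraMap C Ω c = x)
    {m : ℕ} (w : Fin m → Ω) (hw : LinearIndependent C w) : IsUnit (wrM D w).det := by
  rw [isUnit_iff_ne_zero]
  intro h
  obtain ⟨v, hv, hv2⟩ := Matrix.exists_mulVec_eq_zero_iff.2 h
  apply hv
  apply wr_aux D hD m w hw v
  intro i hi
  have := congrFun hv2 ⟨i, hi⟩
  simp only [Matrix.mulVec, dotProduct, wrM, Matrix.of_apply, Pi.zero_apply] at this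
  rw [← this]; exact Finset.sum_congr rfl fun j _ => mul_comm _ _
theorem wr_row (D : Derivation C Ω Ω) (hD : ∀ x, D x = 0 → ∃ c, algebraMap C Ω c = x)
    {m : ℕ} (w : Fin m → Ω) (hw : LinearIndependent C w) (a : Fin m → Ω)
    (h : ∀ j, ∑ i : Fin m, a i * D^[(i : ℕ)] (w j) = 0) : a = 0 := by
  have h1 : Matrix.vecMul a (wrM D w) = 0 := by
    funext j; simpa [Matrix.vecMul, dotProduct, wrM] using h j
  have h2 := wrM_det D hD w hw
  have h3 := congrArg (fun v => Matrix.vecMul v (wrM D w)⁻¹) h1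
  simpa [Matrix.vecMul_vecMul, Matrix.mul_nonsing_inv _ h2] using h3
theorem exists_op (D : Derivation C Ω Ω) (hD : ∀ x, D x = 0 → ∃ c, algebraMap C Ω c = x)
    {m : ℕ} (w : Fin m → Ω) (hw : LinearIndependent C w) :
    ∃ a : Fin m → Ω, ∀ j, LApply D m a (w j) = 0 := by
  have h2 := wrM_det D hD w hw
  refine ⟨Matrix.vecMul (fun j => - D^[m] (w j)) (wrM D w)⁻¹, fun j => ?_⟩
  have h3 : Matrix.vecMul (Matrix.vecMul (fun j => - D^[m] (w j)) (wrM D w)⁻¹) (wrM D w)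
      = (fun j => - D^[m] (w j)) := by
    rw [Matrix.vecMul_vecMul, Matrix.nonsing_inv_mul _ h2, Matrix.vecMul_one]
  have h4 := congrFun h3 j
  rw [LApply]
  rw [Matrix.vecMul, dotProduct] at h4
  simp only [wrM, Matrix.of_apply] at h4 ⊢
  rw [h4]; ring
def opL (D : Derivation C Ω Ω) (m : ℕ) (a : Fin m → Ω) : Ω →ₗ[C] Ω :=
  (D : Ω →ₗ[C] Ω) ^ m + ∑ i : Fin m, LinearMap.mulLeft C (a i) ∘ₗ ((D : Ω →ₗ[C] Ω) ^ (i : ℕ))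
theorem opL_apply (D : Derivation C Ω Ω) (m : ℕ) (a : Fin m → Ω) (z : Ω) :
    opL D m a z = LApply D m a z := by
  simp [opL, LApply, Module.End.pow_apply]
theorem opL_ker (D : Derivation C Ω Ω) (hD : ∀ x, D x = 0 → ∃ c, algebraMap C Ω c = x)
    (m : ℕ) (a : Fin m → Ω) (w : Fin (m+1) → Ω) (h : ∀ j, LApply D m a (w j) = 0) :
    ¬ LinearIndependent C w := by
  intro hw
  have h1 := wr_row D hD w hw (Fin.snoc a 1) (by
    intro j
    rw [Fin.sum_univ_castSucc]
    have := h j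
    rw [LApply] at this
    simp only [Fin.snoc_castSucc, Fin.snoc_last, Fin.val_castSucc, Fin.val_last, one_mul]
    rw [add_comm]; exact this)
  have := congrFun h1 (Fin.last m)
  simp at this
theorem opL_ker_fin (D : Derivation C Ω Ω) (hD : ∀ x, D x = 0 → ∃ c, algebraMap C Ω c = x)
    (m : ℕ) (a : Fin m → Ω) : Module.Finite C (LinearMap.ker (opL D m a)) ∧
      Module.finrank C (LinearMap.ker (opL D m a)) ≤ m := by
  have hr : Module.rank C (LinearMap.ker (opL D m a)) ≤ m := by
    apply rank_le
    intro s hs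
    by_contra hlt
    push Not at hlt
    have e : Fin (m+1) ↪ s := (Fin.castLEEmb (by simpa using hlt)).trans s.equivFin.symm.toEmbedding
    refine opL_ker D hD m a (fun i => ((e i : LinearMap.ker (opL D m a)) : Ω)) ?_ ?_
    · intro j
      have := (e j : LinearMap.ker (opL D m a)).2
      rw [LinearMap.mem_ker, opL_apply] at this
      exact this
    · have := (hs.comp e e.injective).map' (Submodule.subtype _) (Submodule.ker_subtype _)
      exact this
  have hf : Module.Finite C (LinearMap.ker (opL D m a)) :=
    Module.rank_lt_aleph0_iff.1 (lt_of_le_of_lt hr (Cardinal.natCast_lt_aleph0))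
  refine ⟨hf, ?_⟩
  exact Module.finrank_le_of_rank_le hr
end PartA

section PartB1
open LieModule
theorem hasTrivialRadical_of_irr {C G W : Type*} [Field C] [CharZero C] [IsAlgClosed C]
    [LieRing G] [LieAlgebra C G] [Module.Finite C G]
    [AddCommGroup W] [Module C W] [Module.Finite C W] [Nontrivial W]
    [LieRingModule G W] [LieModule C G W]
    (hirr : ∀ N : LieSubmodule C G W, N ≠ ⊥ → N = ⊤)
    (hfaith : ∀ x : G, (∀ w : W, ⁅x, w⁆ = 0) → x = 0)
    (htr : ∀ x : G, LinearMap.trace C W (toEnd C G W x) = 0) :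
    LieAlgebra.HasTrivialRadical C G := by
  refine ⟨?_⟩
  set R := LieAlgebra.radical C G with hR
  have : LieAlgebra.IsSolvable R := LieAlgebra.radicalIsSolvable C G
  obtain ⟨χ, hχ⟩ := exists_nontrivial_weightSpace_of_isSolvable C R W
  set U : LieSubmodule C G W := weightSpaceOfIsLieTower C W χ with hU
  have hUt : U = ⊤ := by
    apply hirr
    intro h
    obtain ⟨⟨v, hv⟩, hv0⟩ := exists_ne (0 : weightSpace W χ)
    have : v ∈ U := hv
    rw [h, LieSubmodule.mem_bot] at this
    exact hv0 (Subtype.ext this)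
  have hact : ∀ (r : R) (w : W), ⁅r, w⁆ = χ r • w := by
    intro r w
    have : w ∈ U := by rw [hUt]; trivial
    have h2 : w ∈ weightSpace W χ := this
    exact (mem_weightSpace _ _).1 h2 r
  have hz : ∀ r : R, χ r = 0 := by
    intro r
    have h1 := htr r
    have h2 : toEnd C G W (r : G) = χ r • LinearMap.id := by
      ext w; exact hact r w
    rw [h2, map_smul, LinearMap.trace_id] at h1
    simpa [Module.finrank_pos.ne'] using h1
  rw [LieSubmodule.eq_bot_iff]
  intro r hr
  apply hfaith
  intro w
  have := hact ⟨r, hr⟩ w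
  rw [hz, zero_smul] at this
  exact this
theorem der_det {Ω : Type*} [Field Ω] (δ : Derivation ℤ Ω Ω) {m : ℕ}
    (F M : Matrix (Fin m) (Fin m) Ω) (h : F.map δ = F * M) :
    δ F.det = M.trace * F.det := by
  let f : Ω →+* DualNumber Ω :=
    { toFun := fun x => TrivSqZeroExt.inl x + TrivSqZeroExt.inr (δ x)
      map_one' := by ext <;> simp
      map_mul' := by intro x y; ext <;> simp [mul_comm]
      map_zero' := by ext <;> simp
      map_add' := by intro x y; ext <;> simp }
  let i : Ω →+* DualNumber Ω := TrivSqZeroExt.inlHom Ω Ω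
  have h1 : F.map f = F.map i * (1 + (DualNumber.eps : DualNumber Ω) • M.map i) := by
    have h2 : F.map f = F.map i + (DualNumber.eps : DualNumber Ω) • ((F * M).map i) := by
      rw [← h]
      ext a b <;> simp [f, i]
    rw [h2, Matrix.map_mul, mul_add, mul_one, Matrix.mul_smul]
  have h3 : f F.det = (F.map f).det := RingHom.map_det f F
  rw [h1, Matrix.det_mul, Matrix.det_one_add_smul] at h3
  have h4 : (F.map i).det = i F.det := (RingHom.map_det i F).symm
  have h5 : (M.map i).trace = i M.trace := by simp [Matrix.trace]
  rw [h4, h5, pow_two, DualNumber.eps_mul_eps, mul_zero, add_zero] at h3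
  have h6 := congrArg TrivSqZeroExt.snd h3
  simpa [f, i, mul_comm] using h6
end PartB1

section PartB2
variable {C Ω : Type u} [Field C] [Field Ω] [Algebra C Ω]
structure Sit (D : Derivation C Ω Ω) (L : LieSubalgebra C (Derivation C Ω Ω))
    (K : Subfield Ω) (d : ℕ) : Prop where
  const : ∀ x, D x = 0 → ∃ c, algebraMap C Ω c = x
  comm : ∀ δ ∈ L, ∀ a, δ (D a) = D (δ a)
  inv : ∀ a, (∀ δ ∈ L, δ a = 0) → a ∈ K
  triv : ∀ δ ∈ L, ∀ a ∈ K, δ a = 0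
  cl : ∀ m ≤ d, ∀ a : Fin m → Ω, (∀ i, a i ∈ K) → ∀ w : Fin m → Ω, LinearIndependent C w →
    (∀ j, LApply D m a (w j) = 0) → ∀ j, w j ∈ K
  cl1 : d = 1 → ∀ z, D z ∈ K → z ∈ K
  dpos : 1 ≤ d
variable {D : Derivation C Ω Ω} {L : LieSubalgebra C (Derivation C Ω Ω)}
    {K : Subfield Ω} {d : ℕ}
theorem lie_eq (x : L) (a : Ω) : ⁅x, a⁆ = (x : Derivation C Ω Ω) a := rfl
theorem lsum (U : LieSubmodule C L Ω) {ι : Type*} [Fintype ι] (b : Module.Basis ι C U) (u : U) :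
    (u : Ω) = ∑ i, b.repr u i • (b i : Ω) := by
  have h : ∀ c : ι → C, ((∑ i, c i • b i : U) : Ω) = ∑ i, c i • (b i : Ω) := by
    intro c; simp
  rw [← h, b.sum_repr]
theorem Sit.comm_iter (S : Sit D L K d) (δ : Derivation C Ω Ω) (hδ : δ ∈ L) (i : ℕ) (a : Ω) :
    δ (D^[i] a) = D^[i] (δ a) := by
  induction i with
  | zero => rfl
  | succ i ih => rw [Function.iterate_succ_apply', S.comm δ hδ, ih, Function.iterate_succ_apply']
theorem Sit.der_LApply (S : Sit D L K d) (δ : Derivation C Ω Ω) (hδ : δ ∈ L) (m : ℕ)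
    (a : Fin m → Ω) (z : Ω) :
    δ (LApply D m a z) = LApply D m a (δ z) + ∑ i : Fin m, δ (a i) * D^[(i : ℕ)] z := by
  simp only [LApply, map_add, map_sum, Derivation.leibniz, smul_eq_mul, S.comm_iter δ hδ,
    Finset.sum_add_distrib, mul_comm (D^[_] z)]
  ring
theorem Sit.exists_op (S : Sit D L K d) (U : LieSubmodule C L Ω) [Module.Finite C U] :
    ∃ a : Fin (Module.finrank C U) → Ω, (∀ i, a i ∈ K) ∧
      (∀ z, LApply D _ a z = 0 ↔ z ∈ U) ∧
      (∀ δ ∈ L, ∀ z, δ (LApply D _ a z) = LApply D _ a (δ z)) := by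
  let b := Module.finBasis C U
  let w : Fin (Module.finrank C U) → Ω := fun i => (b i : Ω)
  have hw : LinearIndependent C w :=
    b.linearIndependent.map' U.toSubmodule.subtype (Submodule.ker_subtype _)
  obtain ⟨a, ha⟩ := _root_.exists_op D S.const w hw
  have hle : U.toSubmodule ≤ LinearMap.ker (opL D _ a) := by
    intro u hu
    have h2 : u = ∑ i, (b.repr ⟨u, hu⟩) i • w i := lsum U b ⟨u, hu⟩
    rw [h2]
    refine Submodule.sum_mem _ fun i _ => Submodule.smul_mem _ _ ?_
    rw [LinearMap.mem_ker, opL_apply]; exact ha i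
  obtain ⟨hf, hfr⟩ := opL_ker_fin D S.const _ a
  have heq : U.toSubmodule = LinearMap.ker (opL D _ a) :=
    Submodule.eq_of_le_of_finrank_le hle hfr
  have hmem : ∀ z, LApply D _ a z = 0 ↔ z ∈ U := by
    intro z
    rw [← LieSubmodule.mem_toSubmodule, heq, LinearMap.mem_ker, opL_apply]
  have hK : ∀ δ ∈ L, ∀ i, δ (a i) = 0 := by
    intro δ hδ
    refine congrFun (wr_row D S.const w hw (fun i => δ (a i)) fun j => ?_)
    have h1 := S.der_LApply δ hδ _ a (w j)
    rw [ha j, map_zero, (hmem (δ (w j))).2 (U.lie_mem (x := ⟨δ, hδ⟩) (b j).2), zero_add] at h1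
    exact h1.symm
  refine ⟨a, fun i => S.inv _ fun δ hδ => hK δ hδ i, hmem, fun δ hδ z => ?_⟩
  rw [S.der_LApply δ hδ]
  simp [hK δ hδ]
theorem Sit.crit1 (S : Sit D L K d) (U : LieSubmodule C L Ω) [Module.Finite C U]
    (hU : Module.finrank C U ≤ d) : ∀ u ∈ U, u ∈ K := by
  obtain ⟨a, haK, hmem, -⟩ := S.exists_op U
  let b := Module.finBasis C U
  have hw : LinearIndependent C (fun i => (b i : Ω)) :=
    b.linearIndependent.map' U.toSubmodule.subtype (Submodule.ker_subtype _)
  have h := S.cl _ hU a haK _ hw fun j => (hmem _).2 (b j).2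
  intro u hu
  refine S.inv u fun δ hδ => ?_
  have h2 : u = ∑ i, (b.repr ⟨u, hu⟩) i • (b i : Ω) := lsum U b ⟨u, hu⟩
  rw [h2, map_sum]
  refine Finset.sum_eq_zero fun i _ => ?_
  rw [δ.map_smul, S.triv δ hδ _ (h i), smul_zero]
theorem Sit.crit1' (S : Sit D L K d) {e : ℕ} (he : e ≤ d) (z : Fin e → Ω)
    (hz : ∀ δ ∈ L, ∀ i, δ (z i) ∈ Submodule.span C (Set.range z)) : ∀ i, z i ∈ K := by
  let U : LieSubmodule C L Ω :=
    { Submodule.span C (Set.range z) with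
      lie_mem := by
        intro x m hm
        change (x : Derivation C Ω Ω) m ∈ Submodule.span C (Set.range z)
        have : Submodule.span C (Set.range z) ≤
            (Submodule.span C (Set.range z)).comap (x.1 : Ω →ₗ[C] Ω) := by
          rw [Submodule.span_le]; rintro _ ⟨i, rfl⟩; exact hz x.1 x.2 i
        exact this hm }
  have hfin : Module.Finite C U :=
    Module.Finite.span_of_finite C (Set.finite_range z)
  have hr : Module.finrank C U ≤ d := by
    refine le_trans ?_ he
    have := finrank_range_le_card (R := C) z
    rw [Fintype.card_fin] at this
    exact this
  intro i
  exact S.crit1 U hr _ (Submodule.subset_span ⟨i, rfl⟩)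
theorem Sit.trace (S : Sit D L K d) (W : LieSubmodule C L Ω) [Module.Finite C W] (x : L) :
    LinearMap.trace C W (LieModule.toEnd C L W x) = 0 := by
  let b := Module.finBasis C W
  let w : Fin (Module.finrank C W) → Ω := fun i => (b i : Ω)
  have hw : LinearIndependent C w :=
    b.linearIndependent.map' W.toSubmodule.subtype (Submodule.ker_subtype _)
  have hdet := wrM_det D S.const w hw
  have key : ∀ x : L, (x : Derivation C Ω Ω) (wrM D w).det =
      algebraMap C Ω (LinearMap.trace C W (LieModule.toEnd C L W x)) * (wrM D w).det := by
    intro x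
    set M : Matrix (Fin (Module.finrank C W)) (Fin (Module.finrank C W)) C := LinearMap.toMatrix b b (LieModule.toEnd C L W x) with hM
    have h1 := der_det ((x : Derivation C Ω Ω).restrictScalars ℤ) (wrM D w)
      (M.map (algebraMap C Ω)) (by
      ext i j
      have h3 : (x : Derivation C Ω Ω) (w j) = ∑ l, M l j • w l := by
        have := lsum W b (LieModule.toEnd C L W x (b j))
        refine Eq.trans ?_ (this.trans ?_)
        · rfl
        · exact Finset.sum_congr rfl fun l _ => by rw [hM, LinearMap.toMatrix_apply]
      have h5 := S.comm_iter x.1 x.2 i (w j)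
      simp only [wrM, Matrix.map_apply, Matrix.of_apply, Matrix.mul_apply]
      refine h5.trans ?_
      rw [h3]
      have h6 : ∀ z, D^[(i : ℕ)] z = ((D : Ω →ₗ[C] Ω) ^ (i : ℕ)) z := fun z => by
        rw [Module.End.pow_apply]; rfl
      rw [h6, map_sum]
      refine Finset.sum_congr rfl fun l _ => ?_
      rw [map_smul, h6, Algebra.smul_def, mul_comm])
    refine h1.trans ?_
    congr 1
    rw [LinearMap.trace_eq_matrix_trace C b, ← hM]
    simp [Matrix.trace]
  have h1 := S.crit1' (e := 1) S.dpos (fun _ => (wrM D w).det) (by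
    intro δ hδ i
    rw [key ⟨δ, hδ⟩, ← Algebra.smul_def]
    exact Submodule.smul_mem _ _ (Submodule.subset_span ⟨i, rfl⟩)) 0
  have h2 := key x
  rw [S.triv x.1 x.2 _ h1] at h2
  have h3 := (mul_eq_zero.1 h2.symm).resolve_right hdet.ne_zero
  simpa using h3
end PartB2

section PartB3a
attribute [local instance] LieRing.ofAssociativeRing
abbrev gIm (C : Type*) (G V : Type*) [CommRing C] [LieRing G] [LieAlgebra C G] [AddCommGroup V]
    [Module C V] [LieRingModule G V] [LieModule C G V] : LieSubalgebra C (Module.End C V) :=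
  (LieModule.toEnd C G V).range
end PartB3a
section PartB3
variable {C Ω : Type u} [Field C] [Field Ω] [Algebra C Ω]
variable {D : Derivation C Ω Ω} {L : LieSubalgebra C (Derivation C Ω Ω)}
    {K : Subfield Ω} {d : ℕ}
def orb (C : Type*) {G V : Type*} [CommRing C] [LieRing G] [LieAlgebra C G] [AddCommGroup V]
    [Module C V] [LieRingModule G V] [LieModule C G V] (y : V) : G →ₗ[C] V :=
  ((LieModule.toEnd C G V : G →ₗ[C] Module.End C V) : G →ₗ[C] V →ₗ[C] V).flip y
@[simp] theorem orb_apply (C : Type*) {G V : Type*} [CommRing C] [LieRing G] [LieAlgebra C G]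
    [AddCommGroup V]
    [Module C V] [LieRingModule G V] [LieModule C G V] (y : V) (x : G) : orb C y x = ⁅x, y⁆ := rfl
theorem lsm_ne_bot {C G V : Type*} [CommRing C] [LieRing G] [LieAlgebra C G] [AddCommGroup V]
    [Module C V] [LieRingModule G V] [LieModule C G V] {U : LieSubmodule C G V} (h : U ≠ ⊥) :
    ∃ u ∈ U, u ≠ 0 := by
  by_contra hc; push Not at hc
  exact h ((LieSubmodule.eq_bot_iff _).2 hc)
theorem Sit.min_choice (S : Sit D L K d) (y : Ω) (hy : y ∉ K) (N : LieSubmodule C L Ω)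
    (hN : Module.Finite C N) (hyN : y ∈ N)
    (hgy : Module.finrank C (LinearMap.range (orb C y : L →ₗ[C] Ω)) ≤ d) :
    ∃ (y : Ω) (V : LieSubmodule C L Ω), Module.Finite C V ∧ y ∈ V ∧ y ∉ K ∧
      Module.finrank C (LinearMap.range (orb C y : L →ₗ[C] Ω)) ≤ d ∧
      ∀ U : LieSubmodule C L Ω, U ≤ V → U ≠ ⊥ → ∀ x : L, ⁅x, y⁆ ∈ U := by
  classical
  let P : ℕ → Prop := fun n => ∃ (y : Ω) (V : LieSubmodule C L Ω), Module.Finite C V ∧ y ∈ V ∧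
    y ∉ K ∧ Module.finrank C (LinearMap.range (orb C y : L →ₗ[C] Ω)) ≤ d ∧ Module.finrank C V = n
  have hP : ∃ n, P n := ⟨_, y, N, hN, hyN, hy, hgy, rfl⟩
  obtain ⟨y, V, hV, hyV, hyK, hg, hn⟩ := Nat.find_spec hP
  refine ⟨y, V, hV, hyV, hyK, hg, fun U hUV hU x => ?_⟩
  have hUf : Module.Finite C U := Submodule.finiteDimensional_of_le (S₂ := V.toSubmodule) hUV
  obtain ⟨a, haK, hmem, hcom⟩ := S.exists_op U
  set T := opL D _ a with hT
  have hTc : ∀ (x : L) z, T ⁅x, z⁆ = ⁅x, T z⁆ := by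
    intro x z; rw [hT, opL_apply, opL_apply]; exact (hcom x.1 x.2 z).symm
  let T' : Ω →ₗ⁅C, L⁆ Ω := { T with map_lie' := fun {x z} => hTc x z }
  have hyT : T y ∈ K := by
    by_contra hc
    have hlt : Module.finrank C (V.map T') < Nat.find hP := by
      rw [← hn]
      let f := T.domRestrict V.toSubmodule
      have h1 := LinearMap.finrank_range_add_finrank_ker f
      have h2 : LinearMap.range f = (V.map T').toSubmodule := by
        rw [LieSubmodule.toSubmodule_map]
        ext z; simp [f, T']
      have h3 : 0 < Module.finrank C (LinearMap.ker f) := by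
        obtain ⟨u, hu, hu0⟩ := lsm_ne_bot hU
        have : Nontrivial (LinearMap.ker f) := by
         refine nontrivial_of_ne ⟨⟨u, hUV hu⟩, ?_⟩ 0 ?_
         · rw [LinearMap.mem_ker]
           change T u = 0
           rw [hT, opL_apply]; exact (hmem u).2 hu
         · intro h
           exact hu0 (congrArg (fun z => ((z : LinearMap.ker f) : V).1) h)
        exact Module.finrank_pos (R := C) (M := LinearMap.ker f)
      rw [h2] at h1
      have h4 : Module.finrank C V.toSubmodule = Module.finrank C V := rfl
      have h5 : Module.finrank C (V.map T').toSubmodule = Module.finrank C (V.map T') := rfl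
      omega
    refine Nat.find_min hP hlt ⟨T y, V.map T', ?_, ?_, hc, ?_, rfl⟩
    · have : Module.Finite C (V.toSubmodule.map T) := inferInstance
      exact this
    · exact (LieSubmodule.mem_map _).2 ⟨y, hyV, rfl⟩
    · have h6 : (orb C (T y) : L →ₗ[C] Ω) = T ∘ₗ orb C y := by
        exact LinearMap.ext fun x => (hTc x y).symm
      rw [h6, LinearMap.range_comp]
      have hfi : Module.Finite C (LinearMap.range (orb C y : L →ₗ[C] Ω)) := by
        refine Submodule.finiteDimensional_of_le (S₂ := V.toSubmodule) ?_
        rintro _ ⟨x, rfl⟩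
        exact V.lie_mem hyV
      exact (Submodule.finrank_map_le _ _).trans hg
  rw [← hmem, ← opL_apply]
  have := hTc x y
  rw [← hT, this, lie_eq]
  exact S.triv x.1 x.2 _ hyT
theorem reduce_abs {C G0 M0 : Type*} [Field C] [CharZero C] [IsAlgClosed C] [LieRing G0]
    [LieAlgebra C G0]
    [AddCommGroup M0] [Module C M0] [LieRingModule G0 M0] [LieModule C G0 M0] (d : ℕ) (y : M0)
    (V W : LieSubmodule C G0 M0) (hV : Module.Finite C V) (hyV : y ∈ V)
    (hWm : ∀ x : G0, ⁅x, y⁆ ∈ W) (hWV : W ≤ V) (hWf : Module.Finite C W)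
    (hWle : ∀ U : LieSubmodule C G0 M0, U ≤ V → U ≠ ⊥ → W ≤ U)
    (hWd : d < Module.finrank C W) (htr : ∀ x : G0, LinearMap.trace C W (LieModule.toEnd C G0 W x) = 0)
    (x0 : G0) (hx0 : ⁅x0, y⁆ ≠ 0)
    (hg : Module.finrank C (LinearMap.range (orb C y : G0 →ₗ[C] M0)) ≤ d) :
    ∃ (V : LieSubmodule C G0 M0), Module.Finite C V ∧
      LieAlgebra.HasTrivialRadical C (gIm C G0 V) ∧
      ∃ y : V, (∃ x : (gIm C G0 V), ⁅x, y⁆ ≠ 0) ∧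
      Module.finrank C (LinearMap.range (orb C y : (gIm C G0 V) →ₗ[C] V)) ≤ d := by
  let V' : LieSubmodule C G0 M0 :=
    { Submodule.span C {y} ⊔ W.toSubmodule with
      lie_mem := by
        intro x m hm
        obtain ⟨a, ha, b, hb, rfl⟩ := Submodule.mem_sup.1 hm
        obtain ⟨c, rfl⟩ := Submodule.mem_span_singleton.1 ha
        rw [lie_add, lie_smul]
        exact Submodule.mem_sup_right (W.add_mem (W.smul_mem c (hWm x)) (W.lie_mem hb)) }
  have hyV' : y ∈ V' := Submodule.mem_sup_left (Submodule.mem_span_singleton_self y)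
  have hWV' : W ≤ V' := fun w hw => Submodule.mem_sup_right hw
  have hV'f : Module.Finite C V' := by
    have : Module.Finite C (Submodule.span C {y} ⊔ W.toSubmodule : Submodule C M0) := by
      have : Module.Finite C W.toSubmodule := hWf
      infer_instance
    exact this
  have hker : ∀ x : G0, (∀ w ∈ W, ⁅x, w⁆ = 0) → ⁅x, y⁆ = 0 := by
    by_contra hcon
    push Not at hcon
    obtain ⟨x1, hx1, hx1y⟩ := hcon
    let n : Submodule C G0 :=
      { carrier := {x | ∀ w ∈ W, ⁅x, w⁆ = 0}
        add_mem' := by intro a b ha hb w hw; rw [add_lie, ha w hw, hb w hw, add_zero]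
        zero_mem' := by intro w hw; exact zero_lie w
        smul_mem' := by intro c a ha w hw; rw [smul_lie, ha w hw, smul_zero] }
    let U : LieSubmodule C G0 M0 :=
      { n.map (orb C y) with
        lie_mem := by
          rintro x _ ⟨z, hz, rfl⟩
          refine ⟨⁅x, z⁆, ?_, ?_⟩
          · intro w hw
            rw [lie_lie, hz w hw, lie_zero, hz _ (W.lie_mem hw), sub_zero]
          · rw [orb_apply, orb_apply, lie_lie, hz _ (hWm x), sub_zero] }
    have hUV : U ≤ V := by
      rintro _ ⟨z, hz, rfl⟩; exact V.lie_mem hyV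
    have hU0 : U ≠ ⊥ := by
      intro h
      have : ⁅x1, y⁆ ∈ U := ⟨x1, hx1, rfl⟩
      rw [h] at this; exact hx1y this
    have h1 := hWle U hUV hU0
    have h2 : W.toSubmodule ≤ LinearMap.range (orb C y : G0 →ₗ[C] M0) := by
      intro w hw
      obtain ⟨z, -, hz⟩ := h1 hw
      exact ⟨z, hz⟩
    have hfi : Module.Finite C (LinearMap.range (orb C y : G0 →ₗ[C] M0)) := by
      refine Submodule.finiteDimensional_of_le (S₂ := V.toSubmodule) ?_
      rintro _ ⟨x, rfl⟩
      exact V.lie_mem hyV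
    have h3 := Submodule.finrank_mono h2
    have h4 : Module.finrank C W.toSubmodule = Module.finrank C W := rfl
    omega
  refine ⟨V', hV'f, ?_, ⟨y, hyV'⟩, ?_, ?_⟩
  · set G := (gIm C G0 V') with hG
    let W' : LieSubmodule C G V' :=
      { W.toSubmodule.comap V'.toSubmodule.subtype with
        lie_mem := by
          rintro ⟨g, x, rfl⟩ m hm
          exact W.lie_mem (x := x) hm }
    have hact : ∀ (x : G0) (v : V'), ((⁅(⟨LieModule.toEnd C G0 V' x, x, rfl⟩ : G), v⁆ : V') : M0) = ⁅x, (v : M0)⁆ :=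
      fun x v => rfl
    have hnt : Nontrivial W' := by
      refine nontrivial_of_ne ⟨⟨⁅x0, y⁆, hWV' (hWm x0)⟩, hWm x0⟩ 0 ?_
      intro h
      exact hx0 (congrArg (fun z : W' => ((z : V') : M0)) h)
    refine hasTrivialRadical_of_irr (W := W') ?_ ?_ ?_
    · intro M hM
      let U : LieSubmodule C G0 M0 :=
        { M.toSubmodule.map (V'.toSubmodule.subtype ∘ₗ W'.toSubmodule.subtype) with
          lie_mem := by
            rintro x _ ⟨z, hz, rfl⟩
            exact ⟨(⁅(⟨LieModule.toEnd C G0 V' x, x, rfl⟩ : G), (show W' from z)⁆ : W'), M.lie_mem hz, rfl⟩ }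
      have hUV : U ≤ V := by
        rintro _ ⟨z, hz, rfl⟩; exact hWV z.2
      have hU0 : U ≠ ⊥ := by
        intro h
        obtain ⟨m, hm, hm0⟩ := lsm_ne_bot hM
        have : ((m : V') : M0) ∈ U := ⟨m, hm, rfl⟩
        rw [h] at this
        exact hm0 (Subtype.ext (Subtype.ext this))
      have h1 := hWle U hUV hU0
      rw [eq_top_iff]
      intro z _
      obtain ⟨z', hz', he⟩ := h1 (z.2 : ((z : V') : M0) ∈ W)
      have : z' = z := Subtype.ext (Subtype.ext he)
      rw [← this]; exact hz'
    · rintro ⟨g, x, rfl⟩ h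
      have h1 : ∀ w ∈ W, ⁅x, w⁆ = 0 := by
        intro w hw
        have := h ⟨⟨w, hWV' hw⟩, hw⟩
        exact congrArg (fun z : W' => ((z : V') : M0)) this
      apply Subtype.ext
      ext ⟨v, hv⟩
      change ⁅x, v⁆ = 0
      obtain ⟨a, ha, b, hb, rfl⟩ := Submodule.mem_sup.1 hv
      obtain ⟨c, rfl⟩ := Submodule.mem_span_singleton.1 ha
      rw [lie_add, lie_smul, hker x h1, h1 b hb, smul_zero, add_zero]
    · rintro ⟨g, x, rfl⟩
      rw [← htr x]
      let e : W ≃ₗ[C] W' :=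
        { toFun := fun w => ⟨⟨w.1, hWV' w.2⟩, w.2⟩
          invFun := fun w => ⟨w.1.1, w.2⟩
          map_add' := fun _ _ => rfl
          map_smul' := fun _ _ => rfl
          left_inv := fun _ => rfl
          right_inv := fun _ => rfl }
      rw [← LinearMap.trace_conj' _ e]
      rfl
  · exact ⟨⟨LieModule.toEnd C G0 V' x0, x0, rfl⟩, fun h => hx0 (congrArg Subtype.val h)⟩
  · set G := (gIm C G0 V') with hG
    have h1 : (LinearMap.range (orb C ⟨y, hyV'⟩ : G →ₗ[C] V')).map V'.toSubmodule.subtype ≤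
        LinearMap.range (orb C y : G0 →ₗ[C] M0) := by
      rintro _ ⟨_, ⟨⟨g, x, rfl⟩, rfl⟩, rfl⟩
      exact ⟨x, rfl⟩
    have hfi : Module.Finite C (LinearMap.range (orb C y : G0 →ₗ[C] M0)) := by
      refine Submodule.finiteDimensional_of_le (S₂ := V.toSubmodule) ?_
      rintro _ ⟨x, rfl⟩
      exact V.lie_mem hyV
    have h2 := Submodule.finrank_mono h1
    have h5 := Submodule.finrank_map_subtype_eq V'.toSubmodule (LinearMap.range (orb C ⟨y, hyV'⟩ : G →ₗ[C] V'))
    rw [h5] at h2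
    exact h2.trans hg
theorem Sit.reduce [CharZero C] [IsAlgClosed C] (S : Sit D L K d) (y : Ω) (hy : y ∉ K)
    (N : LieSubmodule C L Ω)
    (hN : Module.Finite C N) (hyN : y ∈ N)
    (hgy : Module.finrank C (LinearMap.range (orb C y : L →ₗ[C] Ω)) ≤ d) :
    ∃ (V : LieSubmodule C L Ω), Module.Finite C V ∧
      LieAlgebra.HasTrivialRadical C (gIm C L V) ∧
      ∃ y : V, (∃ x : (gIm C L V), ⁅x, y⁆ ≠ 0) ∧
      Module.finrank C (LinearMap.range (orb C y : (gIm C L V) →ₗ[C] V)) ≤ d := by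
  obtain ⟨y, V, hV, hyV, hyK, hg, hmin⟩ := S.min_choice y hy N hN hyN hgy
  obtain ⟨x0, hx0⟩ : ∃ x : L, ⁅x, y⁆ ≠ 0 := by
    by_contra h; push Not at h
    exact hyK (S.inv y fun δ hδ => h ⟨δ, hδ⟩)
  set W : LieSubmodule C L Ω := LieSubmodule.lieSpan C L {z | ∃ x : L, ⁅x, y⁆ = z} with hW
  have hWm : ∀ x : L, ⁅x, y⁆ ∈ W := fun x => LieSubmodule.subset_lieSpan ⟨x, rfl⟩
  have hWle : ∀ U : LieSubmodule C L Ω, U ≤ V → U ≠ ⊥ → W ≤ U := by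
    intro U h1 h2
    rw [hW, LieSubmodule.lieSpan_le]
    rintro _ ⟨x, rfl⟩
    exact hmin U h1 h2 x
  have hWV : W ≤ V := by
    rw [hW, LieSubmodule.lieSpan_le]
    rintro _ ⟨x, rfl⟩
    exact V.lie_mem hyV
  have hWf : Module.Finite C W := Submodule.finiteDimensional_of_le (S₂ := V.toSubmodule) hWV
  have hWd : d < Module.finrank C W := by
    by_contra hle
    push Not at hle
    have hWK := S.crit1 W hle
    set w := ⁅x0, y⁆ with hw
    have hwK : w ∈ K := hWK _ (hWm x0)
    have hspan : ∀ x : L, ⁅x, y⁆ ∈ Submodule.span C {w} := by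
      let U : LieSubmodule C L Ω :=
        { Submodule.span C {w} with
          lie_mem := by
            intro x m hm
            obtain ⟨c, rfl⟩ := Submodule.mem_span_singleton.1 hm
            have : ⁅x, c • w⁆ = 0 := by
              exact ((x : Derivation C Ω Ω).map_smul c w).trans (by rw [S.triv x.1 x.2 _ hwK, smul_zero])
            rw [this]; exact Submodule.zero_mem _ }
      have hU : w ∈ U := Submodule.mem_span_singleton_self w
      intro x
      refine hmin U ?_ ?_ x
      · intro m hm
        obtain ⟨c, rfl⟩ := Submodule.mem_span_singleton.1 hm
        exact V.smul_mem c (hWV (hWm x0))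
      · intro h; rw [h] at hU; exact hx0 hU
    rcases Nat.lt_or_ge 1 d with h1 | h1
    · refine hyK (S.crit1' (e := 2) h1 ![y, w] ?_ 0)
      intro δ hδ i
      have hh : Submodule.span C {w} ≤ Submodule.span C (Set.range ![y, w]) :=
        Submodule.span_mono (by simp)
      fin_cases i
      · exact hh (hspan ⟨δ, hδ⟩)
      · simp [S.triv δ hδ w hwK]
    · have h1 : d = 1 := le_antisymm h1 S.dpos
      have h2 : D (y / w) ∈ K := by
        refine S.inv _ fun δ hδ => ?_
        rw [S.comm δ hδ]
        obtain ⟨c, hc⟩ := Submodule.mem_span_singleton.1 (hspan ⟨δ, hδ⟩)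
        have hc' : δ y = c • w := hc.symm
        have h3 : δ (y / w) = algebraMap C Ω c := by
          rw [div_eq_mul_inv, Derivation.leibniz, Derivation.leibniz_inv, S.triv δ hδ w hwK, hc']
          simp only [smul_eq_mul, Algebra.smul_def]
          field_simp
          ring
        rw [h3, Derivation.map_algebraMap]
      have h3 := S.cl1 h1 _ h2
      have h4 := K.mul_mem h3 hwK
      rw [div_mul_cancel₀ _ hx0] at h4
      exact hyK h4
  exact reduce_abs d y V W hV hyV hWm hWV hWf hWle hWd (fun x => S.trace W x) x0 hx0 hg
end PartB3

section PartC1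
variable {C Ω : Type u} [Field C] [Field Ω] [Algebra C Ω]
theorem descent {ι : Type*} [Fintype ι] (Δ : Set (Derivation C Ω Ω)) (N : Submodule Ω (ι → Ω))
    (hN : ∀ δ ∈ Δ, ∀ v ∈ N, (fun i => δ (v i)) ∈ N) :
    N ≤ Submodule.span Ω {v | v ∈ N ∧ ∀ i, ∀ δ ∈ Δ, δ (v i) = 0} := by
  classical
  suffices h : ∀ s : Finset ι, ∀ v ∈ N, (∀ i, i ∉ s → v i = 0) →
      v ∈ Submodule.span Ω {v | v ∈ N ∧ ∀ i, ∀ δ ∈ Δ, δ (v i) = 0} from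
    fun v hv => h Finset.univ v hv fun i hi => absurd (Finset.mem_univ i) hi
  intro s
  induction s using Finset.strongInduction with
  | H s ih =>
  intro v hv hvs
  by_cases hv0 : v = 0
  · rw [hv0]; exact Submodule.zero_mem _
  by_cases hu : ∃ u ∈ N, u ≠ 0 ∧ ∃ t, t ⊂ s ∧ ∀ i, i ∉ t → u i = 0
  · obtain ⟨u, huN, hu0, t, hts, hut⟩ := hu
    obtain ⟨i, hi⟩ := Function.ne_iff.1 hu0
    have hit : i ∈ t := by by_contra h; exact hi (hut i h)
    have h1 := ih t hts u huN hut
    have h2 : v - (v i / u i) • u ∈ N := N.sub_mem hv (N.smul_mem _ huN)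
    have h3 := ih (s.erase i) (Finset.erase_ssubset (hts.1 hit)) _ h2 (by
      intro j hj
      by_cases hji : j = i
      · subst hji
        have : u j ≠ 0 := hi
        simp [this]
      · have hjs : j ∉ s := fun h => hj (Finset.mem_erase.2 ⟨hji, h⟩)
        simp [hvs j hjs, hut j (fun h => hjs (hts.1 h))])
    have h4 := Submodule.add_mem _ h3 (Submodule.smul_mem _ (v i / u i) h1)
    rwa [sub_add_cancel] at h4
  · push Not at hu
    obtain ⟨i, hi⟩ := Function.ne_iff.1 hv0
    have hi' : v i ≠ 0 := hi
    have his : i ∈ s := by by_contra h; exact hi (hvs i h)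
    set u := (v i)⁻¹ • v with hu'
    have huN : u ∈ N := N.smul_mem _ hv
    have hv' : v = v i • u := by rw [hu', smul_smul, mul_inv_cancel₀ hi', one_smul]
    rw [hv']
    refine Submodule.smul_mem _ _ (Submodule.subset_span ⟨huN, ?_⟩)
    intro j δ hδ
    by_contra hne
    obtain ⟨k, hk, hk2⟩ := hu _ (hN δ hδ u huN) (Function.ne_iff.2 ⟨j, hne⟩) (s.erase i)
      (Finset.erase_ssubset his)
    apply hk2
    by_cases hki : k = i
    · subst hki
      simp [hu', hi']
    · simp [hu', hvs k (fun h => hk (Finset.mem_erase.2 ⟨hki, h⟩))]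
theorem burnside {C Q : Type*} [Field C] [IsAlgClosed C] [AddCommGroup Q] [Module C Q]
    [Module.Finite C Q] [Nontrivial Q] (A : Subalgebra C (Module.End C Q))
    (h : ∀ N : Submodule C Q, (∀ a ∈ A, ∀ q ∈ N, a q ∈ N) → N ≠ ⊥ → N = ⊤) : A = ⊤ := by
  have hs : IsSimpleModule A Q := by
    rw [isSimpleModule_iff]
    refine ⟨fun N => ?_⟩
    by_cases hN : N = ⊥
    · exact Or.inl hN
    · right
      have := h (N.restrictScalars C) (fun a ha q hq => N.smul_mem (⟨a, ha⟩ : A) hq) (by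
        simpa using hN)
      simpa using this
  have hb := IsSimpleModule.algebraMap_end_bijective_of_isAlgClosed (A := A) (V := Q) C
  rw [eq_top_iff]
  intro f _
  let f' : Module.End (Module.End A Q) Q :=
    { toFun := f
      map_add' := f.map_add
      map_smul' := by
        intro g q
        obtain ⟨c, rfl⟩ := hb.2 g
        exact f.map_smul c q }
  obtain ⟨s, hs⟩ := Module.Finite.fg_top (R := C) (M := Q)
  obtain ⟨r, hr⟩ := jacobson_density (R := A) f' s
  have : f = r.1 := by
    refine LinearMap.ext_on (s := (s : Set Q)) hs ?_
    intro m hm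
    exact hr m hm
  rw [this]; exact r.2
end PartC1

section PartC2
variable {C Ω : Type u} [Field C] [Field Ω] [Algebra C Ω]
def extL (Ω : Type*) {C : Type*} [Field C] [Field Ω] [Algebra C Ω] {m e : ℕ}
    (r : Matrix (Fin m) (Fin m) C →ₗ[C] Matrix (Fin e) (Fin e) C) :
    Matrix (Fin m) (Fin m) Ω →ₗ[Ω] Matrix (Fin e) (Fin e) Ω where
  toFun X := ∑ a, ∑ b, X a b • (r (Matrix.single a b 1)).map (algebraMap C Ω)
  map_add' X Y := by simp [add_smul, Finset.sum_add_distrib]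
  map_smul' c X := by simp [mul_smul, Finset.smul_sum]
theorem extL_map {m e : ℕ} (r : Matrix (Fin m) (Fin m) C →ₗ[C] Matrix (Fin e) (Fin e) C)
    (X : Matrix (Fin m) (Fin m) C) :
    extL Ω r (X.map (algebraMap C Ω)) = (r X).map (algebraMap C Ω) := by
  conv_rhs => rw [Matrix.matrix_eq_sum_single X]
  have : ∀ a b, Matrix.single a b (X a b) = X a b • Matrix.single a b (1 : C) := by
    intro a b; simp [Matrix.smul_single]
  simp only [this, map_sum, map_smul]
  ext i j
  simp [extL, Matrix.sum_apply]
  simp only [Algebra.smul_def]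
theorem extL_der {m e : ℕ} (r : Matrix (Fin m) (Fin m) C →ₗ[C] Matrix (Fin e) (Fin e) C)
    (δ : Derivation C Ω Ω) (X : Matrix (Fin m) (Fin m) Ω) :
    (extL Ω r X).map δ = extL Ω r (X.map δ) := by
  ext i j
  simp [extL, Matrix.sum_apply, mul_comm]
theorem map_der_mul {ι : Type*} [Fintype ι] (δ : Derivation C Ω Ω) (X Y : Matrix ι ι Ω) :
    (X * Y).map δ = X.map δ * Y + X * Y.map δ := by
  ext i j
  simp [Matrix.mul_apply, Finset.sum_add_distrib, mul_comm, add_comm]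
theorem map_der_const {ι : Type*} (δ : Derivation C Ω Ω) (X : Matrix ι ι C) :
    (X.map (algebraMap C Ω)).map δ = 0 := by
  ext i j; simp
theorem horiz_span {m : ℕ} (L : Set (Derivation C Ω Ω)) (M : L → Matrix (Fin m) (Fin m) C)
    (hM : ∀ x y, ∃ z, M z = M x * M y - M y * M x)
    (F : Matrix (Fin m) (Fin m) Ω) (hF : IsUnit F.det)
    (hFM : ∀ x : L, F.map x.1 = F * (M x).map (algebraMap C Ω)) (x0 : L) :
    (M x0).map (algebraMap C Ω) ∈ Submodule.span Ω
      {X | X ∈ Submodule.span Ω (Set.range fun x => (M x).map (algebraMap C Ω)) ∧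
        ∀ x : L, X.map x.1 = X * (M x).map (algebraMap C Ω) - (M x).map (algebraMap C Ω) * X} := by
  classical
  set g := Submodule.span Ω (Set.range fun x => (M x).map (algebraMap C Ω)) with hg
  have hgd : ∀ (x : L), ∀ X ∈ g, X.map x.1 ∈ g := by
    intro x X hX
    induction hX using Submodule.span_induction with
    | mem X hX => obtain ⟨y, rfl⟩ := hX; rw [map_der_const]; exact Submodule.zero_mem _
    | zero => rw [show (0 : Matrix (Fin m) (Fin m) Ω).map x.1 = 0 by ext; simp]; exact Submodule.zero_mem _
    | add X Y _ _ h1 h2 =>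
      rw [show (X + Y).map x.1 = X.map x.1 + Y.map x.1 by ext; simp]
      exact Submodule.add_mem _ h1 h2
    | smul c X hX h =>
      rw [show (c • X).map x.1 = c • X.map x.1 + x.1 c • X by
        ext i j; simp [mul_comm]]
      exact Submodule.add_mem _ (Submodule.smul_mem _ _ h) (Submodule.smul_mem _ _ hX)
  have hgb : ∀ (x : L), ∀ X ∈ g, (M x).map (algebraMap C Ω) * X - X * (M x).map (algebraMap C Ω) ∈ g := by
    intro x X hX
    induction hX using Submodule.span_induction with
    | mem X hX =>
      obtain ⟨y, rfl⟩ := hX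
      obtain ⟨z, hz⟩ := hM x y
      refine Submodule.subset_span ⟨z, ?_⟩
      simp only [hz, ← Matrix.map_mul]
      exact Matrix.map_sub _ (map_sub _) _ _
    | zero => simp
    | add X Y _ _ h1 h2 =>
      convert Submodule.add_mem _ h1 h2 using 1
      noncomm_ring
    | smul c X hX h =>
      convert Submodule.smul_mem _ c h using 1
      simp [smul_sub]
  let toM : (Fin m × Fin m → Ω) →ₗ[Ω] Matrix (Fin m) (Fin m) Ω :=
    { toFun := fun v => Matrix.of fun i j => v (i, j)
      map_add' := fun _ _ => rfl
      map_smul' := fun _ _ => rfl }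
  let cj : Matrix (Fin m) (Fin m) Ω →ₗ[Ω] Matrix (Fin m) (Fin m) Ω :=
    { toFun := fun T => F⁻¹ * T * F
      map_add' := fun _ _ => by noncomm_ring
      map_smul' := fun c T => by simp }
  have hFi : F * F⁻¹ = 1 := Matrix.mul_nonsing_inv _ hF
  have hiF : F⁻¹ * F = 1 := Matrix.nonsing_inv_mul _ hF
  have hkey : ∀ (x : L) (T : Matrix (Fin m) (Fin m) Ω), cj (T.map x.1) =
      (cj T).map x.1 + ((M x).map (algebraMap C Ω) * cj T - cj T * (M x).map (algebraMap C Ω)) := by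
    intro x T
    have h1 : T * F = F * cj T := by
      change _ = F * (F⁻¹ * T * F); rw [← mul_assoc, ← mul_assoc, hFi, one_mul]
    have h2 := congrArg (fun Z : Matrix (Fin m) (Fin m) Ω => F⁻¹ * Z.map x.1) h1
    simp only [map_der_mul, hFM, mul_add] at h2
    have h3 : F⁻¹ * (F * (M x).map (algebraMap C Ω) * cj T) = (M x).map (algebraMap C Ω) * cj T := by
      rw [mul_assoc, ← mul_assoc F⁻¹ F, hiF, one_mul]
    have h4 : F⁻¹ * (F * (cj T).map x.1) = (cj T).map x.1 := by
      rw [← mul_assoc F⁻¹ F, hiF, one_mul]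
    have h5 : F⁻¹ * (T * (F * (M x).map (algebraMap C Ω))) = cj T * (M x).map (algebraMap C Ω) := by
      change _ = F⁻¹ * T * F * _; simp only [mul_assoc]
    rw [h3, h4, h5, ← mul_assoc] at h2
    change cj (T.map x.1) + _ = _ at h2
    rw [← sub_eq_iff_eq_add.2 h2.symm]
    abel
  let N : Submodule Ω (Fin m × Fin m → Ω) := g.comap (cj ∘ₗ toM)
  have hN := descent L N (by
    intro δ hδ v hv
    change cj ((toM v).map δ) ∈ g
    rw [hkey ⟨δ, hδ⟩]
    exact Submodule.add_mem _ (hgd ⟨δ, hδ⟩ _ hv) (hgb ⟨δ, hδ⟩ _ hv))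
  let v0 : Fin m × Fin m → Ω := fun p => (F * (M x0).map (algebraMap C Ω) * F⁻¹) p.1 p.2
  have hv0 : cj (toM v0) = (M x0).map (algebraMap C Ω) := by
    change F⁻¹ * (F * (M x0).map (algebraMap C Ω) * F⁻¹) * F = _
    rw [← mul_assoc, ← mul_assoc, hiF, one_mul, mul_assoc, hiF, mul_one]
  have hv0N : v0 ∈ N := by
    change cj (toM v0) ∈ g
    rw [hv0]; exact Submodule.subset_span ⟨x0, rfl⟩
  have h1 := Submodule.mem_map_of_mem (f := cj ∘ₗ toM) (hN hv0N)
  rw [LinearMap.comp_apply, hv0, Submodule.map_span] at h1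
  refine Submodule.span_mono ?_ h1
  rintro _ ⟨v, ⟨hv, hvc⟩, rfl⟩
  refine ⟨hv, fun x => ?_⟩
  have h2 := hkey x (toM v)
  have h3 : (toM v).map x.1 = 0 := by ext i j; exact hvc (i, j) x.1 x.2
  rw [h3, map_zero] at h2
  rw [LinearMap.comp_apply]
  rw [eq_comm, add_eq_zero_iff_eq_neg] at h2
  rw [h2]; abel
end PartC2

section PartC3
variable {C Ω : Type u} [Field C] [Field Ω] [Algebra C Ω]
def horizB (L : Set (Derivation C Ω Ω)) (K : Subfield Ω) (triv : ∀ δ ∈ L, ∀ a ∈ K, δ a = 0)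
    {e : ℕ} (A : L → Matrix (Fin e) (Fin e) Ω) :
    Subalgebra K (Matrix (Fin e) (Fin e) Ω) where
  carrier := {Y | ∀ x : L, Y.map x.1 = Y * A x - A x * Y}
  mul_mem' := by
    intro Y Z hY hZ x
    rw [map_der_mul, hY x, hZ x]; noncomm_ring
  add_mem' := by
    intro Y Z hY hZ x
    rw [show (Y + Z).map x.1 = Y.map x.1 + Z.map x.1 by ext; simp, hY x, hZ x]; noncomm_ring
  algebraMap_mem' := by
    intro c x
    rw [Algebra.algebraMap_eq_smul_one]
    have h : (c • (1 : Matrix (Fin e) (Fin e) Ω)).map x.1 = 0 := by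
      ext i j
      have h0 : (c • (1 : Matrix (Fin e) (Fin e) Ω)) i j = if i = j then (c : Ω) else 0 := by
        rw [Matrix.smul_apply, Matrix.one_apply, Subfield.smul_def]; split_ifs <;> simp
      rw [Matrix.map_apply, h0]
      split_ifs
      · exact triv x.1 x.2 c c.2
      · simp
    rw [h]; simp
theorem horizB_li (L : Set (Derivation C Ω Ω)) (K : Subfield Ω) (triv : ∀ δ ∈ L, ∀ a ∈ K, δ a = 0)
    (inv : ∀ a, (∀ δ ∈ L, δ a = 0) → a ∈ K)
    {e : ℕ} (A : L → Matrix (Fin e) (Fin e) Ω) {ι : Type*} (b : ι → horizB L K triv A)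
    (hb : LinearIndependent K b) :
    LinearIndependent Ω (fun i => (b i : Matrix (Fin e) (Fin e) Ω)) := by
  classical
  rw [linearIndependent_iff_finset_linearIndependent]
  intro s
  have hb' : LinearIndependent K (b ∘ ((↑) : s → ι)) := hb.comp _ Subtype.val_injective
  rw [Fintype.linearIndependent_iff]
  intro c hc
  let N : Submodule Ω (s → Ω) :=
    LinearMap.ker (Fintype.linearCombination Ω (fun i : s => (b i : Matrix (Fin e) (Fin e) Ω)))
  have hmem : ∀ v : s → Ω, v ∈ N ↔ ∑ i, v i • (b i : Matrix (Fin e) (Fin e) Ω) = 0 := by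
    intro v; rw [LinearMap.mem_ker, Fintype.linearCombination_apply]
  have hN := descent L N (by
    intro δ hδ v hv
    rw [hmem] at hv ⊢
    have h1 := congrArg (fun Z : Matrix (Fin e) (Fin e) Ω => Z.map δ) hv
    have h2 : (∑ i, v i • (b i : Matrix (Fin e) (Fin e) Ω)).map δ =
        ∑ i, δ (v i) • (b i : Matrix (Fin e) (Fin e) Ω) +
        ((∑ i, v i • (b i : Matrix (Fin e) (Fin e) Ω)) * A ⟨δ, hδ⟩ -
          A ⟨δ, hδ⟩ * (∑ i, v i • (b i : Matrix (Fin e) (Fin e) Ω))) := by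
      have h3 : (∑ i, v i • (b i : Matrix (Fin e) (Fin e) Ω)).map δ =
        ∑ i, (δ (v i) • (b i : Matrix (Fin e) (Fin e) Ω) + v i • (b i : Matrix (Fin e) (Fin e) Ω).map δ) := by
        ext p q
        simp [Matrix.sum_apply, mul_comm, add_comm]
      rw [h3, Finset.sum_add_distrib, Finset.sum_mul, Finset.mul_sum, ← Finset.sum_sub_distrib]
      congr 1
      refine Finset.sum_congr rfl fun i _ => ?_
      rw [(b i).2 ⟨δ, hδ⟩]; simp [smul_sub]
    rw [hv, zero_mul, mul_zero, sub_zero, add_zero] at h2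
    rw [← h2]; ext; simp)
  have hc' : c ∈ N := (hmem c).2 hc
  have h5 := hN hc'
  have h6 : Submodule.span Ω {v | v ∈ N ∧ ∀ i, ∀ δ ∈ L, δ (v i) = 0} = ⊥ := by
    rw [Submodule.span_eq_bot]
    rintro v ⟨hv, hvc⟩
    rw [hmem] at hv
    let v' : s → K := fun i => ⟨v i, inv _ (hvc i)⟩
    have h7 := Fintype.linearIndependent_iff.1 hb' v' (by
      apply Subtype.ext
      refine Eq.trans ?_ hv
      simp [v', Subfield.smul_def])
    ext i
    exact congrArg Subtype.val (h7 i)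
  rw [h6, Submodule.mem_bot] at h5
  intro i; rw [h5]; rfl
theorem horizB_matrix (L : Set (Derivation C Ω Ω)) (K : Subfield Ω)
    (triv : ∀ δ ∈ L, ∀ a ∈ K, δ a = 0)
    (inv : ∀ a, (∀ δ ∈ L, δ a = 0) → a ∈ K) [IsAlgClosed K]
    {e : ℕ} (he : 0 < e) (A : L → Matrix (Fin e) (Fin e) Ω)
    (hsp : Submodule.span Ω (horizB L K triv A : Set (Matrix (Fin e) (Fin e) Ω)) = ⊤) :
    Nonempty (horizB L K triv A ≃ₐ[K] Matrix (Fin e) (Fin e) K) := by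
  classical
  have : NeZero e := ⟨he.ne'⟩
  set B := horizB L K triv A with hB
  let b := Module.Free.chooseBasis K B
  have hli := horizB_li L K triv inv A b b.linearIndependent
  have hfin : Finite (Module.Free.ChooseBasisIndex K B) := hli.finite
  have := Fintype.ofFinite (Module.Free.ChooseBasisIndex K B)
  have hspb : ⊤ ≤ Submodule.span Ω (Set.range fun i => (b i : Matrix (Fin e) (Fin e) Ω)) := by
    rw [← hsp, Submodule.span_le]
    intro Y hY
    have h1 := b.sum_repr ⟨Y, hY⟩
    have h2 := congrArg Subtype.val h1
    rw [← (show _ = Y from h2)]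
    simp only [AddSubmonoidClass.coe_finsetSum]
    refine Submodule.sum_mem _ fun i _ => ?_
    exact Submodule.smul_mem _ ((b.repr ⟨Y, hY⟩ i : K) : Ω) (Submodule.subset_span ⟨i, rfl⟩)
  let β := Module.Basis.mk hli hspb
  have hBf : Module.Finite K B := Module.Finite.of_basis b
  have hdim : Module.finrank K B = e * e := by
    rw [Module.finrank_eq_card_basis b, ← Module.finrank_eq_card_basis β, Module.finrank_matrix]
    simp
  have hsimp : IsSimpleRing B := by
    have : Nontrivial B := by
      refine nontrivial_of_ne 1 0 ?_
      intro h
      exact one_ne_zero (α := Matrix (Fin e) (Fin e) Ω) (congrArg Subtype.val h)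
    refine ⟨⟨fun I => ?_⟩⟩
    by_cases hI : I = ⊥
    · exact Or.inl hI
    right
    obtain ⟨Y0, hY0, hY00⟩ : ∃ Y ∈ I, Y ≠ 0 := by
      by_contra hc; push Not at hc
      apply hI
      rw [eq_bot_iff]
      intro x hx
      exact (TwoSidedIdeal.mem_bot _).2 (hc x hx)
    let IK : Submodule K B :=
      { carrier := {Y | Y ∈ I}
        add_mem' := fun h1 h2 => I.add_mem h1 h2
        zero_mem' := I.zero_mem
        smul_mem' := fun c Y hY => by
          change c • Y ∈ I
          rw [Algebra.smul_def]; exact I.mul_mem_left _ _ hY }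
    have h1I : (1 : B) ∈ IK := by
      by_contra h1
      obtain ⟨f, hf1, hfI⟩ := Submodule.exists_le_ker_of_notMem h1
      let fΩ : Matrix (Fin e) (Fin e) Ω →ₗ[Ω] Ω := β.constr Ω (fun i => ((f (b i) : K) : Ω))
      have hfΩ : ∀ Y : B, fΩ Y = ((f Y : K) : Ω) := by
        intro Y
        have hY : (Y : Matrix (Fin e) (Fin e) Ω) = ∑ i, ((b.repr Y i : K) : Ω) • β i := by
          conv_lhs => rw [← b.sum_repr Y]
          simp only [AddSubmonoidClass.coe_finsetSum, β, Module.Basis.mk_apply]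
          rfl
        rw [hY, map_sum]
        conv_rhs => rw [← b.sum_repr Y, map_sum]
        simp [fΩ, Module.Basis.constr_basis]
      let J : TwoSidedIdeal (Matrix (Fin e) (Fin e) Ω) :=
        .mk' {Z | ∀ P Q, fΩ (P * Z * Q) = 0} (by simp) (by
            intro x y hx hy P Q; rw [mul_add, add_mul, map_add, hx, hy, add_zero]) (by
            intro x hx P Q; rw [mul_neg, neg_mul, map_neg, hx, neg_zero]) (by
            intro x y hy P Q; rw [← mul_assoc]; exact hy _ _) (by
            intro x y hx P Q; rw [← mul_assoc, mul_assoc (P * x)]; exact hx _ _)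
      have hY0J : (Y0 : Matrix (Fin e) (Fin e) Ω) ∈ J := by
        rw [TwoSidedIdeal.mem_mk']
        intro P Q
        have hP : P ∈ Submodule.span Ω (B : Set (Matrix (Fin e) (Fin e) Ω)) := hsp ▸ trivial
        have hQ : Q ∈ Submodule.span Ω (B : Set (Matrix (Fin e) (Fin e) Ω)) := hsp ▸ trivial
        induction hP using Submodule.span_induction with
        | mem P hP =>
          induction hQ using Submodule.span_induction with
          | mem Q hQ =>
            have h3 : (⟨P, hP⟩ * Y0 * ⟨Q, hQ⟩ : B) ∈ IK := I.mul_mem_right _ _ (I.mul_mem_left _ _ hY0)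
            have h4 := hfΩ (⟨P, hP⟩ * Y0 * ⟨Q, hQ⟩ : B)
            rw [(LinearMap.mem_ker).1 (hfI h3)] at h4
            simpa using h4
          | zero => simp
          | add X Y _ _ h1 h2 => rw [mul_add, map_add, h1, h2, add_zero]
          | smul c X _ h => rw [mul_smul_comm, map_smul, h, smul_zero]
        | zero => simp
        | add X Y _ _ h1 h2 => rw [add_mul, add_mul, map_add, h1, h2, add_zero]
        | smul c X _ h => rw [smul_mul_assoc, smul_mul_assoc, map_smul, h, smul_zero]
      have hJ : J = ⊤ := by
        rcases eq_bot_or_eq_top J with h | h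
        · rw [h, TwoSidedIdeal.mem_bot] at hY0J
          exact absurd (Subtype.ext hY0J) hY00
        · exact h
      have h1J : (1 : Matrix (Fin e) (Fin e) Ω) ∈ J := by rw [hJ]; trivial
      rw [TwoSidedIdeal.mem_mk'] at h1J
      have h5 := h1J 1 1
      rw [one_mul, one_mul] at h5
      have h6 := hfΩ 1
      rw [OneMemClass.coe_one, h5] at h6
      exact hf1 (Subtype.ext h6.symm)
    rw [eq_top_iff]
    intro x _
    have := I.mul_mem_left x 1 h1I
    rwa [mul_one] at this
  obtain ⟨n, hn, ⟨φ⟩⟩ := IsSimpleRing.exists_algEquiv_matrix_of_isAlgClosed K B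
  have h7 := φ.toLinearEquiv.finrank_eq
  rw [hdim, Module.finrank_matrix] at h7
  have h8 : n = e := by
    simp only [Fintype.card_fin, Module.finrank_self, mul_one] at h7
    exact (Nat.mul_self_inj.1 h7).symm
  subst h8
  exact ⟨φ⟩
end PartC3

section PartC4
variable {C Ω : Type u} [Field C] [Field Ω] [Algebra C Ω]
variable {D : Derivation C Ω Ω} {L : LieSubalgebra C (Derivation C Ω Ω)}
    {K : Subfield Ω} {d : ℕ}
theorem horizB_top (L : Set (Derivation C Ω Ω)) (K : Subfield Ω)
    (triv : ∀ δ ∈ L, ∀ a ∈ K, δ a = 0)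
    {m e : ℕ} (M : L → Matrix (Fin m) (Fin m) C)
    (hM : ∀ x y, ∃ z, M z = M x * M y - M y * M x)
    (F : Matrix (Fin m) (Fin m) Ω) (hF : IsUnit F.det)
    (hFM : ∀ x : L, F.map x.1 = F * (M x).map (algebraMap C Ω))
    (r : Matrix (Fin m) (Fin m) C →ₗ[C] Matrix (Fin e) (Fin e) C)
    (hr : ∀ x y, r (M x * M y - M y * M x) = r (M x) * r (M y) - r (M y) * r (M x))
    (hA : Algebra.adjoin C (Set.range fun x => r (M x)) = ⊤) :
    Submodule.span Ω (horizB L K triv (fun x => (r (M x)).map (algebraMap C Ω)) :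
      Set (Matrix (Fin e) (Fin e) Ω)) = ⊤ := by
  classical
  set B := horizB L K triv (fun x => (r (M x)).map (algebraMap C Ω)) with hB
  have hlin : ∀ (x : L), ∀ X ∈ Submodule.span Ω (Set.range fun x => (M x).map (algebraMap C Ω)),
      extL Ω r (X * (M x).map (algebraMap C Ω) - (M x).map (algebraMap C Ω) * X) =
      extL Ω r X * (r (M x)).map (algebraMap C Ω) - (r (M x)).map (algebraMap C Ω) * extL Ω r X := by
    intro x X hX
    induction hX using Submodule.span_induction with
    | mem X hX =>
      obtain ⟨y, rfl⟩ := hX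
      simp only [← Matrix.map_mul, extL_map]
      rw [← Matrix.map_sub _ (map_sub (algebraMap C Ω)), ← Matrix.map_sub _ (map_sub (algebraMap C Ω)),
        extL_map, hr]
    | zero => simp
    | add X Y _ _ h1 h2 =>
      rw [add_mul, mul_add, add_sub_add_comm, map_add, h1, h2, map_add]; noncomm_ring
    | smul c X _ h =>
      rw [smul_mul_assoc, mul_smul_comm, ← smul_sub, map_smul, h, map_smul]
      simp [smul_sub]
  have hAmem : ∀ x, (r (M x)).map (algebraMap C Ω) ∈ Submodule.span Ω (B : Set (Matrix (Fin e) (Fin e) Ω)) := by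
    intro x
    have h1 := Submodule.mem_map_of_mem (f := extL Ω r) (horiz_span L M hM F hF hFM x)
    rw [extL_map, Submodule.map_span] at h1
    refine Submodule.span_mono ?_ h1
    rintro _ ⟨X, ⟨hX, hXh⟩, rfl⟩
    intro y
    rw [extL_der, hXh y, hlin y X hX]
  have hcl : (Algebra.adjoin Ω (B : Set (Matrix (Fin e) (Fin e) Ω))).toSubmodule =
      Submodule.span Ω (B : Set (Matrix (Fin e) (Fin e) Ω)) := by
    rw [Algebra.adjoin_eq_span]
    congr 1
    exact congrArg (fun S : Submonoid (Matrix (Fin e) (Fin e) Ω) => (S : Set (Matrix (Fin e) (Fin e) Ω))) (Submonoid.closure_eq B.toSubsemiring.toSubmonoid)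
  let ψ : Matrix (Fin e) (Fin e) C →ₐ[C] Matrix (Fin e) (Fin e) Ω := (Algebra.ofId C Ω).mapMatrix
  let S : Subalgebra C (Matrix (Fin e) (Fin e) C) :=
    ((Algebra.adjoin Ω (B : Set (Matrix (Fin e) (Fin e) Ω))).restrictScalars C).comap ψ
  have hS : S = ⊤ := by
    rw [eq_top_iff, ← hA, Algebra.adjoin_le_iff]
    rintro _ ⟨x, rfl⟩
    change _ ∈ (Algebra.adjoin Ω (B : Set (Matrix (Fin e) (Fin e) Ω))).toSubmodule
    rw [hcl]; exact hAmem x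
  rw [← hcl, eq_top_iff]
  intro X _
  rw [Matrix.matrix_eq_sum_single X]
  refine Submodule.sum_mem _ fun i _ => Submodule.sum_mem _ fun j _ => ?_
  have h3 : Matrix.single i j (X i j) = X i j • ψ (Matrix.single i j 1) := by
    have : ψ (Matrix.single i j 1) = Matrix.single i j 1 := by
      change (Matrix.single i j (1 : C)).map (algebraMap C Ω) = _
      rw [Matrix.map_single _ _ _ (algebraMap C Ω), map_one]
    rw [this, Matrix.smul_single]; simp
  rw [h3]
  refine Submodule.smul_mem _ _ ?_
  have : (Matrix.single i j (1 : C)) ∈ S := by rw [hS]; trivial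
  exact this
theorem Sit.crit2_mat [CharZero Ω] [IsAlgClosed Ω] (S : Sit D L K d) [IsAlgClosed K]
    {m e : ℕ} (he : 0 < e) (hed : e ≤ d) (M : L → Matrix (Fin m) (Fin m) C)
    (hM : ∀ x y, ∃ z, M z = M x * M y - M y * M x)
    (F : Matrix (Fin m) (Fin m) Ω) (hF : IsUnit F.det)
    (hFM : ∀ x : L, F.map x.1 = F * (M x).map (algebraMap C Ω))
    (r : Matrix (Fin m) (Fin m) C →ₗ[C] Matrix (Fin e) (Fin e) C)
    (hr : ∀ x y, r (M x * M y - M y * M x) = r (M x) * r (M y) - r (M y) * r (M x))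
    (hA : Algebra.adjoin C (Set.range fun x => r (M x)) = ⊤)
    (htr : ∀ x, (r (M x)).trace = 0) : ∀ x, r (M x) = 0 := by
  classical
  let A : L → Matrix (Fin e) (Fin e) Ω := fun x => (r (M x)).map (algebraMap C Ω)
  obtain ⟨φ⟩ := horizB_matrix (L : Set (Derivation C Ω Ω)) K S.triv S.inv he A
    (horizB_top _ K S.triv M hM F hF hFM r hr hA)
  let X : Fin e → Fin e → Matrix (Fin e) (Fin e) Ω := fun a b => (φ.symm (Matrix.single a b 1)).1
  have hXA : ∀ a b (x : L), (X a b).map x.1 = X a b * A x - A x * X a b := fun a b x =>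
    (φ.symm (Matrix.single a b 1)).2 x
  have hXX : ∀ a b c, X a b * X b c = X a c := by
    intro a b c
    change ((φ.symm (Matrix.single a b 1) * φ.symm (Matrix.single b c 1) : horizB _ K S.triv A) : Matrix (Fin e) (Fin e) Ω) = _
    rw [← map_mul, Matrix.single_mul_single_same, mul_one]
  have hXX0 : ∀ a b b' c, b ≠ b' → X a b * X b' c = 0 := by
    intro a b b' c h
    change ((φ.symm (Matrix.single a b 1) * φ.symm (Matrix.single b' c 1) : horizB _ K S.triv A) : Matrix (Fin e) (Fin e) Ω) = _
    rw [← map_mul, Matrix.single_mul_single_of_ne _ _ _ _ h, map_zero]; rfl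
  let o : Fin e := ⟨0, he⟩
  have hX0 : X o o ≠ 0 := by
    intro h
    have h1 : φ.symm (Matrix.single o o 1) = 0 := Subtype.ext h
    rw [map_eq_zero_iff _ φ.symm.injective] at h1
    have := congrFun (congrFun h1 o) o
    simp at this
  obtain ⟨u, hu⟩ : ∃ u, (X o o).mulVec u ≠ 0 := by
    by_contra hc; push Not at hc
    exact hX0 (Matrix.mulVec_injective (by ext1 v; simp [hc]))
  let P0 : Matrix (Fin e) (Fin e) Ω := Matrix.of fun i j => (X j o).mulVec u i
  have hPcol : ∀ (Y : Matrix (Fin e) (Fin e) Ω) i j, (Y * P0) i j = (Y * X j o).mulVec u i := by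
    intro Y i j
    rw [← Matrix.mulVec_mulVec]; rfl
  have hXP0 : ∀ a b, X a b * P0 = P0 * Matrix.single a b 1 := by
    intro a b
    ext i j
    rw [hPcol]
    by_cases h : b = j
    · subst h
      rw [hXX, Matrix.mul_single_apply_same, mul_one]; rfl
    · rw [hXX0 _ _ _ _ h, Matrix.mul_single_apply_of_ne _ _ _ _ _ (Ne.symm h)]; simp
  have hP0u : IsUnit P0 := by
    rw [← Matrix.mulVec_injective_iff_isUnit]
    change Function.Injective (Matrix.mulVecLin P0)
    rw [injective_iff_map_eq_zero]
    intro v hv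
    rw [Matrix.mulVecLin_apply] at hv
    obtain ⟨i, hi⟩ := Function.ne_iff.1 hu
    ext j
    have h1 : (X o j * P0).mulVec v = 0 := by
      rw [← Matrix.mulVec_mulVec, hv, Matrix.mulVec_zero]
    rw [hXP0, ← Matrix.mulVec_mulVec] at h1
    have h2 := congrFun h1 i
    have h3 : (Matrix.single o j (1 : Ω)).mulVec v = Pi.single o (v j) := by
      rw [Matrix.single_mulVec, one_mul]; rfl
    rw [h3, Matrix.mulVec_single] at h2
    have h4 : (X o o).mulVec u i * v j = 0 := by simpa [P0] using h2
    exact (mul_eq_zero.1 h4).resolve_left hi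
  have hP0d : P0.det ≠ 0 := by
    have := (Matrix.isUnit_iff_isUnit_det _).1 hP0u
    exact this.ne_zero
  obtain ⟨c, hc⟩ := IsAlgClosed.exists_pow_nat_eq (P0.det)⁻¹ he
  set P := c • P0 with hP
  have hPd : P.det = 1 := by
    rw [hP, Matrix.det_smul, Fintype.card_fin, hc, inv_mul_cancel₀ hP0d]
  have hXP : ∀ a b, X a b * P = P * Matrix.single a b 1 := by
    intro a b; rw [hP, mul_smul_comm, hXP0, smul_mul_assoc]
  have hPu : IsUnit P.det := by rw [hPd]; exact isUnit_one
  have hiP : P⁻¹ * P = 1 := Matrix.nonsing_inv_mul _ hPu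
  have hPi : P * P⁻¹ = 1 := Matrix.mul_nonsing_inv _ hPu
  have hmain : ∀ x : L, P.map x.1 = - (A x * P) := by
    intro x
    set Q := P⁻¹ * (P.map x.1 + A x * P) with hQ
    have hPQ : P * Q = P.map x.1 + A x * P := by rw [hQ, ← mul_assoc, hPi, one_mul]
    have hcomm : ∀ a b, Commute (Matrix.single a b 1) Q := by
      intro a b
      have h1 := congrArg (fun Z : Matrix (Fin e) (Fin e) Ω => Z.map x.1) (hXP a b)
      simp only [map_der_mul, hXA] at h1
      have h2 : (Matrix.single a b (1 : Ω)).map x.1 = 0 := by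
        rw [Matrix.map_single _ _ _ x.1]; simp
      rw [h2, mul_zero, add_zero] at h1
      have h3 : X a b * (P * Q) = (P * Q) * Matrix.single a b 1 := by
        rw [hPQ, add_mul, ← h1, mul_assoc (A x), ← hXP]; noncomm_ring
      rw [← mul_assoc, hXP, mul_assoc, mul_assoc] at h3
      have h4 := congrArg (fun Z => P⁻¹ * Z) h3
      simp only [← mul_assoc, hiP, one_mul] at h4
      exact h4
    obtain ⟨q, hq⟩ := Matrix.mem_range_scalar_iff_commute_single'.2 hcomm
    have htrQ : Q.trace = 0 := by
      rw [hQ, mul_add, Matrix.trace_add, ← mul_assoc, Matrix.trace_mul_cycle, hPi, one_mul]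
      have h5 : (A x).trace = 0 := by
        have := congrArg (algebraMap C Ω) (htr x)
        rw [map_zero] at this
        rw [← this, Matrix.trace, Matrix.trace, map_sum]; rfl
      have h6 := der_det (x.1.restrictScalars ℤ) P (P⁻¹ * P.map x.1) (by
        rw [← mul_assoc, hPi, one_mul]; rfl)
      rw [hPd, Derivation.map_one_eq_zero, mul_one] at h6
      rw [h5, ← h6, add_zero]
    have hq0 : q = 0 := by
      rw [← hq] at htrQ
      simp [Matrix.trace, he.ne'] at htrQ
      exact htrQ
    have hQ0 : Q = 0 := by rw [← hq, hq0, map_zero]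
    rw [hQ0, mul_zero] at hPQ
    exact eq_neg_of_add_eq_zero_left hPQ.symm
  have hPK : ∀ i j, P i j ∈ K := by
    intro i j
    refine S.crit1' hed (fun i => P i j) ?_ i
    intro δ hδ i
    have h1 := congrFun (congrFun (hmain ⟨δ, hδ⟩) i) j
    change δ (P i j) = _ at h1
    rw [h1, Matrix.neg_apply, Matrix.mul_apply]
    refine Submodule.neg_mem _ (Submodule.sum_mem _ fun l _ => ?_)
    have : A ⟨δ, hδ⟩ i l * P l j = (r (M ⟨δ, hδ⟩) i l) • P l j := by rw [Algebra.smul_def]; rfl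
    rw [this]
    exact Submodule.smul_mem _ _ (Submodule.subset_span ⟨l, rfl⟩)
  intro x
  have h1 := hmain x
  have h2 : P.map x.1 = 0 := by ext i j; exact S.triv x.1 x.2 _ (hPK i j)
  rw [h2, eq_comm, neg_eq_zero] at h1
  have h3 : A x = 0 := by
    have := congrArg (fun Z => Z * P⁻¹) h1
    simpa [mul_assoc, hPi] using this
  ext i j
  have h4 := congrFun (congrFun h3 i) j
  exact (map_eq_zero (algebraMap C Ω)).1 h4
end PartC4

section PartC5
variable {C Ω : Type u} [Field C] [Field Ω] [Algebra C Ω]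
variable {D : Derivation C Ω Ω} {L : LieSubalgebra C (Derivation C Ω Ω)}
    {K : Subfield Ω} {d : ℕ}
section
attribute [local instance] LieRing.ofAssociativeRing
theorem gIm_ext {C G V Q : Type*} [Field C] [LieRing G] [LieAlgebra C G] [AddCommGroup V]
    [Module C V] [LieRingModule G V] [LieModule C G V] [AddCommGroup Q] [Module C Q]
    (f : gIm C G V →ₗ[C] Q) : ∃ R : Module.End C V →ₗ[C] Q, ∀ x : gIm C G V, R x.1 = f x := by
  obtain ⟨R, hR⟩ := LinearMap.exists_extend (p := (gIm C G V).toSubmodule) f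
  exact ⟨R, fun x => congrArg (fun f => f x) hR⟩
theorem toEnd_lie (C : Type*) {G V : Type*} [CommRing C] [LieRing G] [LieAlgebra C G] [AddCommGroup V]
    [Module C V] [LieRingModule G V] [LieModule C G V] (x y : G) :
    LieModule.toEnd C G V ⁅x, y⁆ = LieModule.toEnd C G V x * LieModule.toEnd C G V y -
      LieModule.toEnd C G V y * LieModule.toEnd C G V x := LieHom.map_lie _ x y
end
theorem toMatrix_toEnd_lie {C G V ι : Type*} [CommRing C] [LieRing G] [LieAlgebra C G]
    [AddCommGroup V] [Module C V] [LieRingModule G V] [LieModule C G V] [Fintype ι] [DecidableEq ι]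
    (b : Module.Basis ι C V) (x y : G) :
    LinearMap.toMatrix b b (LieModule.toEnd C G V ⁅x, y⁆) =
      LinearMap.toMatrix b b (LieModule.toEnd C G V x) *
        LinearMap.toMatrix b b (LieModule.toEnd C G V y) -
      LinearMap.toMatrix b b (LieModule.toEnd C G V y) *
        LinearMap.toMatrix b b (LieModule.toEnd C G V x) := by
  rw [toEnd_lie, map_sub, LinearMap.toMatrix_mul, LinearMap.toMatrix_mul]
theorem toMatrix_adjoin_top {C G Q ι : Type*} [Field C] [IsAlgClosed C] [LieRing G]
    [LieAlgebra C G] [AddCommGroup Q] [Module C Q] [LieRingModule G Q] [LieModule C G Q]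
    [Module.Finite C Q] [Nontrivial Q] [Fintype ι] [DecidableEq ι]
    (hirr : ∀ N : LieSubmodule C G Q, N ≠ ⊥ → N = ⊤)
    (bQ : Module.Basis ι C Q) :
    Algebra.adjoin C (Set.range fun x : G => LinearMap.toMatrix bQ bQ (LieModule.toEnd C G Q x))
      = ⊤ := by
  let A := Algebra.adjoin C (Set.range fun x : G => LieModule.toEnd C G Q x)
  have hA : A = ⊤ := by
    apply burnside
    intro N hN hN0
    let N' : LieSubmodule C G Q :=
      { N with lie_mem := fun {x m} hm => hN _ (Algebra.subset_adjoin ⟨x, rfl⟩) m hm }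
    have := hirr N' (fun h => hN0 (congrArg LieSubmodule.toSubmodule h))
    exact congrArg LieSubmodule.toSubmodule this
  have h1 := congrArg (Subalgebra.map (LinearMap.toMatrixAlgEquiv bQ).toAlgHom) hA
  rw [Algebra.map_top, AlgHom.map_adjoin] at h1
  have h2 : (LinearMap.toMatrixAlgEquiv bQ).toAlgHom.range = ⊤ :=
    (AlgHom.range_eq_top _).2 (LinearMap.toMatrixAlgEquiv bQ).surjective
  rw [h2, ← Set.range_comp] at h1
  exact h1
def gElt {C G V : Type*} [CommRing C] [LieRing G] [LieAlgebra C G] [AddCommGroup V]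
    [Module C V] [LieRingModule G V] [LieModule C G V] (x : G) : gIm C G V :=
  ⟨LieModule.toEnd C G V x, x, rfl⟩
theorem gElt_surj {C G V : Type*} [CommRing C] [LieRing G] [LieAlgebra C G] [AddCommGroup V]
    [Module C V] [LieRingModule G V] [LieModule C G V] (y : gIm C G V) : ∃ x : G, gElt x = y := by
  obtain ⟨y, x, rfl⟩ := y
  exact ⟨x, rfl⟩
theorem gElt_lie {C G V : Type*} [CommRing C] [LieRing G] [LieAlgebra C G] [AddCommGroup V]
    [Module C V] [LieRingModule G V] [LieModule C G V] (x y : G) :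
    (gElt ⁅x, y⁆ : gIm C G V) = ⁅(gElt x : gIm C G V), gElt y⁆ :=
  Subtype.ext (toEnd_lie C x y)
set_option maxHeartbeats 800000 in
theorem Sit.crit2 [IsAlgClosed C] [CharZero Ω] [IsAlgClosed Ω] (S : Sit D L K d) [IsAlgClosed K]
    (V : LieSubmodule C L Ω) [Module.Finite C V] {Q : Type*} [AddCommGroup Q] [Module C Q]
    [Module.Finite C Q] [LieRingModule (gIm C L V) Q] [LieModule C (gIm C L V) Q]
    (hirr : ∀ N : LieSubmodule C (gIm C L V) Q, N ≠ ⊥ → N = ⊤)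
    (htr : ∀ x, LinearMap.trace C Q (LieModule.toEnd C (gIm C L V) Q x) = 0)
    (hQ : Module.finrank C Q ≤ d) (hnt : ∃ (x : gIm C L V) (q : Q), ⁅x, q⁆ ≠ 0) : False := by
  classical
  obtain ⟨x1, q1, hq1⟩ := hnt
  have : Nontrivial Q := nontrivial_of_ne _ _ hq1
  let b := Module.finBasis C V
  let w : Fin (Module.finrank C V) → Ω := fun i => (b i : Ω)
  have hw : LinearIndependent C w :=
    b.linearIndependent.map' V.toSubmodule.subtype (Submodule.ker_subtype _)
  have hdet := wrM_det D S.const w hw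
  let bQ := Module.finBasis C Q
  let M : L → Matrix (Fin (Module.finrank C V)) (Fin (Module.finrank C V)) C :=
    fun x => LinearMap.toMatrix b b (LieModule.toEnd C L V x)
  have hFM : ∀ x : L, (wrM D w).map x.1 = wrM D w * (M x).map (algebraMap C Ω) := by
    intro x
    ext i j
    have h3 : (x : Derivation C Ω Ω) (w j) = ∑ l, M x l j • w l := by
      have := lsum V b (LieModule.toEnd C L V x (b j))
      refine Eq.trans ?_ (this.trans ?_)
      · rfl
      · exact Finset.sum_congr rfl fun l _ => by simp only [M, LinearMap.toMatrix_apply]; rfl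
    have h5 := S.comm_iter x.1 x.2 i (w j)
    simp only [wrM, Matrix.map_apply, Matrix.of_apply, Matrix.mul_apply]
    refine h5.trans ?_
    rw [h3]
    have h6 : ∀ z, D^[(i : ℕ)] z = ((D : Ω →ₗ[C] Ω) ^ (i : ℕ)) z := fun z => by
      rw [Module.End.pow_apply]; rfl
    rw [h6, map_sum]
    refine Finset.sum_congr rfl fun l _ => ?_
    rw [map_smul, h6, Algebra.smul_def, mul_comm]
  obtain ⟨R, hR⟩ := gIm_ext
    ((LieModule.toEnd C (gIm C L V) Q : (gIm C L V) →ₗ[C] Module.End C Q))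
  have hR' : ∀ x : L, R (LieModule.toEnd C L V x) = LieModule.toEnd C (gIm C L V) Q (gElt x) :=
    fun x => hR (gElt x)
  let r : Matrix (Fin (Module.finrank C V)) (Fin (Module.finrank C V)) C →ₗ[C]
      Matrix (Fin (Module.finrank C Q)) (Fin (Module.finrank C Q)) C :=
    (LinearMap.toMatrix bQ bQ).toLinearMap ∘ₗ R ∘ₗ (LinearMap.toMatrix b b).symm.toLinearMap
  have hrM : ∀ x, r (M x) = LinearMap.toMatrix bQ bQ (LieModule.toEnd C (gIm C L V) Q (gElt x)) := by
    intro x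
    simp only [r, M, LinearMap.comp_apply, LinearEquiv.coe_coe, LinearEquiv.symm_apply_apply, hR']
  have hMM : ∀ x y, M ⁅x, y⁆ = M x * M y - M y * M x := by
    intro x y
    exact toMatrix_toEnd_lie b x y
  have key := S.crit2_mat (Module.finrank_pos (R := C) (M := Q)) hQ M (fun x y => ⟨_, hMM x y⟩) _ hdet hFM r
    (by
      intro x y
      rw [← hMM, hrM, hrM, hrM, gElt_lie]
      exact toMatrix_toEnd_lie bQ _ _)
    (by
      rw [← toMatrix_adjoin_top hirr bQ]
      congr 1
      ext Z
      constructor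
      · rintro ⟨x, rfl⟩
        exact ⟨gElt x, (hrM x).symm⟩
      · rintro ⟨y, rfl⟩
        obtain ⟨x, rfl⟩ := gElt_surj y
        exact ⟨x, hrM x⟩)
    (by
      intro x
      rw [hrM, ← LinearMap.trace_eq_matrix_trace]; exact htr _)
  obtain ⟨x, rfl⟩ := gElt_surj x1
  have h3 := key x
  rw [hrM, map_eq_zero_iff _ (LinearEquiv.injective _)] at h3
  exact hq1 (congrArg (fun f => f q1) h3)
end PartC5

section PartL2
set_option linter.unusedSectionVars false
variable {ι R M N : Type*} [Finite ι] [Field R] [CharZero R] [AddCommGroup M] [Module R M]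
  [AddCommGroup N] [Module R N] (P : RootPairing ι R M N) [P.IsCrystallographic] [P.IsReduced]
def IsGr (t : N) (T : ι → ℤ) : Prop := ∀ i, P.toLinearMap (P.root i) t = (T i : R)
def RLin (k i j : ι) (z w : ℤ) : Prop := P.root k = z • P.root i + w • P.root j
variable {P}
theorem IsGr.lin {t : N} {T : ι → ℤ} (h : IsGr P t T) {k i j : ι} {z w : ℤ}
    (hk : RLin P k i j z w) : T k = z * T i + w * T j := by
  have h1 := h k
  rw [hk, map_add, map_zsmul, map_zsmul, LinearMap.add_apply, LinearMap.smul_apply,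
    LinearMap.smul_apply, h i, h j, zsmul_eq_mul, zsmul_eq_mul] at h1
  exact_mod_cast h1.symm
theorem isGr_coroot (j : ι) : IsGr P (P.coroot j) (fun i => P.pairingIn ℤ i j) := fun i => by
  rw [P.root_coroot_eq_pairing, ← P.algebraMap_pairingIn ℤ]; rfl
theorem RLin.p {k i j : ι} {z w : ℤ} (hk : RLin P k i j z w) (l : ι) :
    P.pairingIn ℤ k l = z * P.pairingIn ℤ i l + w * P.pairingIn ℤ j l :=
  (isGr_coroot l).lin hk
variable (P) in
theorem exists_refl (i j : ι) :
    ∃ k, RLin P k i j 1 (-P.pairingIn ℤ i j) := by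
  refine ⟨P.reflectionPerm j i, ?_⟩
  rw [RLin, P.root_reflectionPerm, P.reflection_apply_root, ← P.algebraMap_pairingIn ℤ,
    one_smul, neg_smul, sub_eq_add_neg]
  simp [Int.cast_smul_eq_zsmul]
variable (P) in
theorem exists_neg (i : ι) : ∃ k, RLin P k i i (-1) 0 := by
  refine ⟨P.reflectionPerm i i, ?_⟩
  rw [RLin, P.root_reflectionPerm, P.reflection_apply_self]; simp
theorem exists_add {i j : ι} (h : P.pairingIn ℤ i j < 0) (h' : P.root i ≠ -P.root j) :
    ∃ k, RLin P k i j 1 1 := by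
  obtain ⟨k, hk⟩ := P.root_add_root_mem_of_pairingIn_neg h h'
  exact ⟨k, by rw [RLin, hk]; simp⟩
theorem exists_sub {i j : ι} (h : 0 < P.pairingIn ℤ i j) (h' : i ≠ j) :
    ∃ k, RLin P k i j 1 (-1) := by
  obtain ⟨k, hk⟩ := P.root_sub_root_mem_of_pairingIn_pos h h'
  exact ⟨k, by rw [RLin, hk]; simp [sub_eq_add_neg]⟩
variable (P) in
theorem p_self (i : ι) :
    P.pairingIn ℤ i i = 2 := by
  have := isGr_coroot (P := P) i i
  rw [P.root_coroot_two] at this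
  exact_mod_cast this.symm
def PR (x y : ℤ) : Prop := (x = 0 ∧ y = 0) ∨ (x = 1 ∧ (y = 1 ∨ y = 2 ∨ y = 3)) ∨
  (x = -1 ∧ (y = -1 ∨ y = -2 ∨ y = -3)) ∨ (y = 1 ∧ (x = 2 ∨ x = 3)) ∨
  (y = -1 ∧ (x = -2 ∨ x = -3))
theorem p_pair {i j : ι} (h : i ≠ j) (h' : P.root i ≠ -P.root j) :
    PR (P.pairingIn ℤ i j) (P.pairingIn ℤ j i) := by
  have := P.pairingIn_pairingIn_mem_set_of_isCrystal_of_isRed' i j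
    (fun e => h (P.root.injective e)) h'
  simp only [Set.mem_insert_iff, Set.mem_singleton_iff, Prod.mk.injEq] at this
  unfold PR
  omega
theorem p_pair_pos {t : N} {T : ι → ℤ} (hT : IsGr P t T) {i j : ι} (h : i ≠ j) (hi : 0 < T i)
    (hj : 0 < T j) : P.root i ≠ -P.root j ∧ PR (P.pairingIn ℤ i j) (P.pairingIn ℤ j i) := by
  have : P.root i ≠ -P.root j := by
    intro e
    have := hT.lin (k := i) (i := j) (j := j) (z := -1) (w := 0) (by rw [RLin, e]; simp)
    omega
  exact ⟨this, p_pair h this⟩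
end PartL2

section PartL3
set_option linter.unusedSectionVars false
variable {ι R M N : Type*} [Finite ι] [Field R] [CharZero R] [AddCommGroup M] [Module R M]
  [AddCommGroup N] [Module R N] {P : RootPairing ι R M N} [P.IsCrystallographic] [P.IsReduced]
def MinGr (P : RootPairing ι R M N) (T : ι → ℤ) : Prop :=
  ∀ t' T', IsGr P t' T' → (∃ i, 0 < T' i) → {i | 0 < T i}.ncard ≤ {i | 0 < T' i}.ncard
theorem not_isolated {t : N} {T : ι → ℤ} (hT : IsGr P t T) (hm : MinGr P T)
    (h2 : 2 ≤ {i | 0 < T i}.ncard) {a : ι} (ha : 0 < T a) :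
    ∃ b, 0 < T b ∧ b ≠ a ∧ P.pairingIn ℤ b a ≠ 0 := by
  by_contra! hc
  have h1 : {i | 0 < P.pairingIn ℤ i a} = {a} := by
    ext b
    simp only [Set.mem_ofPred_eq, Set.mem_singleton_iff]
    constructor
    · intro hb
      by_contra hba
      rcases lt_trichotomy (T b) 0 with h | h | h
      · obtain ⟨k, hk⟩ := exists_neg P b
        have e1 := hT.lin hk
        have e2 := hk.p a
        have e3 := hc k (by omega) (by rintro rfl; rw [p_self] at e2; omega)
        omega
      · obtain ⟨k, hk⟩ := exists_refl P b a
        obtain ⟨l, hl⟩ := exists_neg P k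
        have e1 := hT.lin hk
        have e2 := hk.p a
        have e3 := hT.lin hl
        have e4 := hl.p a
        rw [p_self] at e2
        have e5 : 0 < T l := by nlinarith
        have e6 : l = a := by
          by_contra hne
          have := hc l e5 hne
          omega
        subst e6
        rw [p_self] at e4
        have : P.pairingIn ℤ b l = 2 := by omega
        rw [this] at e1
        omega
      · have := hc b h hba
        omega
    · rintro rfl; rw [p_self]; norm_num
  have := hm _ _ (isGr_coroot (P := P) a) ⟨a, by rw [p_self]; norm_num⟩
  rw [h1, Set.ncard_singleton] at this
  omega
def TyA (P : RootPairing ι R M N) [P.IsCrystallographic] (T : ι → ℤ) : Prop :=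
  ∀ i j, 0 < T i → 0 < T j → i ≠ j → P.pairingIn ℤ i j = 1
def TyB (P : RootPairing ι R M N) [P.IsCrystallographic] (T : ι → ℤ) (a b c : ι) : Prop :=
  (∀ i, 0 < T i ↔ i = a ∨ i = b ∨ i = c) ∧ a ≠ b ∧ a ≠ c ∧ b ≠ c ∧ RLin P c a b 1 1 ∧
    T a = T b ∧ P.pairingIn ℤ a b = 0 ∧ P.pairingIn ℤ b a = 0 ∧ P.pairingIn ℤ c a = 2 ∧
    P.pairingIn ℤ c b = 2 ∧ P.pairingIn ℤ a c = 1 ∧ P.pairingIn ℤ b c = 1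
theorem case_two {t : N} {T : ι → ℤ} (hT : IsGr P t T) (hm : MinGr P T)
    (h2 : {i | 0 < T i}.ncard = 2) : TyA P T := by
  intro a b ha hb hab
  have hS : ∀ i, 0 < T i → i = a ∨ i = b := by
    obtain ⟨x, y, hxy, he⟩ := Set.ncard_eq_two.1 h2
    have h : ∀ i, 0 < T i ↔ i = x ∨ i = y := fun i => by
      rw [← Set.mem_ofPred_eq (p := fun i => 0 < T i), he]; simp
    have h3 := (h a).1 ha
    have h4 := (h b).1 hb
    intro i hi
    have h5 := (h i).1 hi
    grind
  obtain ⟨c, hc, hca, hp⟩ := not_isolated hT hm (by omega) ha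
  obtain rfl : c = b := by have := hS c hc; tauto
  obtain ⟨hn, hpr⟩ := p_pair_pos hT hab ha hc
  have hpos : ¬ P.pairingIn ℤ a c < 0 := by
    intro h
    obtain ⟨k, hk⟩ := exists_add h hn
    have e := hT.lin hk
    have e1 := hk.p a
    have e2 := hk.p c
    rw [p_self] at e1 e2
    rcases hS k (by omega) with rfl | rfl <;> omega
  unfold PR at hpr
  obtain ⟨k, hk⟩ := exists_sub (i := a) (j := c) (P := P) (by omega) hab
  obtain ⟨l, hl⟩ := exists_neg P k
  have hTe : T a = T c := by
    have e := hT.lin hk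
    have e1 := hk.p a
    have e2 := hk.p c
    have e' := hT.lin hl
    have e1' := hl.p a
    have e2' := hl.p c
    rw [p_self] at e1 e2
    rcases lt_trichotomy (T k) 0 with h | h | h
    · rcases hS l (by omega) with rfl | rfl <;> rw [p_self] at * <;> omega
    · omega
    · rcases hS k (by omega) with rfl | rfl <;> rw [p_self] at * <;> omega
  by_contra h1
  obtain ⟨k, hk⟩ := exists_refl P a c
  obtain ⟨l, hl⟩ := exists_neg P k
  have e := hT.lin hk
  have e1 := hk.p a
  have e2 := hk.p c
  have e' := hT.lin hl
  have e1' := hl.p a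
  have e2' := hl.p c
  rw [p_self] at e1 e2
  have : P.pairingIn ℤ a c = 2 ∨ P.pairingIn ℤ a c = 3 := by omega
  rcases this with h | h <;> rw [h] at e e1 e2 <;>
  rcases hS l (by omega) with rfl | rfl <;> rw [p_self] at * <;> omega
set_option maxHeartbeats 1000000 in
theorem case_sum {t : N} {T : ι → ℤ} (hT : IsGr P t T) (hm : MinGr P T)
    {a b c : ι} (hS : ∀ i, 0 < T i ↔ i = a ∨ i = b ∨ i = c) (hab : a ≠ b) (hac : a ≠ c)
    (hbc : b ≠ c) (hc : RLin P c a b 1 1) : TyB P T a b c := by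
  have ha : 0 < T a := (hS a).2 (by simp)
  have hb : 0 < T b := (hS b).2 (by simp)
  have hcp : 0 < T c := (hS c).2 (by simp)
  obtain ⟨hn, hpr⟩ := p_pair_pos hT hab ha hb
  obtain ⟨-, hprac⟩ := p_pair_pos hT hac ha hcp
  obtain ⟨-, hprbc⟩ := p_pair_pos hT hbc hb hcp
  unfold PR at hpr hprac hprbc
  have saa := p_self P a
  have sbb := p_self P b
  have scc := p_self P c
  have ca := hc.p a
  have cb := hc.p b
  have cc := hc.p c
  have cT := hT.lin hc
  have key : ∀ k z w, RLin P k a b z w → 0 < T k → (z = 1 ∧ w = 0) ∨ (z = 0 ∧ w = 1) ∨ (z = 1 ∧ w = 1) := by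
    intro k z w hk h
    have hli : ∀ z' w' : ℤ, RLin P k a b z' w' → z' = z ∧ w' = w := by
      intro z' w' hk'
      have e1 := hk.p a
      have e2 := hk.p b
      have e3 := hk'.p a
      have e4 := hk'.p b
      rw [saa] at e1 e3
      rw [sbb] at e2 e4
      have h4 : P.pairingIn ℤ a b * P.pairingIn ℤ b a ≠ 4 := by
        rcases hpr with ⟨h, h'⟩ | ⟨h, h' | h' | h'⟩ | ⟨h, h' | h' | h'⟩ | ⟨h', h | h⟩ | ⟨h', h | h⟩ <;>
          rw [h, h'] <;> norm_num
      have e5 : (z' - z) * (P.pairingIn ℤ a b * P.pairingIn ℤ b a - 4) = 0 := by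
        linear_combination (-2) * (e1 - e3) + P.pairingIn ℤ b a * (e2 - e4)
      have e6 : (w' - w) * (P.pairingIn ℤ a b * P.pairingIn ℤ b a - 4) = 0 := by
        linear_combination (-2) * (e2 - e4) + P.pairingIn ℤ a b * (e1 - e3)
      have h5 : P.pairingIn ℤ a b * P.pairingIn ℤ b a - 4 ≠ 0 := by omega
      rcases mul_eq_zero.1 e5 with h | h
      · rcases mul_eq_zero.1 e6 with h' | h'
        · omega
        · exact absurd h' h5
      · exact absurd h h5
    rcases (hS k).1 h with rfl | rfl | rfl
    · have := hli 1 0 (by simp [RLin]); omega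
    · have := hli 0 1 (by simp [RLin]); omega
    · have := hli 1 1 hc; omega
  have flip : ∀ k z w, RLin P k a b z w → T k < 0 → (z = -1 ∧ w = 0) ∨ (z = 0 ∧ w = -1) ∨ (z = -1 ∧ w = -1) := by
    intro k z w hk h
    obtain ⟨l, hl⟩ := exists_neg P k
    have := hT.lin hl
    have := key l (-z) (-w) (by
      unfold RLin at hk hl ⊢
      rw [hl, hk]; simp) (by omega)
    omega
  have sw : ∀ k z w, RLin P k b a z w → RLin P k a b w z := by
    intro k z w h
    unfold RLin at *; rw [h, add_comm]
  obtain ⟨k, hk⟩ := exists_refl P a b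
  obtain ⟨l, hl⟩ := exists_refl P b a
  have hl' := sw _ _ _ hl
  have kT := hT.lin hk
  have lT := hT.lin hl
  have k1 := key k _ _ hk
  have l1 := key l _ _ hl'
  have k2 := flip k _ _ hk
  have l2 := flip l _ _ hl'
  obtain ⟨m, hmm⟩ := exists_refl P c b
  have hm' : RLin P m a b 1 (1 - P.pairingIn ℤ c b) := by
    unfold RLin at *
    rw [hmm, hc]; module
  have mT := hT.lin hm'
  have m1 := key m _ _ hm'
  have m2 := flip m _ _ hm'
  have hp : (P.pairingIn ℤ a b = -1 ∧ P.pairingIn ℤ b a = -1) ∨ (P.pairingIn ℤ a b = 0 ∧ P.pairingIn ℤ b a = 0) := by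
    rcases hpr with ⟨h, h'⟩ | ⟨h, h' | h' | h'⟩ | ⟨h, h' | h' | h'⟩ | ⟨h', h | h⟩ | ⟨h', h | h⟩ <;>
      rw [h] at kT k1 k2 cb <;> rw [h'] at lT l1 l2 ca <;> rw [cb, sbb] at mT m1 m2 <;> omega
  rcases hp with ⟨h1, h2⟩ | ⟨h1, h2⟩
  · exfalso
    let t' := 2 • P.coroot a + P.coroot b
    let T' : ι → ℤ := fun i => 2 * P.pairingIn ℤ i a + P.pairingIn ℤ i b
    have hT' : IsGr P t' T' := by
      intro i
      simp only [t', T', map_add, map_nsmul]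
      rw [isGr_coroot a i, isGr_coroot b i]; push_cast; simp
    have hle := hm t' T' hT' ⟨a, by simp only [T']; omega⟩
    have hSe : {i | 0 < T i} = {a, b, c} := by ext i; simpa using hS i
    have h3 : {i | 0 < T i}.ncard = 3 := by rw [hSe]; exact Set.ncard_eq_three.2 ⟨a, b, c, hab, hac, hbc, rfl⟩
    have hsub : {i | 0 < T' i} ⊆ {a, c} := by
      intro i hi
      simp only [Set.mem_ofPred_eq, T'] at hi
      have hor : ∀ x : ι, (x = a ∨ x = b) → T i = 0 → P.pairingIn ℤ i x = 0 := by
        intro x hx h0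
        by_contra hne
        obtain ⟨kk, hkk⟩ := exists_refl P i x
        have hxT : 0 < T x := by rcases hx with rfl | rfl <;> assumption
        have e1 := hT.lin hkk
        rw [h0] at e1
        have hkS : ∃ z w : ℤ, RLin P kk a b z w := by
          rcases lt_trichotomy (T kk) 0 with h | h | h
          · obtain ⟨l, hl⟩ := exists_neg P kk
            have := hT.lin hl
            unfold RLin at hl
            have hk2 : P.root kk = - P.root l := by rw [hl]; simp
            rcases (hS l).1 (by omega) with rfl | rfl | rfl
            · exact ⟨-1, 0, by simp [RLin, hk2]⟩
            · exact ⟨0, -1, by simp [RLin, hk2]⟩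
            · exact ⟨-1, -1, by rw [RLin, hk2, hc]; module⟩
          · exfalso
            rw [h] at e1
            have : P.pairingIn ℤ i x * T x = 0 := by linarith
            rcases mul_eq_zero.1 this with h | h <;> omega
          · rcases (hS kk).1 (by omega) with rfl | rfl | rfl
            · exact ⟨1, 0, by simp [RLin]⟩
            · exact ⟨0, 1, by simp [RLin]⟩
            · exact ⟨1, 1, hc⟩
        obtain ⟨z, w, hzw⟩ := hkS
        have hi2 : ∃ z w : ℤ, RLin P i a b z w := by
          rcases hx with rfl | rfl
          · refine ⟨z + P.pairingIn ℤ i x, w, ?_⟩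
            unfold RLin at *
            have : P.root i = P.root kk + P.pairingIn ℤ i x • P.root x := by rw [hkk]; module
            rw [this, hzw]; module
          · refine ⟨z, w + P.pairingIn ℤ i x, ?_⟩
            unfold RLin at *
            have : P.root i = P.root kk + P.pairingIn ℤ i x • P.root x := by rw [hkk]; module
            rw [this, hzw]; module
        obtain ⟨z', w', hi'⟩ := hi2
        have g1 := hi'.p a
        have g2 := hi'.p b
        rw [saa, h2] at g1
        rw [sbb, h1] at g2
        have g3 := hT.lin hi'
        have hkne : T kk ≠ 0 := by
          intro h
          rw [h] at e1
          have : P.pairingIn ℤ i x * T x = 0 := by linarith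
          rcases mul_eq_zero.1 this with h | h <;> omega
        rcases hx with rfl | rfl
        · have f2 : RLin P kk x b (z' - P.pairingIn ℤ i x) w' := by
            unfold RLin at *; rw [hkk, hi']; module
          have g4 := key _ _ _ f2
          have g5 := flip _ _ _ f2
          clear hpr hprac hprbc k1 k2 l1 l2 m1 m2 key flip
          have hz : (z' = 1 ∧ w' = 1) ∨ (z' = 0 ∧ w' = 1) ∨ (z' = -1 ∧ w' = -1) ∨
            (z' = -1 ∧ w' = 0) ∨ (z' = 0 ∧ w' = -1) ∨ (z' = 1 ∧ w' = 0) := by omega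
          rcases hz with ⟨rfl, rfl⟩ | ⟨rfl, rfl⟩ | ⟨rfl, rfl⟩ | ⟨rfl, rfl⟩ | ⟨rfl, rfl⟩ | ⟨rfl, rfl⟩ <;>
            omega
        · have f2 : RLin P kk a x z' (w' - P.pairingIn ℤ i x) := by
            unfold RLin at *; rw [hkk, hi']; module
          have g4 := key _ _ _ f2
          have g5 := flip _ _ _ f2
          clear hpr hprac hprbc k1 k2 l1 l2 m1 m2 key flip
          have hz : (z' = 1 ∧ w' = 1) ∨ (z' = 0 ∧ w' = 1) ∨ (z' = -1 ∧ w' = -1) ∨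
            (z' = -1 ∧ w' = 0) ∨ (z' = 0 ∧ w' = -1) ∨ (z' = 1 ∧ w' = 0) := by omega
          rcases hz with ⟨rfl, rfl⟩ | ⟨rfl, rfl⟩ | ⟨rfl, rfl⟩ | ⟨rfl, rfl⟩ | ⟨rfl, rfl⟩ | ⟨rfl, rfl⟩ <;>
            omega
      rcases lt_trichotomy (T i) 0 with h | h | h
      · exfalso
        obtain ⟨l, hl⟩ := exists_neg P i
        have := hT.lin hl
        have u1 := hl.p a
        have u2 := hl.p b
        rcases (hS l).1 (by omega) with rfl | rfl | rfl <;> omega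
      · have := hor a (by simp) h
        have := hor b (by simp) h
        omega
      · rcases (hS i).1 h with rfl | rfl | rfl
        · simp
        · omega
        · simp
    have := Set.ncard_le_ncard hsub (Set.toFinite _)
    have h4 : ({a, c} : Set ι).ncard ≤ 2 := Set.ncard_insert_le _ _ |>.trans (by simp)
    omega
  · have hTab : T a = T b := by
      obtain ⟨q, hq⟩ := exists_refl P c b
      by_contra hne
      have := mT; rw [cb, h1, sbb] at m1 m2 mT
      omega
    refine ⟨hS, hab, hac, hbc, hc, hTab, h1, h2, by omega, by omega, ?_, ?_⟩ <;> omega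
end PartL3

section PartL4
set_option linter.unusedSectionVars false
variable {ι R M N : Type*} [Finite ι] [Field R] [CharZero R] [AddCommGroup M] [Module R M]
  [AddCommGroup N] [Module R N] {P : RootPairing ι R M N} [P.IsCrystallographic] [P.IsReduced]
theorem case_two_val {t : N} {T : ι → ℤ} (hT : IsGr P t T) (hm : MinGr P T)
    {a b c : ι} (hS : ∀ i, 0 < T i ↔ i = a ∨ i = b ∨ i = c) (hab : a ≠ b)
    (h3 : {i | 0 < T i}.ncard = 3) (hTab : T a = T b)
    (hp : P.pairingIn ℤ a b = 2) :
    ∃ t' T' a' b' c', IsGr P t' T' ∧ {i | 0 < T' i}.ncard = 3 ∧ TyB P T' a' b' c' := by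
  have ha : 0 < T a := (hS a).2 (by simp)
  have hb : 0 < T b := (hS b).2 (by simp)
  have saa := p_self P a
  have sbb := p_self P b
  have hpr := (p_pair_pos hT hab ha hb).2
  unfold PR at hpr
  have hba : P.pairingIn ℤ b a = 1 := by omega
  obtain ⟨k, hk⟩ := exists_refl P a b
  obtain ⟨l, hl⟩ := exists_neg P k
  have hl' : RLin P l a b (-1) 2 := by
    unfold RLin at *; rw [hl, hk, hp]; module
  have hlT := hT.lin hl'
  have hla := hl'.p a
  have hlb := hl'.p b
  have hlc : l = c := by
    rcases (hS l).1 (by omega) with rfl | rfl | rfl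
    · omega
    · omega
    · rfl
  subst hlc
  obtain ⟨e, he⟩ := exists_sub (P := P) (i := a) (j := b) (by omega) hab
  have hea := he.p a
  have heb := he.p b
  have hSe : ∀ i, 0 < P.pairingIn ℤ i a ↔ i = b ∨ i = e ∨ i = a := by
    intro i
    constructor
    · intro hi
      rcases lt_trichotomy (T i) 0 with h | h | h
      · exfalso
        obtain ⟨j, hj⟩ := exists_neg P i
        have := hT.lin hj
        have := hj.p a
        rcases (hS j).1 (by omega) with rfl | rfl | rfl <;> omega
      · obtain ⟨j, hj⟩ := exists_refl P i a
        obtain ⟨q, hq⟩ := exists_neg P j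
        have hq' : RLin P q i a (-1) (P.pairingIn ℤ i a) := by
          unfold RLin at *; rw [hq, hj]; module
        have h1 := hT.lin hq'
        rw [h] at h1
        have h2 := hq'.p a
        rw [saa] at h2
        have hqS : 0 < T q := by rw [h1]; nlinarith
        have h4 : T q = T a := by rcases (hS q).1 hqS with rfl | rfl | rfl <;> omega
        have h5 : P.pairingIn ℤ i a = 1 := by
          have : (P.pairingIn ℤ i a - 1) * T a = 0 := by linarith
          rcases mul_eq_zero.1 this with h | h <;> omega
        rw [h5] at hq'
        rcases (hS q).1 hqS with rfl | rfl | rfl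
        · omega
        · right; left
          apply P.root.injective
          unfold RLin at *
          have : P.root i = P.root a - P.root q := by rw [hq']; module
          rw [this, he]; module
        · omega
      · rcases (hS i).1 h with rfl | rfl | rfl
        · simp
        · simp
        · omega
    · rintro (rfl | rfl | rfl) <;> omega
  have hbe : b ≠ e := by rintro rfl; omega
  have hea' : e ≠ a := by rintro rfl; omega
  have h3' : {i | 0 < P.pairingIn ℤ i a}.ncard = 3 :=
    Set.ncard_eq_three.2 ⟨b, e, a, hbe, hab.symm, hea', by ext i; simpa using hSe i⟩
  have hm' : MinGr P (fun i => P.pairingIn ℤ i a) := by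
    intro t' T' h1 h2
    have := hm t' T' h1 h2
    rw [h3'] ; omega
  refine ⟨_, _, b, e, a, isGr_coroot a, h3', case_sum (isGr_coroot a) hm' hSe hbe hab.symm hea' ?_⟩
  unfold RLin at *
  rw [he]; module
theorem case_three {t : N} {T : ι → ℤ} (hT : IsGr P t T) (hm : MinGr P T)
    (h3 : {i | 0 < T i}.ncard = 3) :
    TyA P T ∨ ∃ t' T' a' b' c', IsGr P t' T' ∧ {i | 0 < T' i}.ncard = 3 ∧ TyB P T' a' b' c' := by
  by_cases hsum : ∃ a b c, 0 < T a ∧ 0 < T b ∧ 0 < T c ∧ RLin P c a b 1 1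
  · right
    obtain ⟨a, b, c, ha, hb, hc, h⟩ := hsum
    have saa := p_self P a
    have sbb := p_self P b
    have scc := p_self P c
    have e1 := h.p a
    have e2 := h.p b
    have e3 := hT.lin h
    have hab : a ≠ b := by
      rintro rfl
      obtain ⟨hn, hpr⟩ := p_pair_pos hT (i := a) (j := c) (by rintro rfl; omega) ha hc
      unfold PR at hpr; omega
    have hac : a ≠ c := by rintro rfl; omega
    have hbc : b ≠ c := by rintro rfl; omega
    refine ⟨t, T, a, b, c, hT, h3, case_sum hT hm ?_ hab hac hbc h⟩
    have hsub : ({a, b, c} : Set ι) ⊆ {i | 0 < T i} := by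
      rintro i (rfl | rfl | rfl) <;> assumption
    have heq : ({a, b, c} : Set ι) = {i | 0 < T i} := by
      apply Set.eq_of_subset_of_ncard_le hsub _ (Set.toFinite _)
      rw [h3, Set.ncard_eq_three.2 ⟨a, b, c, hab, hac, hbc, rfl⟩]
    intro i
    rw [← Set.mem_ofPred_eq (p := fun i => 0 < T i), ← heq]; simp
  push Not at hsum
  have hge : ∀ a b, 0 < T a → 0 < T b → a ≠ b → 0 ≤ P.pairingIn ℤ a b := by
    intro a b ha hb hab
    by_contra h
    obtain ⟨k, hk⟩ := exists_add (by omega) (p_pair_pos hT hab ha hb).1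
    exact hsum a b k ha hb (by have := hT.lin hk; omega) hk
  have hle1 : ∀ a b, 0 < T a → 0 < T b → a ≠ b → 0 < P.pairingIn ℤ a b → T a ≤ T b := by
    intro a b ha hb hab h
    by_contra hlt
    obtain ⟨k, hk⟩ := exists_sub h hab
    refine hsum k b a (by have := hT.lin hk; omega) hb ha ?_
    unfold RLin at *; rw [hk]; module
  have heq : ∀ a b, 0 < T a → 0 < T b → a ≠ b → 0 < P.pairingIn ℤ a b → T a = T b := by
    intro a b ha hb hab h
    have h' := (p_pair_pos hT hab ha hb).2
    unfold PR at h'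
    exact le_antisymm (hle1 a b ha hb hab h) (hle1 b a hb ha hab.symm (by omega))
  have hzero : ∀ a b, 0 < T a → 0 < T b → P.pairingIn ℤ a b = 0 → P.pairingIn ℤ b a = 0 := by
    intro a b ha hb h
    have hab : a ≠ b := by rintro rfl; rw [p_self] at h; omega
    have h' := (p_pair_pos hT hab ha hb).2
    unfold PR at h'; omega
  have hthree : ∀ a b, 0 < T a → 0 < T b → a ≠ b → ∃ c, c ≠ a ∧ c ≠ b ∧ 0 < T c ∧
      ∀ i, 0 < T i ↔ i = a ∨ i = b ∨ i = c := by
    intro a b ha hb hab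
    obtain ⟨x, y, z, hxy, hxz, hyz, he⟩ := Set.ncard_eq_three.1 h3
    have h : ∀ i, 0 < T i ↔ i = x ∨ i = y ∨ i = z := fun i => by
      rw [← Set.mem_ofPred_eq (p := fun i => 0 < T i), he]; simp
    have h1 := (h a).1 ha
    have h2 := (h b).1 hb
    clear hsum hge hle1 heq hzero he
    rcases h1 with rfl | rfl | rfl <;> rcases h2 with rfl | rfl | rfl
    · exact absurd rfl hab
    · exact ⟨z, hxz.symm, hyz.symm, by simp [h], fun i => by rw [h]⟩
    · exact ⟨y, hxy.symm, hyz, by simp [h], fun i => by rw [h]; tauto⟩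
    · exact ⟨z, hyz.symm, hxz.symm, by simp [h], fun i => by rw [h]; tauto⟩
    · exact absurd rfl hab
    · exact ⟨x, hxy, hxz, by simp [h], fun i => by rw [h]; tauto⟩
    · exact ⟨y, hyz, hxy.symm, by simp [h], fun i => by rw [h]; tauto⟩
    · exact ⟨x, hxz, hxy, by simp [h], fun i => by rw [h]; tauto⟩
    · exact absurd rfl hab
  have hall : ∀ a b, 0 < T a → 0 < T b → T a = T b := by
    intro a b ha hb
    by_cases hab : a = b
    · rw [hab]
    by_cases hp : 0 < P.pairingIn ℤ a b
    · exact heq a b ha hb hab hp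
    have hp0 : P.pairingIn ℤ a b = 0 := by have := hge a b ha hb hab; omega
    have hp0' := hzero a b ha hb hp0
    obtain ⟨c, hca, hcb, hc, hS⟩ := hthree a b ha hb hab
    obtain ⟨x, hx, hxa, hpx⟩ := not_isolated hT hm (by omega) ha
    obtain ⟨y, hy, hyb, hpy⟩ := not_isolated hT hm (by omega) hb
    have hxc : x = c := by rcases (hS x).1 hx with rfl | rfl | rfl; exacts [absurd rfl hxa, absurd hp0' hpx, rfl]
    have hyc : y = c := by rcases (hS y).1 hy with rfl | rfl | rfl; exacts [absurd hp0 hpy, absurd rfl hyb, rfl]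
    subst hxc
    subst hyc
    have h1 := hge y a hx ha hca
    have h2 := hge y b hx hb hcb
    rw [← heq y a hx ha hca (by omega), ← heq y b hx hb hcb (by omega)]
  by_cases h2 : ∃ a b, 0 < T a ∧ 0 < T b ∧ a ≠ b ∧ P.pairingIn ℤ a b = 2
  · right
    obtain ⟨a, b, ha, hb, hab, hp⟩ := h2
    obtain ⟨c, hca, hcb, hc, hS⟩ := hthree a b ha hb hab
    exact case_two_val hT hm hS hab h3 (hall a b ha hb) hp
  push Not at h2
  left
  have h01 : ∀ a b, 0 < T a → 0 < T b → a ≠ b → P.pairingIn ℤ a b = 0 ∨ P.pairingIn ℤ a b = 1 := by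
    intro a b ha hb hab
    have h' := (p_pair_pos hT hab ha hb).2
    unfold PR at h'
    have := hge a b ha hb hab
    have := h2 a b ha hb hab
    by_contra hne
    have h3 : P.pairingIn ℤ a b = 3 := by omega
    obtain ⟨k, hk⟩ := exists_refl P a b
    obtain ⟨l, hl⟩ := exists_neg P k
    have e1 := hT.lin hk
    have e2 := hT.lin hl
    have e3 := hall a b ha hb
    rw [h3] at e1
    have e4 := hall a l ha (by omega)
    omega
  intro a b ha hb hab
  by_contra hne
  have hp0 : P.pairingIn ℤ a b = 0 := by have := h01 a b ha hb hab; omega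
  have hp0' := hzero a b ha hb hp0
  obtain ⟨c, hca, hcb, hc, hS⟩ := hthree a b ha hb hab
  obtain ⟨x, hx, hxa, hpx⟩ := not_isolated hT hm (by omega) ha
  obtain ⟨y, hy, hyb, hpy⟩ := not_isolated hT hm (by omega) hb
  have hxc : x = c := by rcases (hS x).1 hx with rfl | rfl | rfl; exacts [absurd rfl hxa, absurd hp0' hpx, rfl]
  have hyc : y = c := by rcases (hS y).1 hy with rfl | rfl | rfl; exacts [absurd hp0 hpy, absurd rfl hyb, rfl]
  subst hxc
  subst hyc
  have u1 := h01 y a hc ha hca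
  have u2 := h01 y b hc hb hcb
  have u3 := h01 a y ha hc hca.symm
  have u4 := h01 b y hb hc hcb.symm
  have u5 := hzero a y ha hc
  have u6 := hzero b y hb hc
  have saa := p_self P a
  have sbb := p_self P b
  have scc := p_self P y
  obtain ⟨k, hk⟩ := exists_sub (P := P) (i := a) (j := y) (by omega) hca.symm
  have k1 := hk.p a
  have k2 := hk.p b
  have k3 := hk.p y
  have k4 := hT.lin hk
  obtain ⟨l, hl⟩ := exists_add (P := P) (i := k) (j := b) (by omega) (by
    intro h
    have := (isGr_coroot (P := P) b).lin (k := k) (i := b) (j := b) (z := -1) (w := 0) (by unfold RLin; rw [h]; module)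
    omega)
  have l1 := hl.p a
  have l2 := hl.p b
  have l3 := hl.p y
  have l4 := hT.lin hl
  have v1 := hall a b ha hb
  have v2 := hall a y ha hc
  rcases (hS l).1 (by omega) with rfl | rfl | rfl <;> omega
theorem comb_main {t : N} {T : ι → ℤ} (hT : IsGr P t T) (hpos : ∃ i, 0 < T i)
    (h3 : {i | 0 < T i}.ncard ≤ 3) :
    ∃ t' T', IsGr P t' T' ∧ (∃ i, 0 < T' i) ∧ {i | 0 < T' i}.ncard ≤ {i | 0 < T i}.ncard ∧
      (TyA P T' ∨ ∃ a b c, TyB P T' a b c) := by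
  classical
  have hex : ∃ n, ∃ t' T', IsGr P t' T' ∧ (∃ i, 0 < T' i) ∧ {i | 0 < T' i}.ncard = n :=
    ⟨_, t, T, hT, hpos, rfl⟩
  obtain ⟨t', T', hT', hpos', hn⟩ := Nat.find_spec hex
  have hmin : MinGr P T' := fun t'' T'' h1 h2 => by
    rw [hn]; exact Nat.find_min' hex ⟨t'', T'', h1, h2, rfl⟩
  have hle := hmin t T hT hpos
  have h0 : 0 < {i | 0 < T' i}.ncard := by
    obtain ⟨i, hi⟩ := hpos'
    exact (Set.ncard_pos (Set.toFinite _)).2 ⟨i, hi⟩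
  have : {i | 0 < T' i}.ncard = 1 ∨ {i | 0 < T' i}.ncard = 2 ∨ {i | 0 < T' i}.ncard = 3 := by omega
  rcases this with h | h | h
  · refine ⟨t', T', hT', hpos', hle, Or.inl ?_⟩
    obtain ⟨x, hx⟩ := Set.ncard_eq_one.1 h
    intro i j hi hj hij
    have h1 : i = x := by rw [← Set.mem_singleton_iff, ← hx]; exact hi
    have h2 : j = x := by rw [← Set.mem_singleton_iff, ← hx]; exact hj
    exact absurd (h1.trans h2.symm) hij
  · exact ⟨t', T', hT', hpos', hle, Or.inl (case_two hT' hmin h)⟩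
  · rcases case_three hT' hmin h with h' | ⟨t2, T2, a, b, c, h1, h2, h4⟩
    · exact ⟨t', T', hT', hpos', hle, Or.inl h'⟩
    · refine ⟨t2, T2, h1, ⟨a, (h4.1 a).2 (by simp)⟩, ?_, Or.inr ⟨a, b, c, h4⟩⟩
      rw [h2, ← h]; exact hle
end PartL4

section PartM1
set_option linter.unusedSectionVars false
variable {C G : Type u} [Field C] [CharZero C] [LieRing G] [LieAlgebra C G]
noncomputable def repA (U : Submodule C G) (π : G →ₗ[C] U) (χ : G →ₗ[C] C) (h2 : ∀ x y : U, ⁅(x : G), (y : G)⁆ ∈ U) :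
    G →ₗ[C] Module.End C (C × U) :=
  LinearMap.mk₂ C (fun x (p : C × U) =>
    (p.1 * χ x + χ ⁅x - (π x : G), (p.2 : G)⁆,
      p.1 • π x + π ⁅x - (π x : G), (p.2 : G)⁆ + χ x • p.2 + (2⁻¹ : C) • (⟨⁅(π x : G), (p.2 : G)⁆, h2 _ _⟩ : U)))
    (by
      intro x y p
      ext
      · simp; ring
      · simp; module)
    (by
      intro c x p
      ext
      · simp [← smul_sub]; ring
      · simp [← smul_sub]; module)
    (by
      intro x p q
      ext
      · simp; ring
      · simp; module)
    (by
      intro c x p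
      ext
      · simp; ring
      · simp; module)
variable {U : Submodule C G} {π : G →ₗ[C] U} {χ : G →ₗ[C] C} {h2 : ∀ x y : U, ⁅(x : G), (y : G)⁆ ∈ U}
theorem repA_apply (x : G) (p : C × U) : repA U π χ h2 x p = (p.1 * χ x + χ ⁅x - (π x : G), (p.2 : G)⁆,
      p.1 • π x + π ⁅x - (π x : G), (p.2 : G)⁆ + χ x • p.2 + (2⁻¹ : C) • (⟨⁅(π x : G), (p.2 : G)⁆, h2 _ _⟩ : U)) := rfl
theorem repA_p {x : G} (hx : π x = 0) (p : C × U) : repA U π χ h2 x p = (p.1 * χ x + χ ⁅x, (p.2 : G)⁆,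
      π ⁅x, (p.2 : G)⁆ + χ x • p.2) := by
  rw [repA_apply]; ext <;> simp [hx]
theorem repA_u (h0 : ∀ x : U, π x = x) (h4 : ∀ x : U, χ x = 0) (x : U) (p : C × U) :
    repA U π χ h2 x p = (0, p.1 • x + (2⁻¹ : C) • (⟨⁅(x : G), (p.2 : G)⁆, h2 _ _⟩ : U)) := by
  rw [repA_apply]; ext <;> simp [h0, h4]
theorem repA_lie (h0 : ∀ x : U, π x = x) (h1 : ∀ x y, π x = 0 → π y = 0 → π ⁅x, y⁆ = 0 ∧ χ ⁅x, y⁆ = 0)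
    (h3 : ∀ x y z : U, ⁅⁅(x : G), (y : G)⁆, (z : G)⁆ = 0) (h4 : ∀ x : U, χ x = 0)
    (J1 : ∀ x, π x = 0 → ∀ v w : U, χ ⁅⁅x, (v : G)⁆ - (π ⁅x, (v : G)⁆ : G), (w : G)⁆ +
      χ ⁅⁅x, (w : G)⁆ - (π ⁅x, (w : G)⁆ : G), (v : G)⁆ = 0)
    (J2 : ∀ x, π x = 0 → ∀ v w : U, π ⁅⁅x, (v : G)⁆ - (π ⁅x, (v : G)⁆ : G), (w : G)⁆ +
      π ⁅⁅x, (w : G)⁆ - (π ⁅x, (w : G)⁆ : G), (v : G)⁆ + (2 * χ ⁅x, (v : G)⁆) • w + (2 * χ ⁅x, (w : G)⁆) • v = 0)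
    (x y : G) : repA U π χ h2 ⁅x, y⁆ = repA U π χ h2 x * repA U π χ h2 y - repA U π χ h2 y * repA U π χ h2 x := by
  have hdec : ∀ z : G, ∃ z1 : G, ∃ z2 : U, π z1 = 0 ∧ z = z1 + z2 := fun z =>
    ⟨z - π z, π z, by simp [h0], by simp⟩
  have hp : ∀ z : G, π (z - (π z : G)) = 0 := fun z => by simp [h0]
  have hpp : ∀ x y : G, π x = 0 → π y = 0 → repA U π χ h2 ⁅x, y⁆ =
      repA U π χ h2 x * repA U π χ h2 y - repA U π χ h2 y * repA U π χ h2 x := by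
    intro x y hx hy
    refine LinearMap.ext fun p => ?_
    obtain ⟨q, v⟩ := p
    rw [LinearMap.sub_apply, Module.End.mul_apply, Module.End.mul_apply, repA_p (h1 x y hx hy).1, repA_p hx, repA_p hy,
      repA_p hx, repA_p hy]
    have e1 := (h1 x _ hx (hp ⁅y, (v : G)⁆))
    have e2 := (h1 y _ hy (hp ⁅x, (v : G)⁆))
    have e3 : ⁅⁅x, y⁆, (v : G)⁆ = ⁅x, ⁅y, (v : G)⁆⁆ - ⁅y, ⁅x, (v : G)⁆⁆ := lie_lie x y _
    simp only [lie_sub, map_sub, sub_eq_zero] at e1 e2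
    have e5 := (h1 x y hx hy).2
    refine Prod.ext ?_ ?_
    · simp [e3, e5, e1.2, e2.2]; ring
    · simp [e3, e5, e1.1, e2.1]; module
  have hpu : ∀ (x : G) (y : U), π x = 0 → repA U π χ h2 ⁅x, (y : G)⁆ =
      repA U π χ h2 x * repA U π χ h2 y - repA U π χ h2 y * repA U π χ h2 x := by
    intro x y hx
    refine LinearMap.ext fun p => ?_
    obtain ⟨q, v⟩ := p
    rw [LinearMap.sub_apply, Module.End.mul_apply, Module.End.mul_apply, repA_u h0 h4, repA_p hx, repA_p hx, repA_u h0 h4,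
      repA_apply]
    have j1 := J1 x hx y v
    have j2 := J2 x hx y v
    have e3 : ⁅x, ⁅(y : G), (v : G)⁆⁆ = ⁅⁅x, (y : G)⁆, (v : G)⁆ - ⁅⁅x, (v : G)⁆, (y : G)⁆ := by
      rw [leibniz_lie x (y : G) (v : G), ← lie_skew (y : G) ⁅x, (v : G)⁆]; abel
    have f1 : ∀ a b : U, χ ⁅(a : G), (b : G)⁆ = 0 := fun a b => h4 ⟨_, h2 a b⟩
    have f2 : ∀ a b : U, π ⁅(a : G), (b : G)⁆ = ⟨_, h2 a b⟩ := fun a b => h0 ⟨_, h2 a b⟩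
    have f3 : ∀ a b : U, (⟨⁅(a : G), (b : G)⁆, h2 a b⟩ : U) = - ⟨⁅(b : G), (a : G)⁆, h2 b a⟩ := fun a b => by
      ext; simp
    refine Prod.ext ?_ ?_
    · simp only [sub_lie, map_sub, f1, lie_add, lie_smul, map_add, map_smul, e3, Submodule.coe_add, Submodule.coe_smul, smul_eq_mul, Prod.fst_sub] at j1 ⊢
      linear_combination (1 / 2 : C) * j1
    · have f4 : ∀ c : C, ∀ a b d : U, (⟨⁅(a : G), ((b + c • d : U) : G)⁆, h2 a _⟩ : U) = ⟨_, h2 a b⟩ + c • ⟨_, h2 a d⟩ := fun c a b d => by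
        ext; simp
      simp only [f4]
      simp only [sub_lie, map_sub, f2, lie_add, lie_smul, map_add, map_smul, e3, Submodule.coe_add, Submodule.coe_smul, Prod.snd_sub] at j2 ⊢
      rw [f3 (π ⁅x, (v : G)⁆) y] at j2
      rw [← sub_eq_zero]
      have j3 := congrArg (fun z => (2⁻¹ : C) • z) j2
      simp only [smul_zero] at j3
      rw [← j3]
      module
  have huu : ∀ (x : U) (y : U), repA U π χ h2 ⁅(x : G), (y : G)⁆ =
      repA U π χ h2 x * repA U π χ h2 y - repA U π χ h2 y * repA U π χ h2 x := by
    intro x y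
    refine LinearMap.ext fun p => ?_
    obtain ⟨q, v⟩ := p
    have := repA_u (h2 := h2) h0 h4 ⟨⁅(x : G), (y : G)⁆, h2 x y⟩ (q, v)
    simp only at this
    rw [LinearMap.sub_apply, Module.End.mul_apply, Module.End.mul_apply, repA_u h0 h4, repA_u h0 h4, repA_u h0 h4, repA_u h0 h4,
      this]
    have f5 : ∀ c : C, ∀ a b d : U, (⟨⁅(a : G), ((c • b + (2⁻¹ : C) • (⟨⁅(b : G), (d : G)⁆, h2 b d⟩ : U) : U) : G)⁆, h2 a _⟩ : U) = c • ⟨_, h2 a b⟩ := fun c a b d => by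
      ext
      have : ⁅(a : G), ⁅(b : G), (d : G)⁆⁆ = 0 := by rw [← lie_skew, h3, neg_zero]
      simp [this]
    refine Prod.ext (by simp) ?_
    simp only [f5, Prod.snd_sub]
    ext
    simp only [h3, Submodule.coe_add, Submodule.coe_smul, Submodule.coe_sub]
    rw [← lie_skew (y : G) (x : G)]
    module
  obtain ⟨x1, x2, hx, rfl⟩ := hdec x
  obtain ⟨y1, y2, hy, rfl⟩ := hdec y
  have a1 := hpp x1 y1 hx hy
  have a2 := hpu x1 y2 hx
  have a3 := hpu y1 x2 hy
  have a4 := huu x2 y2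
  rw [← lie_skew, map_neg] at a3
  simp only [lie_add, add_lie, map_add, a1, a2, a4]
  rw [neg_eq_iff_eq_neg.1 a3]
  noncomm_ring
theorem exists_rep (h0 : ∀ x : U, π x = x) (h1 : ∀ x y, π x = 0 → π y = 0 → π ⁅x, y⁆ = 0 ∧ χ ⁅x, y⁆ = 0)
    (h2 : ∀ x y : U, ⁅(x : G), (y : G)⁆ ∈ U)
    (h3 : ∀ x y z : U, ⁅⁅(x : G), (y : G)⁆, (z : G)⁆ = 0) (h4 : ∀ x : U, χ x = 0)
    (J1 : ∀ x, π x = 0 → ∀ v w : U, χ ⁅⁅x, (v : G)⁆ - (π ⁅x, (v : G)⁆ : G), (w : G)⁆ +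
      χ ⁅⁅x, (w : G)⁆ - (π ⁅x, (w : G)⁆ : G), (v : G)⁆ = 0)
    (J2 : ∀ x, π x = 0 → ∀ v w : U, π ⁅⁅x, (v : G)⁆ - (π ⁅x, (v : G)⁆ : G), (w : G)⁆ +
      π ⁅⁅x, (w : G)⁆ - (π ⁅x, (w : G)⁆ : G), (v : G)⁆ + (2 * χ ⁅x, (v : G)⁆) • w + (2 * χ ⁅x, (w : G)⁆) • v = 0)
    (hU : U ≠ ⊥) :
    ∃ (_ : LieRingModule G (C × U)) (_ : LieModule C G (C × U)), ∃ (x : G) (q : C × U), ⁅x, q⁆ ≠ 0 := by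
  letI I1 : LieRingModule G (C × U) :=
    { bracket := fun x q => repA U π χ h2 x q
      add_lie := fun x y m => by change repA U π χ h2 (x + y) m = repA U π χ h2 x m + repA U π χ h2 y m; simp
      lie_add := fun x m n => by change repA U π χ h2 x (m + n) = repA U π χ h2 x m + repA U π χ h2 x n; simp
      leibniz_lie := fun x y m => by
        change repA U π χ h2 x (repA U π χ h2 y m) = repA U π χ h2 ⁅x, y⁆ m + repA U π χ h2 y (repA U π χ h2 x m)
        rw [repA_lie h0 h1 h3 h4 J1 J2]; simp }
  refine ⟨I1, ⟨fun t x m => ?_, fun t x m => ?_⟩, ?_⟩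
  · change repA U π χ h2 (t • x) m = t • repA U π χ h2 x m; simp
  · change repA U π χ h2 x (t • m) = t • repA U π χ h2 x m; simp
  · obtain ⟨x, hx, hx0⟩ := Submodule.exists_mem_ne_zero_of_ne_bot hU
    refine ⟨x, (1, 0), ?_⟩
    change repA U π χ h2 x (1, 0) ≠ 0
    rw [repA_u h0 h4 ⟨x, hx⟩]
    intro h
    have := congrArg Prod.snd h
    apply hx0
    simpa using this
end PartM1

section PartM2
set_option linter.unusedSectionVars false
variable {C G : Type u} [Field C] [CharZero C] [LieRing G] [LieAlgebra C G]
variable {ι M N : Type*} [Finite ι] [AddCommGroup M] [Module C M] [AddCommGroup N] [Module C N]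
structure LieRD (P : RootPairing ι C M N) (gs : M → Submodule C G) (hN : N →ₗ[C] G) (e f : ι → G)
    (κ : LinearMap.BilinForm C G) (q : ι → C) : Prop where
  lie_mem : ∀ {l m x y}, x ∈ gs l → y ∈ gs m → ⁅x, y⁆ ∈ gs (l + m)
  top : ⨆ l, gs l = ⊤
  root : ∀ {l x}, x ∈ gs l → x ≠ 0 → l = 0 ∨ ∃ i, l = P.root i
  hact : ∀ (s : N) {l x}, x ∈ gs l → ⁅hN s, x⁆ = P.toLinearMap l s • x
  hz : ∀ s, hN s ∈ gs 0
  ge : ∀ {i x}, x ∈ gs (P.root i) → ∃ c : C, x = c • e i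
  gf : ∀ {i x}, x ∈ gs (-P.root i) → ∃ c : C, x = c • f i
  e_mem : ∀ i, e i ∈ gs (P.root i)
  f_mem : ∀ i, f i ∈ gs (-P.root i)
  f_ne : ∀ i, f i ≠ 0
  ef : ∀ i, ⁅e i, f i⁆ = hN (P.coroot i)
  kinv : ∀ x y z, κ ⁅x, y⁆ z = κ x ⁅y, z⁆
  kort : ∀ {l m x y}, x ∈ gs l → y ∈ gs m → l + m ≠ 0 → κ x y = 0
  ksymm : ∀ x y, κ x y = κ y x
  kh : ∀ t i, κ (hN t) (hN (P.coroot i)) = 2 * (q i)⁻¹ * P.toLinearMap (P.root i) t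
  q_ne : ∀ i, q i ≠ 0
variable {P : RootPairing ι C M N} [P.IsCrystallographic] [P.IsReduced] {gs : M → Submodule C G} {hN : N →ₗ[C] G} {e f : ι → G}
    {κ : LinearMap.BilinForm C G} {q : ι → C} (S : LieRD P gs hN e f κ q) {t : N} {T : ι → ℤ} (hT : IsGr P t T)
include S hT
theorem LieRD.kef (i : ι) (hi : T i ≠ 0) : κ (f i) (e i) ≠ 0 := by
  intro h
  have h1 := S.kh t i
  rw [← S.ef, ← S.kinv, S.hact t (S.e_mem i), map_smul, LinearMap.smul_apply, S.ksymm, h, smul_zero, hT i] at h1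
  have := S.q_ne i
  have h2 : (T i : C) ≠ 0 := by exact_mod_cast hi
  simp [this, h2] at h1
theorem LieRD.qq (i j : ι) : (P.pairingIn ℤ j i : C) * q i = P.pairingIn ℤ i j * q j := by
  have h1 := S.kh (P.coroot j) i
  have h2 := S.kh (P.coroot i) j
  rw [S.ksymm, h2, isGr_coroot (P := P), isGr_coroot (P := P)] at h1
  have := S.q_ne i
  have := S.q_ne j
  field_simp at h1
  linear_combination h1
theorem LieRD.cls {l : M} {x : G} (hx : x ∈ gs l) (h0 : x ≠ 0) :
    ∃ n : ℤ, P.toLinearMap l t = n ∧ (0 < n → ∃ i, 0 < T i ∧ l = P.root i) ∧ (n < 0 → ∃ i, 0 < T i ∧ l = -P.root i) := by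
  rcases S.root hx h0 with rfl | ⟨i, rfl⟩
  · exact ⟨0, by simp, by simp, by simp⟩
  · refine ⟨T i, hT i, fun h => ⟨i, h, rfl⟩, fun h => ?_⟩
    obtain ⟨j, hj⟩ := exists_neg P i
    have h1 := hT.lin hj
    refine ⟨j, by omega, ?_⟩
    rw [hj]; module
theorem LieRD.neg {l : M} {x : G} (hx : x ∈ gs l) (h0 : x ≠ 0) {n : ℤ} (hn : P.toLinearMap l t = n) (hn0 : n < 0) :
    ∃ i, 0 < T i ∧ l = -P.root i := by
  obtain ⟨m, h1, h2, h3⟩ := S.cls hT hx h0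
  rw [hn] at h1
  have : n = m := by exact_mod_cast h1
  subst this
  exact h3 hn0
theorem LieRD.deg {l : M} {x : G} (hx : x ∈ gs l) (h0 : x ≠ 0) : ∃ n : ℤ, P.toLinearMap l t = n :=
  let ⟨n, h, _⟩ := S.cls hT hx h0; ⟨n, h⟩
theorem LieRD.exists_pi : ∃ π : G →ₗ[C] Submodule.span C (f '' {i | 0 < T i}),
    (∀ {l x} {n : ℤ}, x ∈ gs l → P.toLinearMap l t = n → 0 ≤ n → π x = 0) ∧
    (∀ i, 0 < T i → (π (f i) : G) = f i) ∧ (∀ x : Submodule.span C (f '' {i | 0 < T i}), π x = x) := by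
  classical
  have := Fintype.ofFinite ι
  let U := Submodule.span C (f '' {i | 0 < T i})
  let p0 : G →ₗ[C] G := ∑ i ∈ Finset.univ.filter (fun i => 0 < T i), ((κ (f i) (e i))⁻¹ • (κ.flip (e i))).smulRight (f i)
  have hp0 : ∀ x, p0 x = ∑ i ∈ Finset.univ.filter (fun i => 0 < T i), ((κ (f i) (e i))⁻¹ * κ x (e i)) • f i := fun x => by
    simp [p0, LinearMap.sum_apply]
  have hmem : ∀ x, p0 x ∈ U := fun x => by
    rw [hp0]
    exact Submodule.sum_mem _ fun i hi => Submodule.smul_mem _ _ (Submodule.subset_span ⟨i, by simpa using hi, rfl⟩)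
  have hf : ∀ i, 0 < T i → p0 (f i) = f i := fun i hi => by
    rw [hp0, Finset.sum_eq_single i, inv_mul_cancel₀ (S.kef hT i (by omega)), one_smul]
    · intro j _ hji
      rw [S.kort (S.f_mem i) (S.e_mem j)]
      · simp
      · intro h
        exact hji (P.root.injective (by rw [neg_add_eq_zero] at h; exact h.symm))
    · simp [hi]
  refine ⟨p0.codRestrict U hmem, ?_, fun i hi => by simp [hf i hi], ?_⟩
  · intro l x n hx hn hn0
    ext
    simp only [LinearMap.codRestrict_apply, ZeroMemClass.coe_zero]
    rw [hp0]
    refine Finset.sum_eq_zero fun i hi => ?_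
    rw [S.kort hx (S.e_mem i)]
    · simp
    · intro h
      rw [add_eq_zero_iff_eq_neg.1 h, map_neg, LinearMap.neg_apply, hT i] at hn
      have : - T i = n := by exact_mod_cast hn
      simp at hi
      omega
  · rintro ⟨x, hx⟩
    ext
    simp only [LinearMap.codRestrict_apply]
    induction hx using Submodule.span_induction with
    | mem x hx => obtain ⟨i, hi, rfl⟩ := hx; exact hf i hi
    | zero => simp
    | add x y _ _ h1 h2 => simp [h1, h2]
    | smul c x _ h => simp [h]
theorem LieRD.rep (s : C) (hs : ∀ i, 0 < T i → s * (2 * (q i)⁻¹ * T i) = 1) (hpos : ∃ i, 0 < T i)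
    (h3 : ∀ i j k, 0 < T i → 0 < T j → 0 < T k → ⁅⁅f i, f j⁆, f k⁆ = 0)
    (hJ : ∀ (π : G →ₗ[C] Submodule.span C (f '' {i | 0 < T i})) (χ : G →ₗ[C] C),
      (∀ {l x} {n : ℤ}, x ∈ gs l → P.toLinearMap l t = n → 0 ≤ n → π x = 0) →
      (∀ {l x} {n : ℤ}, x ∈ gs l → P.toLinearMap l t = n → n < 0 → (π x : G) = x) →
      (∀ {l x}, x ∈ gs l → l ≠ 0 → χ x = 0) → (∀ i, 0 < T i → χ (hN (P.coroot i)) = 1) →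
      (∀ x, χ x = s * κ (hN t) x) → ∀ i j k, 0 < T i → 0 < T j → 0 < T k →
        χ ⁅⁅e i, f j⁆ - (π ⁅e i, f j⁆ : G), f k⁆ + χ ⁅⁅e i, f k⁆ - (π ⁅e i, f k⁆ : G), f j⁆ = 0 ∧
        (π ⁅⁅e i, f j⁆ - (π ⁅e i, f j⁆ : G), f k⁆ : G) + (π ⁅⁅e i, f k⁆ - (π ⁅e i, f k⁆ : G), f j⁆ : G) +
          (2 * χ ⁅e i, f j⁆) • f k + (2 * χ ⁅e i, f k⁆) • f j = 0) :
    ∃ U : Submodule C G, Module.finrank C U ≤ {i | 0 < T i}.ncard ∧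
      ∃ (_ : LieRingModule G (C × U)) (_ : LieModule C G (C × U)), ∃ (x : G) (q : C × U), ⁅x, q⁆ ≠ 0 := by
  classical
  refine ⟨Submodule.span C (f '' {i | 0 < T i}), ?_, ?_⟩
  · have := Fintype.ofFinite ι
    refine (finrank_span_le_card _).trans ?_
    rw [← Set.ncard_eq_toFinset_card']
    exact Set.ncard_image_le (Set.toFinite _)
  obtain ⟨π, hπ0, hπf, h0⟩ := S.exists_pi hT
  let χ : G →ₗ[C] C := s • κ (hN t)
  have hχ : ∀ x, χ x = s * κ (hN t) x := fun x => rfl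
  have hχ0 : ∀ {l x}, x ∈ gs l → l ≠ 0 → χ x = 0 := fun {l x} hx hl => by
    rw [hχ, S.kort (S.hz t) hx (by simpa using hl), mul_zero]
  have hπ1 : ∀ {l x} {n : ℤ}, x ∈ gs l → P.toLinearMap l t = n → n < 0 → (π x : G) = x := by
    intro l x n hx hn hn0
    by_cases hx0 : x = 0
    · simp [hx0]
    · obtain ⟨i, hi, rfl⟩ := S.neg hT hx hx0 hn hn0
      obtain ⟨c, rfl⟩ := S.gf hx
      simp [hπf i hi]
  have key := hJ π χ hπ0 hπ1 hχ0 (fun i hi => by rw [hχ, S.kh, hT i]; exact hs i hi) hχ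
  have hind : ∀ p : G → Prop, p 0 → (∀ x y, p x → p y → p (x + y)) →
      (∀ l x (n : ℤ), x ∈ gs l → x ≠ 0 → P.toLinearMap l t = n → 0 ≤ n → p x) → ∀ x, π x = 0 → p x := by
    intro p hp0 hpa hp x hx
    suffices ∀ x, p (x - (π x : G)) by simpa [hx] using this x
    intro x
    have hxt : x ∈ ⨆ l, gs l := S.top ▸ Submodule.mem_top
    induction hxt using Submodule.iSup_induction' with
    | mem l x hx =>
      by_cases hx0 : x = 0
      · simpa [hx0]
      obtain ⟨n, hn⟩ := S.deg hT hx hx0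
      rcases lt_or_ge n 0 with h | h
      · rw [hπ1 hx hn h]; simpa
      · rw [hπ0 hx hn h]; simpa using hp l x n hx hx0 hn h
    | zero => simpa
    | add x y _ _ h1 h2 =>
      have := hpa _ _ h1 h2
      rw [map_add, Submodule.coe_add, add_sub_add_comm]; exact this
  have hUneg : ∀ i j, 0 < T i → 0 < T j → ⁅f i, f j⁆ ∈ Submodule.span C (f '' {i | 0 < T i}) := by
    intro i j hi hj
    have h1 := S.lie_mem (S.f_mem i) (S.f_mem j)
    have h2 := hπ1 h1 (n := -T i - T j) (by simp [hT i, hT j]; ring) (by omega)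
    rw [← h2]; exact SetLike.coe_mem _
  have hJJ : ∀ x, π x = 0 → ∀ v ∈ Submodule.span C (f '' {i | 0 < T i}), ∀ w ∈ Submodule.span C (f '' {i | 0 < T i}),
      χ ⁅⁅x, v⁆ - (π ⁅x, v⁆ : G), w⁆ + χ ⁅⁅x, w⁆ - (π ⁅x, w⁆ : G), v⁆ = 0 ∧
        (π ⁅⁅x, v⁆ - (π ⁅x, v⁆ : G), w⁆ : G) + (π ⁅⁅x, w⁆ - (π ⁅x, w⁆ : G), v⁆ : G) +
          (2 * χ ⁅x, v⁆) • w + (2 * χ ⁅x, w⁆) • v = 0 := by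
    intro x hx v hv w hw
    induction hv using Submodule.span_induction with
    | zero => simp
    | add v1 v2 _ _ a1 a2 =>
      constructor
      · rw [← add_zero (0 : C)]; nth_rewrite 1 [← a1.1]; rw [← a2.1]
        simp; ring
      · rw [← add_zero (0 : G)]; nth_rewrite 1 [← a1.2]; rw [← a2.2]
        simp; module
    | smul c v _ a =>
      constructor
      · rw [← mul_zero c, ← a.1]
        simp [← smul_sub]; ring
      · refine Eq.trans ?_ ((congrArg (c • ·) a.2).trans (smul_zero c))
        simp [← smul_sub]; module
    | mem v hv =>
      obtain ⟨j, hj, rfl⟩ := hv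
      induction hw using Submodule.span_induction with
      | zero => simp
      | add v1 v2 _ _ a1 a2 =>
        constructor
        · rw [← add_zero (0 : C)]; nth_rewrite 1 [← a1.1]; rw [← a2.1]
          simp; ring
        · rw [← add_zero (0 : G)]; nth_rewrite 1 [← a1.2]; rw [← a2.2]
          simp; module
      | smul c v _ a =>
        constructor
        · rw [← mul_zero c, ← a.1]
          simp [← smul_sub]; ring
        · refine Eq.trans ?_ ((congrArg (c • ·) a.2).trans (smul_zero c))
          simp [← smul_sub]; module
      | mem w hw =>
        obtain ⟨k, hk, rfl⟩ := hw
        refine hind (fun x => χ ⁅⁅x, f j⁆ - (π ⁅x, f j⁆ : G), f k⁆ + χ ⁅⁅x, f k⁆ - (π ⁅x, f k⁆ : G), f j⁆ = 0 ∧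
          (π ⁅⁅x, f j⁆ - (π ⁅x, f j⁆ : G), f k⁆ : G) + (π ⁅⁅x, f k⁆ - (π ⁅x, f k⁆ : G), f j⁆ : G) +
          (2 * χ ⁅x, f j⁆) • f k + (2 * χ ⁅x, f k⁆) • f j = 0) (by simp) ?_ ?_ x hx
        · intro x y a1 a2
          constructor
          · rw [← add_zero (0 : C)]; nth_rewrite 1 [← a1.1]; rw [← a2.1]
            simp; ring
          · rw [← add_zero (0 : G)]; nth_rewrite 1 [← a1.2]; rw [← a2.2]
            simp; module
        · intro l x n hx hx0 hn hn0
          rcases hn0.eq_or_lt with rfl | hn1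
          · have b : ∀ j, 0 < T j → χ ⁅x, f j⁆ = 0 ∧ (π ⁅x, f j⁆ : G) = ⁅x, f j⁆ := by
              intro j hj
              have hd : P.toLinearMap (l + -P.root j) t = ((-T j : ℤ) : C) := by simp [hn, hT j]
              refine ⟨hχ0 (S.lie_mem hx (S.f_mem j)) ?_, hπ1 (S.lie_mem hx (S.f_mem j)) hd (by omega)⟩
              intro h0
              rw [h0] at hd
              simp at hd
              omega
            simp [b j hj, b k hk]
          · obtain ⟨m, g1, g2, g3⟩ := S.cls hT hx hx0
            rw [hn] at g1
            have : n = m := by exact_mod_cast g1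
            subst this
            obtain ⟨i, hi, rfl⟩ := g2 hn1
            obtain ⟨c, rfl⟩ := S.ge hx
            have a := key i j k hi hj hk
            constructor
            · rw [← mul_zero c, ← a.1]
              simp [← smul_sub]; ring
            · refine Eq.trans ?_ ((congrArg (c • ·) a.2).trans (smul_zero c))
              simp [← smul_sub]; module
  refine exists_rep h0 (χ := χ) ?_ ?_ ?_ ?_ (fun x hx v w => (hJJ x hx v v.2 w w.2).1)
    (fun x hx v w => Subtype.ext (hJJ x hx v v.2 w w.2).2) ?_
  · intro x y hx hy
    revert y
    refine hind (fun x => ∀ y, π y = 0 → π ⁅x, y⁆ = 0 ∧ χ ⁅x, y⁆ = 0) (by simp) ?_ ?_ x hx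
    · intro x1 x2 a1 a2 y hy
      simp [a1 y hy, a2 y hy]
    · intro l x n hx hx0 hn hn0
      refine hind _ (by simp) ?_ ?_
      · intro x1 x2 a1 a2
        simp [a1, a2]
      · intro m y r hy hy0 hr hr0
        have hd : P.toLinearMap (l + m) t = ((n + r : ℤ) : C) := by simp [hn, hr]
        refine ⟨hπ0 (S.lie_mem hx hy) hd (by omega), ?_⟩
        by_cases hlm : l + m = 0
        · rw [hlm] at hd
          have : (0 : ℤ) = n + r := by simp only [map_zero, LinearMap.zero_apply] at hd; exact_mod_cast hd
          have hn : n = 0 := by omega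
          subst hn
          rw [hχ, ← S.kinv, S.hact t hx, hn]
          simp
        · exact hχ0 (S.lie_mem hx hy) hlm
  · rintro ⟨x, hx⟩ ⟨y, hy⟩
    simp only
    induction hx using Submodule.span_induction with
    | zero => simp
    | add _ _ _ _ a b => rw [add_lie]; exact add_mem a b
    | smul c _ _ a => rw [smul_lie]; exact Submodule.smul_mem _ _ a
    | mem x hx =>
      obtain ⟨i, hi, rfl⟩ := hx
      induction hy using Submodule.span_induction with
      | zero => simp
      | add _ _ _ _ a b => rw [lie_add]; exact add_mem a b
      | smul c _ _ a => rw [lie_smul]; exact Submodule.smul_mem _ _ a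
      | mem y hy => obtain ⟨j, hj, rfl⟩ := hy; exact hUneg i j hi hj
  · rintro ⟨x, hx⟩ ⟨y, hy⟩ ⟨z, hz⟩
    simp only
    induction hx using Submodule.span_induction with
    | zero => simp
    | add _ _ _ _ a b => rw [add_lie, add_lie, a, b, add_zero]
    | smul c _ _ a => rw [smul_lie, smul_lie, a, smul_zero]
    | mem x hx =>
      obtain ⟨i, hi, rfl⟩ := hx
      induction hy using Submodule.span_induction with
      | zero => simp
      | add _ _ _ _ a b => rw [lie_add, add_lie, a, b, add_zero]
      | smul c _ _ a => rw [lie_smul, smul_lie, a, smul_zero]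
      | mem y hy =>
        obtain ⟨j, hj, rfl⟩ := hy
        induction hz using Submodule.span_induction with
        | zero => simp
        | add _ _ _ _ a b => rw [lie_add, a, b, add_zero]
        | smul c _ _ a => rw [lie_smul, a, smul_zero]
        | mem y hy => obtain ⟨k, hk, rfl⟩ := hy; exact h3 i j k hi hj hk
  · rintro ⟨x, hx⟩
    simp only
    induction hx using Submodule.span_induction with
    | zero => simp
    | add _ _ _ _ a b => rw [map_add, a, b, add_zero]
    | smul c _ _ a => rw [map_smul, a, smul_zero]
    | mem x hx =>
      obtain ⟨i, hi, rfl⟩ := hx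
      exact hχ0 (S.f_mem i) (by simpa using P.ne_zero i)
  · obtain ⟨i, hi⟩ := hpos
    rw [Ne, Submodule.span_eq_bot]
    intro h
    exact S.f_ne i (h _ ⟨i, hi, rfl⟩)
end PartM2

section PartM3
set_option linter.unusedSectionVars false
variable {C G : Type u} [Field C] [CharZero C] [LieRing G] [LieAlgebra C G]
variable {ι M N : Type*} [Finite ι] [AddCommGroup M] [Module C M] [AddCommGroup N] [Module C N]
def JP {U : Submodule C G} (e f : ι → G) (π : G →ₗ[C] U) (χ : G →ₗ[C] C) (i j k : ι) : Prop :=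
  χ ⁅⁅e i, f j⁆ - (π ⁅e i, f j⁆ : G), f k⁆ + χ ⁅⁅e i, f k⁆ - (π ⁅e i, f k⁆ : G), f j⁆ = 0 ∧
  (π ⁅⁅e i, f j⁆ - (π ⁅e i, f j⁆ : G), f k⁆ : G) + (π ⁅⁅e i, f k⁆ - (π ⁅e i, f k⁆ : G), f j⁆ : G) +
    (2 * χ ⁅e i, f j⁆) • f k + (2 * χ ⁅e i, f k⁆) • f j = 0
theorem JP.symm {U : Submodule C G} {e f : ι → G} {π : G →ₗ[C] U} {χ : G →ₗ[C] C} {i j k : ι}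
    (h : JP e f π χ i j k) : JP e f π χ i k j := by
  refine ⟨(add_comm _ _).trans h.1, Eq.trans ?_ h.2⟩
  abel
variable {P : RootPairing ι C M N} [P.IsCrystallographic] [P.IsReduced] {gs : M → Submodule C G} {hN : N →ₗ[C] G} {e f : ι → G}
    {κ : LinearMap.BilinForm C G} {q : ι → C} (S : LieRD P gs hN e f κ q) {t : N} {T : ι → ℤ} (hT : IsGr P t T)
theorem pI (i j : ι) : P.toLinearMap (P.root i) (P.coroot j) = (P.pairingIn ℤ i j : C) := isGr_coroot j i
include S in
theorem LieRD.hf (i k : ι) : ⁅hN (P.coroot i), f k⁆ = -(P.pairingIn ℤ k i : C) • f k := by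
  rw [S.hact _ (S.f_mem k), map_neg, LinearMap.neg_apply, pI]
include S in
theorem LieRD.efk (i j k : ι) : ⁅⁅e i, f j⁆, f k⁆ ∈ gs (P.root i + -P.root j + -P.root k) :=
  S.lie_mem (S.lie_mem (S.e_mem i) (S.f_mem j)) (S.f_mem k)
include hT in
theorem deg2 (i j : ι) : P.toLinearMap (P.root i + -P.root j) t = ((T i - T j : ℤ) : C) := by
  simp [hT i, hT j]; ring
include hT in
theorem deg2' (i j : ι) : P.toLinearMap (-P.root i + -P.root j) t = ((-T i - T j : ℤ) : C) := by
  simp [hT i, hT j]; ring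
include hT in
theorem deg3 (i j k : ι) : P.toLinearMap (P.root i + -P.root j + -P.root k) t = ((T i - T j - T k : ℤ) : C) := by
  simp [hT i, hT j, hT k]; ring
include S in
theorem LieRD.swap (i k : ι) : ⁅⁅e i, f k⁆, f i⁆ = ⁅e i, ⁅f k, f i⁆⁆ - (P.pairingIn ℤ k i : C) • f k := by
  rw [lie_lie, S.ef, ← lie_skew (f k) (hN _), S.hf]; module
include S hT
theorem LieRD.van {l : M} {x : G} (hx : x ∈ gs l) {n : ℤ} (hn : P.toLinearMap l t = n) (hn0 : n < 0)
    (H : ∀ m, 0 < T m → l ≠ -P.root m) : x = 0 := by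
  by_contra h
  obtain ⟨m, h1, h2⟩ := S.neg hT hx h hn hn0
  exact H m h1 h2
variable {U : Submodule C G} {π : G →ₗ[C] U} {χ : G →ₗ[C] C}
  (hπ0 : ∀ {l x} {n : ℤ}, x ∈ gs l → P.toLinearMap l t = n → 0 ≤ n → π x = 0)
  (hπ1 : ∀ {l x} {n : ℤ}, x ∈ gs l → P.toLinearMap l t = n → n < 0 → (π x : G) = x)
  (hχ0 : ∀ {l x}, x ∈ gs l → l ≠ 0 → χ x = 0) (hχ1 : ∀ i, 0 < T i → χ (hN (P.coroot i)) = 1)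
include hπ0 hπ1 hχ0
theorem LieRD.chi_ne {l : M} {x : G} (hx : x ∈ gs l) {n : ℤ} (hn : P.toLinearMap l t = n) (hn0 : n ≠ 0) : χ x = 0 := by
  refine hχ0 hx ?_
  rintro rfl
  simp at hn
  exact hn0 (by exact_mod_cast hn.symm)
theorem LieRD.chi_ef {i j : ι} (hij : i ≠ j) : χ ⁅e i, f j⁆ = 0 := by
  refine hχ0 (S.lie_mem (S.e_mem i) (S.f_mem j)) ?_
  rw [← sub_eq_add_neg, sub_ne_zero]
  exact fun h => hij (P.root.injective h)
theorem LieRD.jp_main {i j k : ι} (hj : T j ≤ T i) (hk : T k ≤ T i) (hjk : T i < T j + T k)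
    (h : ⁅⁅e i, f j⁆, f k⁆ + ⁅⁅e i, f k⁆, f j⁆ + (2 * χ ⁅e i, f j⁆) • f k + (2 * χ ⁅e i, f k⁆) • f j = 0) :
    JP e f π χ i j k := by
  have d1 := hπ0 (S.lie_mem (S.e_mem i) (S.f_mem j)) (deg2 hT i j) (by omega)
  have d2 := hπ0 (S.lie_mem (S.e_mem i) (S.f_mem k)) (deg2 hT i k) (by omega)
  have d3 := hπ1 (S.efk i j k) (deg3 hT i j k) (by omega)
  have d4 := hπ1 (S.efk i k j) (deg3 hT i k j) (by omega)
  have d5 := S.chi_ne hT hπ0 hπ1 hχ0 (S.efk i j k) (deg3 hT i j k) (by omega)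
  have d6 := S.chi_ne hT hπ0 hπ1 hχ0 (S.efk i k j) (deg3 hT i k j) (by omega)
  constructor
  · rw [d1, d2, ZeroMemClass.coe_zero, sub_zero, sub_zero, d5, d6, add_zero]
  · rw [d1, d2, ZeroMemClass.coe_zero, sub_zero, sub_zero, d3, d4]; exact h
include hχ1
theorem LieRD.jp_iii {i : ι} (hi : 0 < T i) : JP e f π χ i i i := by
  refine S.jp_main hT hπ0 hπ1 hχ0 le_rfl le_rfl (by omega) ?_
  rw [S.ef, hχ1 i hi, S.hf, p_self]
  push_cast; module
theorem LieRD.jp_iik {i k : ι} (hi : 0 < T i) (hk : 0 < T k) (hki : T k ≤ T i) (hne : i ≠ k)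
    (hp : P.pairingIn ℤ k i = 1) (h0 : ⁅f k, f i⁆ = 0) : JP e f π χ i i k := by
  refine S.jp_main hT hπ0 hπ1 hχ0 le_rfl hki (by omega) ?_
  rw [S.swap, h0, S.ef, hχ1 i hi, S.hf, hp, S.chi_ef hT hπ0 hπ1 hχ0 hne]
  push_cast; rw [lie_zero]; module
end PartM3
section PartM3b
set_option linter.unusedSectionVars false
variable {C G : Type u} [Field C] [CharZero C] [LieRing G] [LieAlgebra C G]
variable {ι M N : Type*} [Finite ι] [AddCommGroup M] [Module C M] [AddCommGroup N] [Module C N]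
variable {P : RootPairing ι C M N} [P.IsCrystallographic] [P.IsReduced] {gs : M → Submodule C G} {hN : N →ₗ[C] G} {e f : ι → G}
    {κ : LinearMap.BilinForm C G} {q : ι → C} (S : LieRD P gs hN e f κ q) {t : N} {T : ι → ℤ} (hT : IsGr P t T)
include S hT
theorem LieRD.repA (hA : TyA P T) (hpos : ∃ i, 0 < T i) :
    ∃ U : Submodule C G, Module.finrank C U ≤ {i | 0 < T i}.ncard ∧
      ∃ (_ : LieRingModule G (C × U)) (_ : LieModule C G (C × U)), ∃ (x : G) (q : C × U), ⁅x, q⁆ ≠ 0 := by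
  have hle : ∀ i j, 0 < T i → 0 < T j → T i ≤ T j := by
    intro i j hi hj
    by_contra hlt
    have hne : i ≠ j := by rintro rfl; omega
    have h1 := hA i j hi hj hne
    obtain ⟨k, hk⟩ := exists_sub (P := P) (i := i) (j := j) (by omega) hne
    have h2 := hT.lin hk
    have h3 := hk.p j
    have h4 := p_self P j
    by_cases hkj : k = j
    · subst hkj; omega
    · have := hA k j (by omega) hj hkj
      omega
  have heq : ∀ i j, 0 < T i → 0 < T j → T i = T j := fun i j hi hj => le_antisymm (hle i j hi hj) (hle j i hj hi)
  have hq : ∀ i j, 0 < T i → 0 < T j → q i = q j := by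
    intro i j hi hj
    by_cases hij : i = j
    · rw [hij]
    · have := S.qq hT i j
      rw [hA i j hi hj hij, hA j i hj hi (Ne.symm hij)] at this
      simpa using this
  have hff : ∀ i j, 0 < T i → 0 < T j → ⁅f i, f j⁆ = 0 := by
    intro i j hi hj
    refine S.van hT (S.lie_mem (S.f_mem i) (S.f_mem j)) (deg2' hT i j) (by omega) ?_
    intro m hm h
    have := deg2' hT i j
    rw [h, map_neg, LinearMap.neg_apply, hT m] at this
    have h2 : - T m = - T i - T j := by exact_mod_cast this
    have := heq i m hi hm
    omega
  obtain ⟨i0, hi0⟩ := hpos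
  refine S.rep hT (q i0 / (2 * T i0)) ?_ ⟨i0, hi0⟩ (fun i j k hi hj hk => by rw [hff i j hi hj, zero_lie]) ?_
  · intro i hi
    rw [heq i i0 hi hi0, hq i i0 hi hi0]
    have h1 : (T i0 : C) ≠ 0 := by exact_mod_cast hi0.ne'
    have h2 := S.q_ne i0
    field_simp
  · intro π χ hπ0 hπ1 hχ0 hχ1 _ i j k hi hj hk
    change JP e f π χ i j k
    have hiik : ∀ k, 0 < T k → JP e f π χ i i k := fun k hk => by
      by_cases hik : i = k
      · subst hik; exact S.jp_iii hT hπ0 hπ1 hχ0 hχ1 hi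
      · exact S.jp_iik hT hπ0 hπ1 hχ0 hχ1 hi hk (hle k i hk hi) hik (hA k i hk hi (Ne.symm hik)) (hff k i hk hi)
    by_cases hij : i = j
    · subst hij; exact hiik k hk
    by_cases hik : i = k
    · subst hik; exact (hiik j hj).symm
    have hv : ∀ j k, 0 < T j → 0 < T k → i ≠ j → i ≠ k → ⁅⁅e i, f j⁆, f k⁆ = 0 := by
      intro j k hj hk hij hik
      have e1 := heq i j hi hj
      refine S.van hT (S.efk i j k) (deg3 hT i j k) (by omega) ?_
      intro m hm h
      have h1 := congrArg (fun l => P.toLinearMap l (P.coroot i)) h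
      simp only [map_add, map_neg, LinearMap.add_apply, LinearMap.neg_apply, pI] at h1
      have h2 : P.pairingIn ℤ i i + - P.pairingIn ℤ j i + - P.pairingIn ℤ k i = - P.pairingIn ℤ m i := by exact_mod_cast h1
      rw [p_self, hA j i hj hi (Ne.symm hij), hA k i hk hi (Ne.symm hik)] at h2
      by_cases hmi : m = i
      · subst hmi; rw [p_self] at h2; omega
      · rw [hA m i hm hi hmi] at h2; omega
    refine S.jp_main hT hπ0 hπ1 hχ0 (hle j i hj hi) (hle k i hk hi) (by have := heq i j hi hj; omega) ?_
    rw [hv j k hj hk hij hik, hv k j hk hj hik hij, S.chi_ef hT hπ0 hπ1 hχ0 hij, S.chi_ef hT hπ0 hπ1 hχ0 hik]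
    simp
end PartM3b

section PartM4
set_option linter.unusedSectionVars false
variable {C G : Type u} [Field C] [CharZero C] [LieRing G] [LieAlgebra C G]
variable {ι M N : Type*} [Finite ι] [AddCommGroup M] [Module C M] [AddCommGroup N] [Module C N]
variable {P : RootPairing ι C M N} [P.IsCrystallographic] [P.IsReduced] {gs : M → Submodule C G} {hN : N →ₗ[C] G} {e f : ι → G}
    {κ : LinearMap.BilinForm C G} {q : ι → C} (S : LieRD P gs hN e f κ q) {t : N} {T : ι → ℤ} (hT : IsGr P t T)
theorem TyB.symm {a b c : ι} (h : TyB P T a b c) : TyB P T b a c := by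
  obtain ⟨h1, h2, h3, h4, h5, h6, h7, h8, h9, h10, h11, h12⟩ := h
  refine ⟨fun i => (h1 i).trans (by tauto), h2.symm, h4, h3, ?_, h6.symm, h8, h7, h10, h9, h12, h11⟩
  unfold RLin at *
  rw [h5]; module
include S hT
theorem LieRD.vanB {a b c : ι} (h : TyB P T a b c) {l : M} {x : G} (hx : x ∈ gs l) {n : ℤ} (hn : P.toLinearMap l t = n)
    (hn0 : n < 0) {u v : ℤ} (hu : P.toLinearMap l (P.coroot a) = u) (hv : P.toLinearMap l (P.coroot b) = v)
    (H : ¬ (u = -2 ∧ v = 0) ∧ ¬ (u = 0 ∧ v = -2) ∧ ¬ (u = -2 ∧ v = -2)) : x = 0 := by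
  obtain ⟨h1, h2, h3, h4, h5, h6, h7, h8, h9, h10, h11, h12⟩ := h
  refine S.van hT hx hn hn0 ?_
  rintro m hm rfl
  simp only [map_neg, LinearMap.neg_apply, pI] at hu hv
  have e1 : - P.pairingIn ℤ m a = u := by exact_mod_cast hu
  have e2 : - P.pairingIn ℤ m b = v := by exact_mod_cast hv
  have := p_self P a
  have := p_self P b
  rcases (h1 m).1 hm with rfl | rfl | rfl <;> omega
theorem LieRD.br {a b c : ι} (h : TyB P T a b c) : ⁅e a, ⁅f a, f b⁆⁆ = (2 : C) • f b := by
  have hb := h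
  obtain ⟨h1, h2, h3, h4, h5, h6, h7, h8, h9, h10, h11, h12⟩ := h
  have ha : 0 < T a := (h1 a).2 (by simp)
  have saa := p_self P a
  have sbb := p_self P b
  have hab := S.lie_mem (S.f_mem a) (S.f_mem b)
  have hTc := hT.lin h5
  have mem1 := S.lie_mem (S.e_mem a) hab
  have z1 : ⁅f a, ⁅f a, f b⁆⁆ = 0 := by
    refine S.vanB hT hb (S.lie_mem (S.f_mem a) hab) (n := - T a - T a - T b) (u := -4) (v := -2) ?_ (by omega) ?_ ?_ (by omega)
    · simp [hT a, hT b]; ring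
    · simp only [map_add, map_neg, LinearMap.add_apply, LinearMap.neg_apply, pI, saa, h8]; norm_num
    · simp only [map_add, map_neg, LinearMap.add_apply, LinearMap.neg_apply, pI, sbb, h7]; norm_num
  have z2 : ⁅f a, f c⁆ = 0 := by
    refine S.vanB hT hb (S.lie_mem (S.f_mem a) (S.f_mem c)) (n := - T a - T c) (u := -4) (v := -2) (deg2' hT a c) (by omega) ?_ ?_ (by omega)
    · simp only [map_add, map_neg, LinearMap.add_apply, LinearMap.neg_apply, pI, saa, h9]; norm_num
    · simp only [map_add, map_neg, LinearMap.add_apply, LinearMap.neg_apply, pI, h10, h7]; norm_num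
  have ne : ⁅f a, f b⁆ ≠ 0 := by
    intro h0
    have m2 : ⁅e a, f c⁆ ∈ gs (-P.root b) := by
      have := S.lie_mem (S.e_mem a) (S.f_mem c)
      rwa [h5, show P.root a + -((1 : ℤ) • P.root a + (1 : ℤ) • P.root b) = -P.root b by module] at this
    obtain ⟨s, hs⟩ := S.gf m2
    have e1 : ⁅f a, ⁅e a, f c⁆⁆ = 0 := by rw [hs, lie_smul, h0, smul_zero]
    have e2 : ⁅⁅e a, f a⁆, f c⁆ = 0 := by rw [lie_lie, z2, e1, lie_zero, sub_zero]
    rw [S.ef, S.hf, h9] at e2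
    have := S.f_ne c
    norm_num at e2
    exact this e2
  have m1 : ⁅e a, ⁅f a, f b⁆⁆ ∈ gs (-P.root b) := by convert mem1 using 1; abel
  obtain ⟨s, hs⟩ := S.gf m1
  have e2 : ⁅⁅e a, f a⁆, ⁅f a, f b⁆⁆ = - (s • ⁅f a, f b⁆) := by rw [lie_lie, z1, hs, lie_zero, zero_sub, lie_smul]
  rw [S.ef, S.hact _ hab] at e2
  simp only [map_add, map_neg, LinearMap.add_apply, LinearMap.neg_apply, pI, saa, h8] at e2
  rw [← neg_smul] at e2
  have := smul_left_injective C ne e2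
  rw [hs]
  norm_num at this
  rw [← this]
theorem LieRD.jpa {a b c : ι} (h : TyB P T a b c) {U : Submodule C G} {π : G →ₗ[C] U} {χ : G →ₗ[C] C}
    (hπ0 : ∀ {l x} {n : ℤ}, x ∈ gs l → P.toLinearMap l t = n → 0 ≤ n → π x = 0)
    (hπ1 : ∀ {l x} {n : ℤ}, x ∈ gs l → P.toLinearMap l t = n → n < 0 → (π x : G) = x)
    (hχ0 : ∀ {l x}, x ∈ gs l → l ≠ 0 → χ x = 0) (hχ1 : ∀ i, 0 < T i → χ (hN (P.coroot i)) = 1) {j k : ι}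
    (hj : 0 < T j) (hk : 0 < T k) : JP e f π χ a j k := by
  have hb := h
  obtain ⟨h1, h2, h3, h4, h5, h6, h7, h8, h9, h10, h11, h12⟩ := h
  have ha : 0 < T a := (h1 a).2 (by simp)
  have saa := p_self P a
  have sbb := p_self P b
  have hTc := hT.lin h5
  have eac : χ ⁅e a, f c⁆ = 0 := S.chi_ef hT hπ0 hπ1 hχ0 h3
  have eab : χ ⁅e a, f b⁆ = 0 := S.chi_ef hT hπ0 hπ1 hχ0 h2
  have pac : (π ⁅e a, f c⁆ : G) = ⁅e a, f c⁆ := hπ1 (S.lie_mem (S.e_mem a) (S.f_mem c)) (deg2 hT a c) (by omega)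
  have paa : π ⁅e a, f a⁆ = 0 := hπ0 (S.lie_mem (S.e_mem a) (S.f_mem a)) (deg2 hT a a) (by omega)
  have pab : π ⁅e a, f b⁆ = 0 := hπ0 (S.lie_mem (S.e_mem a) (S.f_mem b)) (deg2 hT a b) (by omega)
  have jaa : JP e f π χ a a a := S.jp_iii hT hπ0 hπ1 hχ0 hχ1 ha
  have jab : JP e f π χ a a b := by
    refine S.jp_main hT hπ0 hπ1 hχ0 le_rfl (by omega) (by omega) ?_
    rw [S.swap, ← lie_skew (f b), lie_neg, S.br hT hb, S.ef, S.hf, h8, hχ1 a ha, eab]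
    push_cast; module
  have jbb : JP e f π χ a b b := by
    refine S.jp_main hT hπ0 hπ1 hχ0 (by omega) (by omega) (by omega) ?_
    have : ⁅⁅e a, f b⁆, f b⁆ = 0 := by
      refine S.vanB hT hb (S.efk a b b) (deg3 hT a b b) (by omega) (u := 2) (v := -4) ?_ ?_ (by omega)
      · simp only [map_add, map_neg, LinearMap.add_apply, LinearMap.neg_apply, pI, saa, h8]; norm_num
      · simp only [map_add, map_neg, LinearMap.add_apply, LinearMap.neg_apply, pI, sbb, h7]; norm_num
    rw [this, eab]; simp
  have jac : JP e f π χ a a c := by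
    constructor
    · rw [paa, pac, ZeroMemClass.coe_zero, sub_zero, sub_self, zero_lie, map_zero, add_zero]
      exact S.chi_ne hT hπ0 hπ1 hχ0 (S.efk a a c) (deg3 hT a a c) (by omega)
    · rw [paa, pac, ZeroMemClass.coe_zero, sub_zero, sub_self, zero_lie, map_zero, ZeroMemClass.coe_zero,
        hπ1 (S.efk a a c) (deg3 hT a a c) (by omega), eac, S.ef, S.hf, h9, hχ1 a ha]
      push_cast; module
  have jbc : JP e f π χ a b c := by
    have : ⁅⁅e a, f b⁆, f c⁆ = 0 := by
      refine S.vanB hT hb (S.efk a b c) (deg3 hT a b c) (by omega) (u := 0) (v := -4) ?_ ?_ (by omega)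
      · simp only [map_add, map_neg, LinearMap.add_apply, LinearMap.neg_apply, pI, saa, h8, h9]; norm_num
      · simp only [map_add, map_neg, LinearMap.add_apply, LinearMap.neg_apply, pI, sbb, h7, h10]; norm_num
    constructor
    · rw [pab, pac, ZeroMemClass.coe_zero, sub_zero, sub_self, zero_lie, map_zero, add_zero, this, map_zero]
    · rw [pab, pac, ZeroMemClass.coe_zero, sub_zero, sub_self, zero_lie, map_zero, ZeroMemClass.coe_zero, this, eab, eac]
      simp
  have jcc : JP e f π χ a c c := by
    constructor
    · rw [pac, sub_self, zero_lie, map_zero, add_zero]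
    · rw [pac, sub_self, zero_lie, map_zero, eac]
      simp
  rcases (h1 j).1 hj with rfl | rfl | rfl <;> rcases (h1 k).1 hk with rfl | rfl | rfl
  exacts [jaa, jab, jac, jab.symm, jbb, jbc, jac.symm, jbc.symm, jcc]
theorem LieRD.repB {a b c : ι} (h : TyB P T a b c) :
    ∃ U : Submodule C G, Module.finrank C U ≤ {i | 0 < T i}.ncard ∧
      ∃ (_ : LieRingModule G (C × U)) (_ : LieModule C G (C × U)), ∃ (x : G) (q : C × U), ⁅x, q⁆ ≠ 0 := by
  have hb := h
  obtain ⟨h1, h2, h3, h4, h5, h6, h7, h8, h9, h10, h11, h12⟩ := h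
  have ha : 0 < T a := (h1 a).2 (by simp)
  have hc : 0 < T c := (h1 c).2 (by simp)
  have hb' : 0 < T b := (h1 b).2 (by simp)
  have saa := p_self P a
  have sbb := p_self P b
  have hTc := hT.lin h5
  have qa := S.q_ne a
  have q1 := S.qq hT c a
  have q2 := S.qq hT c b
  rw [h11, h9] at q1
  rw [h12, h10] at q2
  push_cast at q1 q2
  have hqb : q b = q a := by linear_combination (1 / 2 : C) * (q1 - q2)
  have hqc : q c = 2 * q a := by linear_combination q1
  have hTcc : (T c : C) = 2 * T a := by rw [hTc, ← h6]; push_cast; ring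
  have hTa : (T a : C) ≠ 0 := by exact_mod_cast ha.ne'
  refine S.rep hT (q a / (2 * T a)) ?_ ⟨a, ha⟩ ?_ ?_
  · intro i hi
    rcases (h1 i).1 hi with rfl | rfl | rfl
    · field_simp
    · rw [hqb, ← h6]; field_simp
    · rw [hqc, hTcc]; field_simp
  · intro i j k hi hj hk
    have hge : ∀ i, 0 < T i → T a ≤ T i ∧ T i ≤ 2 * T a := by
      intro i hi
      rcases (h1 i).1 hi with rfl | rfl | rfl <;> omega
    have g1 := hge i hi
    have g2 := hge j hj
    have g3 := hge k hk
    have hd : P.toLinearMap (-P.root i + -P.root j + -P.root k) t = ((- T i - T j - T k : ℤ) : C) := by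
      simp [hT i, hT j, hT k]; ring
    refine S.van hT (S.lie_mem (S.lie_mem (S.f_mem i) (S.f_mem j)) (S.f_mem k)) hd (by omega) ?_
    intro m hm h
    rw [h, map_neg, LinearMap.neg_apply, hT m] at hd
    have h2 : - T m = - T i - T j - T k := by exact_mod_cast hd
    have g4 := hge m hm
    omega
  · intro π χ hπ0 hπ1 hχ0 hχ1 hχ i j k hi hj hk
    change JP e f π χ i j k
    by_cases hia : i = a
    · subst hia; exact S.jpa hT hb hπ0 hπ1 hχ0 hχ1 hj hk
    by_cases hib : i = b
    · subst hib; exact S.jpa hT hb.symm hπ0 hπ1 hχ0 hχ1 hj hk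
    obtain rfl : i = c := by rcases (h1 i).1 hi with h | h | h <;> tauto
    have scc := p_self P i
    have jcc : JP e f π χ i i i := S.jp_iii hT hπ0 hπ1 hχ0 hχ1 hi
    have za : ⁅f a, f i⁆ = 0 := by
      refine S.vanB hT hb (S.lie_mem (S.f_mem a) (S.f_mem i)) (n := - T a - T i) (u := -4) (v := -2) (deg2' hT a i) (by omega) ?_ ?_ (by omega)
      · simp only [map_add, map_neg, LinearMap.add_apply, LinearMap.neg_apply, pI, saa, h9]; norm_num
      · simp only [map_add, map_neg, LinearMap.add_apply, LinearMap.neg_apply, pI, h10, h7]; norm_num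
    have zb : ⁅f b, f i⁆ = 0 := by
      refine S.vanB hT hb (S.lie_mem (S.f_mem b) (S.f_mem i)) (n := - T b - T i) (u := -2) (v := -4) (deg2' hT b i) (by omega) ?_ ?_ (by omega)
      · simp only [map_add, map_neg, LinearMap.add_apply, LinearMap.neg_apply, pI, h8, h9]; norm_num
      · simp only [map_add, map_neg, LinearMap.add_apply, LinearMap.neg_apply, pI, h10, sbb]; norm_num
    have jca : JP e f π χ i i a := S.jp_iik hT hπ0 hπ1 hχ0 hχ1 hi ha (by omega) hia h11 za
    have jcb : JP e f π χ i i b := S.jp_iik hT hπ0 hπ1 hχ0 hχ1 hi hb' (by omega) hib h12 zb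
    have jx : ∀ j k, i ≠ j → i ≠ k → T j = T a → T k = T a → JP e f π χ i j k := by
      intro j k hij hik hj hk
      have kk : ∀ j k, T j = T a → κ (hN t) ⁅⁅e i, f j⁆, f k⁆ = T a * κ (e i) ⁅f j, f k⁆ := by
        intro j k hj
        rw [← S.kinv, S.hact t (S.lie_mem (S.e_mem i) (S.f_mem j)), deg2 hT i j, map_smul, LinearMap.smul_apply, S.kinv, smul_eq_mul]
        congr 2
        omega
      have d1 := hπ0 (S.lie_mem (S.e_mem i) (S.f_mem j)) (deg2 hT i j) (by omega)
      have d2 := hπ0 (S.lie_mem (S.e_mem i) (S.f_mem k)) (deg2 hT i k) (by omega)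
      have d3 := hπ0 (S.efk i j k) (deg3 hT i j k) (by omega)
      have d4 := hπ0 (S.efk i k j) (deg3 hT i k j) (by omega)
      constructor
      · rw [d1, d2, ZeroMemClass.coe_zero, sub_zero, sub_zero, hχ, hχ, kk j k hj, kk k j hk, ← lie_skew (f k) (f j), map_neg]
        ring
      · rw [d1, d2, ZeroMemClass.coe_zero, sub_zero, sub_zero, d3, d4, S.chi_ef hT hπ0 hπ1 hχ0 hij, S.chi_ef hT hπ0 hπ1 hχ0 hik]
        simp
    rcases (h1 j).1 hj with rfl | rfl | rfl <;> rcases (h1 k).1 hk with rfl | rfl | rfl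
    exacts [jx _ _ hia hia rfl rfl, jx _ _ hia hib rfl h6.symm, jca.symm, jx _ _ hib hia h6.symm rfl, jx _ _ hib hib h6.symm h6.symm,
      jcb.symm, jca, jcb, jcc]
end PartM4

section PartM5
open LieAlgebra LieAlgebra.IsKilling LieModule Module
variable {C G : Type u} [Field C] [CharZero C] [LieRing G] [LieAlgebra C G] [Module.Finite C G] [IsKilling C G]
  (H : LieSubalgebra C G) [H.IsCartanSubalgebra] [IsTriangularizable C H G]
noncomputable def gsp (l : Dual C H) : Submodule C G := (rootSpace H (⇑l)).toSubmodule
theorem exists_lieRD : ∃ (e f : H.root → G) (q : H.root → C),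
    LieRD (rootSystem H) (gsp H) H.toSubmodule.subtype e f (killingForm C G) q ∧
      ∀ i, IsSl2Triple (coroot i.1 : G) (e i) (f i) := by
  have h0 : ∀ i : H.root, ∃ p : G × G, IsSl2Triple (coroot i.1 : G) p.1 p.2 ∧ p.1 ∈ rootSpace H i.1 ∧ p.2 ∈ rootSpace H (-i.1) := by
    intro i
    obtain ⟨h, e, f, h1, h2, h3⟩ := exists_isSl2Triple_of_weight_isNonZero (H.isNonZero_coe_root i)
    have := h1.h_eq_coroot (H.isNonZero_coe_root i) h2 h3
    subst this
    exact ⟨(e, f), h1, h2, h3⟩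
  choose p hp1 hp2 hp3 using h0
  have one : ∀ (w : Weight C H G), w.IsNonZero → ∀ z ∈ rootSpace H w, z ≠ 0 → ∀ x ∈ rootSpace H w, ∃ c : C, x = c • z := by
    intro w hw z hz hz0 x hx
    have h1 := finrank_rootSpace_eq_one w hw
    obtain ⟨c, hc⟩ := (finrank_eq_one_iff_of_nonzero' (⟨z, hz⟩ : rootSpace H w) (by simpa using hz0)).1 h1 ⟨x, hx⟩
    exact ⟨c, by simpa using (congrArg Subtype.val hc).symm⟩
  refine ⟨fun i => (p i).1, fun i => (p i).2, fun i => i.1 ((cartanEquivDual H).symm i.1.toLinear), ⟨?_, ?_, ?_, ?_, ?_, ?_, ?_, ?_, ?_, ?_, ?_, ?_, ?_, ?_, ?_, ?_⟩, hp1⟩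
  · intro l m x y hx hy
    exact lie_mem_genWeightSpace_of_mem_genWeightSpace hx hy
  · have h1 := iSup_genWeightSpace_eq_top' C H G
    rw [← LieSubmodule.toSubmodule_inj, LieSubmodule.iSup_toSubmodule, LieSubmodule.top_toSubmodule] at h1
    rw [eq_top_iff, ← h1]
    refine iSup_le fun w => ?_
    exact le_iSup (gsp H) w.toLinear
  · intro l x hx hx0
    by_cases hl : l = 0
    · exact Or.inl hl
    right
    have hne : genWeightSpace G (⇑l) ≠ ⊥ := fun h => hx0 (by
      have : x ∈ (rootSpace H (⇑l)) := hx
      rw [rootSpace, h] at this; simpa using this)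
    let w : Weight C H G := ⟨l, hne⟩
    refine ⟨⟨w, ?_⟩, ?_⟩
    · simp only [LieSubalgebra.root, Finset.mem_filter, Finset.mem_univ, true_and]
      intro h
      apply hl
      ext z
      exact congrFun h z
    · ext z; rfl
  · intro s l x hx
    exact lie_eq_smul_of_mem_rootSpace hx s
  · intro s
    change (s : G) ∈ rootSpace H (0 : H → C)
    rw [rootSpace_zero_eq]
    exact s.2
  · intro i x hx
    exact one i.1 (H.isNonZero_coe_root i) _ (hp2 i) (hp1 i).e_ne_zero x hx
  · intro i x hx
    exact one (-i.1) (H.isNonZero_coe_root i).neg _ (by simpa using hp3 i) (hp1 i).f_ne_zero x (by rw [Weight.coe_neg]; exact hx)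
  · exact hp2
  · intro i
    exact hp3 i
  · intro i; exact (hp1 i).f_ne_zero
  · intro i; exact (hp1 i).lie_e_f
  · intro x y z; exact LieModule.traceForm_apply_lie_apply C G G x y z
  · intro l m x y hx hy hlm
    refine killingForm_apply_eq_zero_of_mem_rootSpace_of_add_ne_zero C G H hx hy ?_
    intro h
    exact hlm (by ext z; exact congrFun h z)
  · intro x y; exact LieModule.traceForm_comm C G G x y
  · intro t i
    have := traceForm_coroot i.1 t
    rw [LieModule.traceForm_comm] at this
    change traceForm C H G t (coroot i.1) = _
    rw [this]
    simp [mul_assoc]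
  · intro i
    exact root_apply_cartanEquivDual_symm_ne_zero (H.isNonZero_coe_root i)
theorem exists_rep_of_gr {t : H} {T : H.root → ℤ} (hT : IsGr (rootSystem H) t T) (hpos : ∃ i, 0 < T i)
    (h3 : {i | 0 < T i}.ncard ≤ 3) :
    ∃ U : Submodule C G, Module.finrank C U ≤ {i | 0 < T i}.ncard ∧
      ∃ (_ : LieRingModule G (C × U)) (_ : LieModule C G (C × U)), ∃ (x : G) (q : C × U), ⁅x, q⁆ ≠ 0 := by
  obtain ⟨e, f, q, S, -⟩ := exists_lieRD H
  obtain ⟨t', T', h1, h2, h4, h5⟩ := comb_main hT hpos h3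
  rcases h5 with h5 | ⟨a, b, c, h5⟩
  · obtain ⟨U, hU, hh⟩ := S.repA h1 h5 h2
    exact ⟨U, hU.trans h4, hh⟩
  · obtain ⟨U, hU, hh⟩ := S.repB h1 h5
    exact ⟨U, hU.trans h4, hh⟩
end PartM5

section PartM6a
open Module
theorem exists_cp {C V X : Type*} [Field C] [AddCommGroup V] [Module C V] (W : X → Submodule C V)
    (h1 : iSupIndep W) (h2 : ⨆ x, W x = ⊤) :
    ∃ cp : X → V →ₗ[C] V, (∀ x v, cp x v ∈ W x) ∧ (∀ x, ∀ v ∈ W x, cp x v = v) ∧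
      (∀ x x', x ≠ x' → ∀ v ∈ W x, cp x' v = 0) ∧ (∀ v, {x | cp x v ≠ 0}.Finite) ∧
      ∀ v w, (∀ x, cp x v = cp x w) → v = w := by
  classical
  have hint := DirectSum.isInternal_submodule_of_iSupIndep_of_iSup_eq_top h1 h2
  let _ := hint.chooseDecomposition
  refine ⟨fun x => (W x).subtype ∘ₗ DirectSum.component C X (fun i => W i) x ∘ₗ (DirectSum.decomposeLinearEquiv W).toLinearMap, ?_, ?_, ?_, ?_, ?_⟩
  · intro x v; exact (DirectSum.decompose W v x).2
  · intro x v hv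
    exact DirectSum.decompose_of_mem_same W hv
  · intro x x' h v hv
    exact DirectSum.decompose_of_mem_ne W hv h
  · intro v
    refine (DFinsupp.finite_support (DirectSum.decompose W v)).subset ?_
    intro x hx h
    apply hx
    change ((DirectSum.decompose W v x : W x) : V) = 0
    rw [h]; rfl
  · intro v w h
    apply (DirectSum.decompose W).injective
    ext x
    exact h x
theorem cp_shift {C V X : Type*} [Field C] [AddCommGroup V] [Module C V] [AddCommGroup X] {W : X → Submodule C V}
    (h2 : ⨆ x, W x = ⊤) {cp : X → V →ₗ[C] V} (c1 : ∀ x, ∀ v ∈ W x, cp x v = v)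
    (c2 : ∀ x x', x ≠ x' → ∀ v ∈ W x, cp x' v = 0) {A : End C V} {a : X}
    (hA : ∀ x, ∀ v ∈ W x, A v ∈ W (x + a)) (x : X) (v : V) : cp (x + a) (A v) = A (cp x v) := by
  have hv : v ∈ ⨆ x, W x := h2 ▸ Submodule.mem_top
  induction hv using Submodule.iSup_induction' with
  | mem z v hv =>
    by_cases h : z = x
    · subst h; rw [c1 _ _ hv, c1 _ _ (hA _ _ hv)]
    · rw [c2 _ _ h _ hv, c2 (z + a) _ (fun h' => h (add_right_cancel h')) _ (hA _ _ hv), map_zero]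
  | zero => simp
  | add v w _ _ h3 h4 => rw [map_add, map_add, map_add, map_add, h3, h4]
theorem lead {C V X J : Type*} [Field C] [AddCommGroup V] [Module C V] [AddCommGroup X] [Module ℚ X] [Finite J]
    {W : X → Submodule C V} (h2 : ⨆ x, W x = ⊤) {cp : X → V →ₗ[C] V} (c1 : ∀ x, ∀ v ∈ W x, cp x v = v)
    (c2 : ∀ x x', x ≠ x' → ∀ v ∈ W x, cp x' v = 0) {A : J → End C V} {a : J → X}
    (hA : ∀ j x, ∀ v ∈ W x, A j v ∈ W (x + a j)) (f : X →ₗ[ℚ] ℚ) (hf : Function.Injective fun j => f (a j))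
    {y : V} {μ : X} (hμ : ∀ x, cp x y ≠ 0 → f x ≤ f μ) (hne : ∀ j, A j (cp μ y) ≠ 0) :
    LinearIndependent C fun j => A j y := by
  classical
  have := Fintype.ofFinite J
  rw [Fintype.linearIndependent_iff]
  intro g hg
  by_contra! hcon
  obtain ⟨j0, hj0, hmax⟩ := (Finset.univ.filter fun j => g j ≠ 0).exists_max_image (fun j => f (a j))
    (by obtain ⟨i, hi⟩ := hcon; exact ⟨i, by simpa using hi⟩)
  have h3 := congrArg (cp (μ + a j0)) hg
  rw [map_zero, map_sum, Finset.sum_eq_single j0, map_smul, cp_shift h2 c1 c2 (hA j0)] at h3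
  · simp only [Finset.mem_filter, Finset.mem_univ, true_and] at hj0
    exact (smul_ne_zero hj0 (hne j0)) h3
  · intro b _ hb
    by_cases hgb : g b = 0
    · rw [hgb, zero_smul, map_zero]
    have h4 : cp (μ + a j0 - a b) y = 0 := by
      by_contra h5
      have h6 := hμ _ h5
      have h7 := hmax b (by simpa using hgb)
      have h8 : f (a b) ≠ f (a j0) := fun h => hb (hf h)
      rw [map_sub, map_add] at h6
      exact h8 (le_antisymm h7 (by linarith))
    have h5 := cp_shift h2 c1 c2 (hA b) (μ + a j0 - a b) y
    rw [sub_add_cancel, h4, map_zero] at h5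
    rw [map_smul, h5, smul_zero]
  · intro h; exact absurd (Finset.mem_univ _) h
theorem exists_eig {C V : Type*} [Field C] [AddCommGroup V] [Module C V] (A : End C V) (c : C) (v : V) (hv : v ≠ 0)
    (k : ℕ) (hk : ((A - c • 1) ^ k) v = 0) : ∃ j : ℕ, ((A - c • 1) ^ j) v ≠ 0 ∧ A (((A - c • 1) ^ j) v) = c • (((A - c • 1) ^ j) v) := by
  obtain ⟨j, h1, h2⟩ := Nat.exists_not_and_succ_of_not_zero_of_exists (p := fun k => ((A - c • 1) ^ k) v = 0) (by simpa using hv) ⟨k, hk⟩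
  refine ⟨j, h1, ?_⟩
  rw [pow_succ', Module.End.mul_apply, LinearMap.sub_apply, sub_eq_zero] at h2
  simpa using h2
variable {C G V : Type*} [Field C] [CharZero C] [LieRing G] [LieAlgebra C G] [AddCommGroup V] [Module C V] [Module.Finite C V]
  [LieRingModule G V] [LieModule C G V]
open LieModule
theorem sl2_int {h e f : G} (t : IsSl2Triple h e f) (hn : IsNilpotent (toEnd C G V e)) {c : C} {v : V} (hv : v ≠ 0)
    {k : ℕ} (hk : ((toEnd C G V h - c • 1) ^ k) v = 0) : ∃ z : ℤ, c = z := by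
  obtain ⟨j, h1, h2⟩ := exists_eig _ _ _ hv _ hk
  set u := ((toEnd C G V h - c • 1) ^ j) v
  obtain ⟨m, hm⟩ := hn
  obtain ⟨n, h3, h4⟩ := Nat.exists_not_and_succ_of_not_zero_of_exists (p := fun k => ((toEnd C G V e) ^ k) u = 0) (by simpa using h1) ⟨m, by rw [hm]; rfl⟩
  have P : t.HasPrimitiveVectorWith (((toEnd C G V e) ^ n) u) (c + 2 * n) :=
    ⟨h3, t.lie_h_pow_toEnd_e h2 n, by rwa [pow_succ', Module.End.mul_apply] at h4⟩
  obtain ⟨N, hN⟩ := P.exists_nat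
  exact ⟨N - 2 * n, by push_cast; rw [← hN]; ring⟩
theorem sl2_inj {h e f : G} (t : IsSl2Triple h e f) {z : ℤ} (hz : z < 0) {v : V} (hv : v ≠ 0)
    {k : ℕ} (hk : ((toEnd C G V h - (z : C) • 1) ^ k) v = 0) : ⁅e, v⁆ ≠ 0 := by
  intro hev
  obtain ⟨j, h1, h2⟩ := exists_eig _ _ _ hv _ hk
  have h3 : ∀ i : ℕ, ⁅e, ((toEnd C G V h - (z : C) • 1) ^ i) v⁆ = 0 := by
    intro i
    induction i with
    | zero => simpa using hev
    | succ i ih =>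
      rw [pow_succ', Module.End.mul_apply]
      set u := ((toEnd C G V h - (z : C) • 1) ^ i) v
      have h4 : ⁅e, ⁅h, u⁆⁆ = ⁅⁅e, h⁆, u⁆ + ⁅h, ⁅e, u⁆⁆ := leibniz_lie e h u
      rw [← lie_skew e h, t.lie_h_e_smul C] at h4
      simp [lie_sub, h4, ih]
  have P : t.HasPrimitiveVectorWith (((toEnd C G V h - (z : C) • 1) ^ j) v) (z : C) := ⟨h1, h2, h3 j⟩
  obtain ⟨N, hN⟩ := P.exists_nat
  have : z = N := by exact_mod_cast hN
  omega
theorem h_inj {h : G} {c : C} (hc : c ≠ 0) {v : V} (hv : v ≠ 0)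
    {k : ℕ} (hk : ((toEnd C G V h - c • 1) ^ k) v = 0) : ⁅h, v⁆ ≠ 0 := by
  intro hhv
  have : ∀ i : ℕ, ((toEnd C G V h - c • 1) ^ i) v = (-c) ^ i • v := by
    intro i
    induction i with
    | zero => simp
    | succ i ih => rw [pow_succ', Module.End.mul_apply, ih]; simp [hhv, pow_succ', smul_smul, mul_comm]
  rw [this] at hk
  exact smul_ne_zero (pow_ne_zero _ (neg_ne_zero.2 hc)) hv hk
end PartM6a

section PartM7
open LieAlgebra LieAlgebra.IsKilling LieModule Module
variable {C G : Type u} [Field C] [CharZero C] [IsAlgClosed C] [LieRing G] [LieAlgebra C G] [Module.Finite C G] [IsKilling C G]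
  (H : LieSubalgebra C G) [H.IsCartanSubalgebra]
  {V : Type u} [AddCommGroup V] [Module C V] [Module.Finite C V] [LieRingModule G V] [LieModule C G V]
theorem gr_of_weight (μ : Dual C H) (hμ : μ ≠ 0) (w : H.root → ℤ) (hw : ∀ i, μ (coroot i.1) = (w i : C)) :
    ∃ (t : H) (T : H.root → ℤ), IsGr (rootSystem H) t T ∧ (∃ i, 0 < T i) ∧ ∀ i, 0 < T i ↔ w i < 0 := by
  classical
  let P := rootSystem H
  let T : H.root → ℤ := fun i => - ∑ j, P.pairingIn ℤ i j * w j
  have key : ∀ i, (∑ j, P.pairingIn ℤ i j * P.pairingIn ℤ i j) * w i = - 2 * T i := by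
    intro i
    have h1 := congrArg μ (P.rootForm_self_smul_coroot i)
    rw [P.rootForm_root_self, map_smul, map_nsmul, P.Polarization_apply, map_sum] at h1
    have hp : ∀ i j, P.pairing i j = (P.pairingIn ℤ i j : C) := fun i j => (P.algebraMap_pairingIn ℤ i j).symm
    have hc : ∀ j, μ (P.coroot j) = (w j : C) := hw
    simp only [map_smul, hc, P.root_coroot'_eq_pairing, hp, smul_eq_mul, nsmul_eq_mul] at h1
    have : (((∑ j, P.pairingIn ℤ i j * P.pairingIn ℤ i j) * w i : ℤ) : C) = ((- 2 * T i : ℤ) : C) := by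
      push_cast [T]
      rw [h1]; simp
    exact_mod_cast this
  have hpos : ∀ i, 0 < ∑ j, P.pairingIn ℤ i j * P.pairingIn ℤ i j := by
    intro i
    refine Finset.sum_pos' (fun j _ => mul_self_nonneg _) ⟨i, Finset.mem_univ _, ?_⟩
    rw [P.pairingIn_same]; norm_num
  have hiff : ∀ i, 0 < T i ↔ w i < 0 := by
    intro i
    have h1 := key i
    have h2 := hpos i
    constructor
    · intro h; by_contra h3; push Not at h3; nlinarith
    · intro h; nlinarith
  refine ⟨- ∑ j, (w j : C) • P.coroot j, T, ?_, ?_, hiff⟩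
  · intro i
    rw [map_neg, map_sum]
    push_cast [T]
    congr 1
    refine Finset.sum_congr rfl fun j _ => ?_
    rw [map_smul, P.root_coroot_eq_pairing, ← P.algebraMap_pairingIn ℤ, smul_eq_mul, mul_comm]; rfl
  · by_contra! hcon
    have h0 : ∀ i, 0 ≤ w i := fun i => by
      have := hcon i
      by_contra h; push Not at h; exact absurd ((hiff i).2 h) (by omega)
    have h00 : ∀ i, w i = 0 := by
      intro i
      have h1 := h0 i
      have h2 := h0 (P.reflectionPerm i i)
      have h3 : (w (P.reflectionPerm i i) : C) = -(w i : C) := by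
        have hc : ∀ j, μ (P.coroot j) = (w j : C) := hw
        rw [← hc, ← hc, P.coroot_reflectionPerm]
        simp [P.coreflection_apply_self]
      have : w (P.reflectionPerm i i) = - w i := by exact_mod_cast h3
      omega
    apply hμ
    have hsp : P.corootSpan C = ⊤ := RootPairing.IsRootSystem.span_coroot_eq_top
    refine LinearMap.ext_on (show Submodule.span C (Set.range P.coroot) = ⊤ from hsp) ?_
    rintro _ ⟨i, rfl⟩
    have : μ (P.coroot i) = (w i : C) := hw i
    rw [this, h00 i]; simp
noncomputable def wsp (V : Type u) [AddCommGroup V] [Module C V] [LieRingModule G V] [LieModule C G V] (l : Dual C H) : Submodule C V :=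
  (genWeightSpace V (⇑l : H → C)).toSubmodule
theorem wsp_indep : iSupIndep (wsp H V) := by
  have h1 := (LieSubmodule.iSupIndep_toSubmodule.2 (iSupIndep_genWeightSpace C H V))
  exact h1.comp (f := fun l : Dual C H => (⇑l : H → C)) DFunLike.coe_injective
theorem wsp_top : ⨆ l, wsp H V l = ⊤ := by
  have h1 := iSup_genWeightSpace_eq_top' C H V
  rw [← LieSubmodule.toSubmodule_inj, LieSubmodule.iSup_toSubmodule, LieSubmodule.top_toSubmodule] at h1
  rw [eq_top_iff, ← h1]
  refine iSup_le fun w => ?_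
  exact le_iSup (wsp H V) w.toLinear
theorem wsp_lie {l m : Dual C H} {x : G} (hx : x ∈ rootSpace H ⇑l) {v : V} (hv : v ∈ wsp H V m) : ⁅x, v⁆ ∈ wsp H V (m + l) := by
  rw [add_comm]
  exact lie_mem_genWeightSpace_of_mem_genWeightSpace hx hv
theorem wsp_pow {l : Dual C H} {v : V} (hv : v ∈ wsp H V l) (h : H) : ∃ k : ℕ, ((toEnd C G V (h : G) - l h • 1) ^ k) v = 0 :=
  (mem_genWeightSpace V _ _).1 hv h
set_option maxHeartbeats 1000000 in
theorem gr_of_vec {cp : Dual C H → V →ₗ[C] V} (c0 : ∀ x v, cp x v ∈ wsp H V x) (c1 : ∀ x, ∀ v ∈ wsp H V x, cp x v = v)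
    (c2 : ∀ x x', x ≠ x' → ∀ v ∈ wsp H V x, cp x' v = 0) (c3 : ∀ v, {x | cp x v ≠ 0}.Finite)
    {y : V} (hy : ∃ l ≠ 0, cp l y ≠ 0) :
    ∃ (t : H) (T : H.root → ℤ), IsGr (rootSystem H) t T ∧ (∃ i, 0 < T i) ∧
      {i | 0 < T i}.ncard + 1 ≤ finrank C (LinearMap.range (orb C y : G →ₗ[C] V)) := by
  classical
  have sl2 : ∀ i : H.root, ∃ p : G × G, IsSl2Triple (coroot i.1 : G) p.1 p.2 ∧ p.1 ∈ rootSpace H i.1 := by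
    intro i
    obtain ⟨h, e, f, h1, h2, h3⟩ := exists_isSl2Triple_of_weight_isNonZero (H.isNonZero_coe_root i)
    have := h1.h_eq_coroot (H.isNonZero_coe_root i) h2 h3
    subst this
    exact ⟨(e, f), h1, h2⟩
  choose p hp1 hp2 using sl2
  let a : Option H.root → Dual C H := fun o => o.elim 0 fun i => i.1.toLinear
  have ha : Function.Injective a := by
    rintro (_ | i) (_ | j) hij
    · rfl
    · exact absurd hij.symm (by simpa [a] using H.isNonZero_coe_root j)
    · exact absurd hij (by simpa [a] using H.isNonZero_coe_root i)
    · congr 1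
      exact (rootSystem H).root.injective hij
  obtain ⟨f, hf⟩ := Module.exists_dual_forall_apply_ne_zero (K := ℚ) (M := Dual C H)
    (ι := {q : Option H.root × Option H.root // q.1 ≠ q.2} ⊕ {x : (c3 y).toFinset // x.1 ≠ 0})
    (fun s => s.elim (fun q => a q.1.1 - a q.1.2) (fun x => x.1.1)) (by
      rintro (⟨q, hq⟩ | ⟨x, hx⟩)
      · exact sub_ne_zero.2 (ha.ne hq)
      · exact hx)
  have hf1 : Function.Injective fun o => f (a o) := by
    intro o o' h
    by_contra h'
    exact hf (Sum.inl ⟨(o, o'), h'⟩) (by simpa [sub_eq_zero] using h)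
  have hf2 : ∀ x, cp x y ≠ 0 → x ≠ 0 → f x ≠ 0 := fun x h1 h2 => hf (Sum.inr ⟨⟨x, by simpa using h1⟩, h2⟩)
  obtain ⟨f, hf1, μ, hμ0, hμ1, hμ2⟩ : ∃ f : Dual C H →ₗ[ℚ] ℚ, (Function.Injective fun o => f (a o)) ∧
      ∃ μ : Dual C H, μ ≠ 0 ∧ cp μ y ≠ 0 ∧ ∀ x, cp x y ≠ 0 → f x ≤ f μ := by
    obtain ⟨l, hl0, hl⟩ := hy
    obtain ⟨m, hm, hmax⟩ := (c3 y).toFinset.exists_max_image f ⟨l, by simpa using hl⟩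
    obtain ⟨m', hm', hmin⟩ := (c3 y).toFinset.exists_min_image f ⟨l, by simpa using hl⟩
    simp only [Set.Finite.mem_toFinset, Set.mem_ofPred_eq] at hm hm' hmax hmin
    by_cases h : m = 0
    · refine ⟨-f, fun o o' h => hf1 (by simpa using h), m', ?_, hm', fun x hx => by simpa using hmin x hx⟩
      rintro rfl
      have h1 := hmax l hl
      have h2 := hmin l hl
      have := hf2 l hl hl0
      rw [h, map_zero] at h1
      rw [map_zero] at h2
      exact this (le_antisymm h1 h2)
    · exact ⟨f, hf1, m, h, hm, hmax⟩
  have hmem := c0 μ y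
  have hint : ∀ i : H.root, ∃ z : ℤ, μ (coroot i.1) = z := by
    intro i
    obtain ⟨k, hk⟩ := wsp_pow H hmem (coroot i.1)
    refine sl2_int (hp1 i) (isNilpotent_toEnd_of_mem_rootSpace V H ?_ (hp2 i)) hμ1 hk
    exact H.isNonZero_coe_root i
  choose w hw using hint
  obtain ⟨t, T, hT, hT0, hiff⟩ := gr_of_weight H μ hμ0 w hw
  refine ⟨t, T, hT, hT0, ?_⟩
  obtain ⟨i0, hi0⟩ := hT0
  let A0 : Option {i // 0 < T i} → G := fun o => o.elim (coroot i0.1 : G) fun i => (p i.1).1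
  let s : Option {i // 0 < T i} → Option H.root := Option.map Subtype.val
  have hs : Function.Injective s := Option.map_injective Subtype.val_injective
  have hli : LinearIndependent C fun o => toEnd C G V (A0 o) y := by
    refine lead (X := Dual C H) (wsp_top H) c1 c2 (a := fun o => a (s o)) ?_ f (hf1.comp hs) hμ2 ?_
    · rintro (_ | i) x v hv
      · refine wsp_lie H (l := 0) ?_ hv
        have : ((coroot i0.1 : H) : G) ∈ rootSpace H (0 : H → C) := by
          rw [rootSpace_zero_eq]; exact (coroot i0.1).2
        exact this
      · exact wsp_lie H (l := i.1.1.toLinear) (hp2 i.1) hv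
    · rintro (_ | i)
      · obtain ⟨k, hk⟩ := wsp_pow H hmem (coroot i0.1)
        refine h_inj ?_ hμ1 hk
        rw [hw]
        have := (hiff i0).1 hi0
        exact_mod_cast this.ne
      · obtain ⟨k, hk⟩ := wsp_pow H hmem (coroot i.1.1)
        rw [hw] at hk
        exact sl2_inj (hp1 i.1) ((hiff i.1).1 i.2) hμ1 hk
  have h5 := finrank_span_eq_card hli
  have h6 : Submodule.span C (Set.range fun o => toEnd C G V (A0 o) y) ≤ LinearMap.range (orb C y : G →ₗ[C] V) := by
    rw [Submodule.span_le]
    rintro _ ⟨o, rfl⟩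
    exact ⟨A0 o, rfl⟩
  have h7 := Submodule.finrank_mono h6
  rw [h5, Fintype.card_option] at h7
  rw [← Nat.card_coe_set_eq, Nat.card_eq_fintype_card]
  exact h7
end PartM7

section PartM8
open LieAlgebra LieAlgebra.IsKilling LieModule Module TensorProduct
variable {C G : Type u} [Field C] [CharZero C] [IsAlgClosed C] [LieRing G] [LieAlgebra C G] [Module.Finite C G] [IsKilling C G]
theorem exp_lie {V : Type u} [AddCommGroup V] [Module C V] [LieRingModule G V] [LieModule C G V] [Module ℚ V] [Module ℚ G]
    (e : G) (h1 : IsNilpotent (ad C G e)) (h2 : IsNilpotent (toEnd C G V e)) (x : G) (y : V) :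
    IsNilpotent.exp (toEnd C G V e) ⁅x, y⁆ = ⁅IsNilpotent.exp (ad C G e) x, IsNilpotent.exp (toEnd C G V e) y⁆ := by
  let DL : Module.End C (G ⊗[C] V) := (toEnd C G V e).lTensor G
  let DR : Module.End C (G ⊗[C] V) := (ad C G e).rTensor V
  have h_nilL : IsNilpotent DL := h2.map <| Module.End.lTensorAlgHom C V G
  have h_nilR : IsNilpotent DR := h1.map <| Module.End.rTensorAlgHom C G V
  have h_comm : Commute DL DR := by ext; simp [DL, DR]
  set m : G ⊗[C] V →ₗ[C] V := TensorProduct.lift (toEnd C G V : G →ₗ[C] End C V) with hm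
  have h₁ : IsNilpotent.exp (toEnd C G V e) ⁅x, y⁆ = m (IsNilpotent.exp (DL + DR) (x ⊗ₜ[C] y)) := by
    suffices IsNilpotent.exp (toEnd C G V e) ∘ₗ m = m ∘ₗ IsNilpotent.exp (DL + DR) by simpa [hm] using! LinearMap.congr_fun this (x ⊗ₜ[C] y)
    apply Module.End.commute_exp_left_of_commute (h_comm.isNilpotent_add h_nilL h_nilR) h2
    ext a b
    simp [DL, DR, hm, add_comm]
  have h₂ : IsNilpotent.exp DL = (IsNilpotent.exp (toEnd C G V e)).lTensor G := (h2.map_exp (Module.End.lTensorAlgHom C V G)).symm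
  have h₃ : IsNilpotent.exp DR = (IsNilpotent.exp (ad C G e)).rTensor V := (h1.map_exp (Module.End.rTensorAlgHom C G V)).symm
  simp [h₁, IsNilpotent.exp_add_of_commute h_comm h_nilL h_nilR, h₂, h₃, hm]
theorem perf (U : Submodule C G) (hU : ∀ x y : G, ⁅x, y⁆ ∈ U) : U = ⊤ := by
  by_contra h
  obtain ⟨f, hf0, hf⟩ := Submodule.exists_le_ker_of_lt_top U (lt_top_iff_ne_top.2 h)
  let B := killingForm C G
  have hB : B.Nondegenerate := killingForm_nondegenerate C G
  obtain ⟨x, rfl⟩ := (LinearMap.BilinForm.toDual B hB).surjective f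
  apply hf0
  have hx : ∀ y : G, ⁅x, y⁆ = 0 := by
    intro y
    apply (LinearMap.BilinForm.toDual B hB).injective
    ext z
    have h1 : B x ⁅y, z⁆ = 0 := hf (hU y z)
    rw [map_zero, LinearMap.zero_apply, ← h1]
    exact traceForm_apply_lie_apply C G G x y z
  have : x ∈ LieAlgebra.center C G := by
    rw [LieModule.mem_maxTrivSubmodule]
    intro y
    rw [← lie_skew, hx, neg_zero]
  rw [LieAlgebra.center_eq_bot, LieSubmodule.mem_bot] at this
  rw [this, map_zero]
theorem exists_irr (m : ℕ) : ∀ (Q : Type u) [AddCommGroup Q] [Module C Q] [Module.Finite C Q] [LieRingModule G Q] [LieModule C G Q],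
    finrank C Q ≤ m → (∃ (x : G) (q : Q), ⁅x, q⁆ ≠ 0) →
    ∃ (Q : Type u) (_ : AddCommGroup Q) (_ : Module C Q) (_ : Module.Finite C Q) (_ : LieRingModule G Q) (_ : LieModule C G Q),
      (∀ N : LieSubmodule C G Q, N ≠ ⊥ → N = ⊤) ∧ (∀ x, LinearMap.trace C Q (toEnd C G Q x) = 0) ∧
      finrank C Q ≤ m ∧ ∃ (x : G) (q : Q), ⁅x, q⁆ ≠ 0 := by
  induction m with
  | zero =>
    intro Q _ _ _ _ _ h ⟨x, q, hq⟩
    have : Subsingleton Q := finrank_zero_iff.1 (Nat.le_zero.1 h)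
    exact absurd (Subsingleton.elim _ _) hq
  | succ m ih =>
    intro Q _ _ _ _ _ hm hnt
    by_cases hirr : ∀ N : LieSubmodule C G Q, N ≠ ⊥ → N = ⊤
    · refine ⟨Q, _, _, inferInstance, _, inferInstance, hirr, ?_, hm, hnt⟩
      have := perf (LinearMap.ker (LinearMap.trace C Q ∘ₗ (toEnd C G Q : G →ₗ[C] End C Q))) (by
        intro x y
        change LinearMap.trace C Q (toEnd C G Q ⁅x, y⁆) = 0
        rw [_root_.toEnd_lie, map_sub, LinearMap.trace_mul_comm, sub_self])
      intro x
      have hx : x ∈ (⊤ : Submodule C G) := trivial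
      rw [← this] at hx
      exact hx
    · push Not at hirr
      obtain ⟨N, hN1, hN2⟩ := hirr
      have hlt1 : finrank C N < finrank C Q := Submodule.finrank_lt (s := N.toSubmodule) (by simpa [lt_top_iff_ne_top] using hN2)
      have hlt2 : finrank C (Q ⧸ N) < finrank C Q := by
        have h1 := Submodule.finrank_quotient_add_finrank N.toSubmodule
        have : 0 < finrank C N.toSubmodule := by
          rw [Nat.pos_iff_ne_zero, Ne, Submodule.finrank_eq_zero]
          simpa using hN1
        change finrank C (Q ⧸ N.toSubmodule) < _
        omega
      by_cases h1 : ∃ (x : G) (q : N), ⁅x, q⁆ ≠ 0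
      · obtain ⟨Q', i1, i2, i3, i4, i5, h3, h4, h5, h6⟩ := ih N (by omega) h1
        exact ⟨Q', i1, i2, i3, i4, i5, h3, h4, by omega, h6⟩
      have : Module.Finite C (Q ⧸ N) := inferInstanceAs (Module.Finite C (Q ⧸ N.toSubmodule))
      by_cases h2 : ∃ (x : G) (q : Q ⧸ N), ⁅x, q⁆ ≠ 0
      · obtain ⟨Q', i1, i2, i3, i4, i5, h3, h4, h5, h6⟩ := ih (Q ⧸ N) (by omega) h2
        exact ⟨Q', i1, i2, i3, i4, i5, h3, h4, by omega, h6⟩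
      exfalso
      push Not at h1 h2
      have hN : ∀ (x : G) (q : Q), ⁅x, q⁆ ∈ N := by
        intro x q
        exact (Submodule.Quotient.mk_eq_zero N.toSubmodule).1 (h2 x (LieSubmodule.Quotient.mk q))
      have hN0 : ∀ (x : G), ∀ q ∈ N, ⁅x, q⁆ = 0 := fun x q hq => congrArg Subtype.val (h1 x ⟨q, hq⟩)
      obtain ⟨x, q, hxq⟩ := hnt
      apply hxq
      have := perf (LinearMap.ker (orb C q : G →ₗ[C] Q)) (by
        intro x y
        rw [LinearMap.mem_ker, orb_apply, lie_lie, hN0 _ _ (hN _ _), hN0 _ _ (hN _ _), sub_zero])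
      have hx : x ∈ (⊤ : Submodule C G) := trivial
      rw [← this] at hx
      exact hx
variable   {V : Type u} [AddCommGroup V] [Module C V] [Module.Finite C V] [LieRingModule G V] [LieModule C G V]
theorem exists_root_ne (H : LieSubalgebra C G) [H.IsCartanSubalgebra] {y : V} (hy : ∃ x : G, ⁅x, y⁆ ≠ 0) :
    ∃ i : H.root, ∃ e ∈ rootSpace H i.1, ⁅e, y⁆ ≠ 0 := by
  by_contra! hcon
  obtain ⟨x, hx⟩ := hy
  apply hx
  have hH : ∀ h : H, ⁅(h : G), y⁆ = 0 := by
    have h1 : (LinearMap.ker ((orb C y : G →ₗ[C] V) ∘ₗ H.toSubmodule.subtype)) = ⊤ := by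
      rw [eq_top_iff]
      have hsp : (rootSystem H).corootSpan C = ⊤ := RootPairing.IsRootSystem.span_coroot_eq_top
      rw [← hsp, RootPairing.corootSpan, Submodule.span_le]
      rintro _ ⟨i, rfl⟩
      obtain ⟨h, e, f, h1, h2, h3⟩ := exists_isSl2Triple_of_weight_isNonZero (H.isNonZero_coe_root i)
      have := h1.h_eq_coroot (H.isNonZero_coe_root i) h2 h3
      subst this
      have h4 : -i.1 ∈ H.root := by
        have := (H.isNonZero_coe_root i).neg
        simpa [LieSubalgebra.root] using this
      have h5 := hcon i e h2
      have h6 := hcon ⟨-i.1, h4⟩ f (by rw [Weight.coe_neg]; exact h3)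
      change ⁅((coroot i.1 : H) : G), y⁆ = 0
      rw [← h1.lie_e_f, lie_lie, h5, h6, lie_zero, lie_zero, sub_zero]
    intro h
    have h2 : h ∈ (⊤ : Submodule C H) := trivial
    rw [← h1] at h2
    exact h2
  have h1 : LinearMap.ker (orb C y : G →ₗ[C] V) = ⊤ := by
    have h1 := iSup_genWeightSpace_eq_top' C H G
    rw [← LieSubmodule.toSubmodule_inj, LieSubmodule.iSup_toSubmodule, LieSubmodule.top_toSubmodule] at h1
    rw [eq_top_iff, ← h1]
    refine iSup_le fun w => ?_
    intro z hz
    by_cases hw : w.IsZero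
    · have : z ∈ rootSpace H (0 : H → C) := by rw [← hw.eq]; exact hz
      rw [rootSpace_zero_eq] at this
      exact hH ⟨z, this⟩
    · exact hcon ⟨w, by simpa [LieSubalgebra.root] using hw⟩ z hz
  have h2 : x ∈ (⊤ : Submodule C G) := trivial
  rw [← h1] at h2
  exact h2
theorem exists_gr (H : LieSubalgebra C G) [H.IsCartanSubalgebra] {y : V} (hy : ∃ x : G, ⁅x, y⁆ ≠ 0) :
    ∃ (t : H) (T : H.root → ℤ), IsGr (rootSystem H) t T ∧ (∃ i, 0 < T i) ∧
      {i | 0 < T i}.ncard + 1 ≤ finrank C (LinearMap.range (orb C y : G →ₗ[C] V)) := by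
  obtain ⟨cp, c0, c1, c2, c3, c4⟩ := exists_cp (wsp H V) (wsp_indep H) (wsp_top H)
  by_cases h : ∃ l ≠ 0, cp l y ≠ 0
  · exact gr_of_vec H c0 c1 c2 c3 h
  push Not at h
  have hy0 : y ∈ wsp H V 0 := by
    have : y = cp 0 y := c4 _ _ fun x => by
      by_cases hx : x = 0
      · subst hx; exact (c1 _ _ (c0 _ _)).symm
      · rw [h x hx, c2 0 x (Ne.symm hx) _ (c0 _ _)]
    rw [this]; exact c0 _ _
  obtain ⟨i, e, he, hey⟩ := exists_root_ne H hy
  have n1 : IsNilpotent (ad C G e) := isNilpotent_ad_of_mem_rootSpace H (H.isNonZero_coe_root i) he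
  have n2 : IsNilpotent (toEnd C G V e) := isNilpotent_toEnd_of_mem_rootSpace V H (H.isNonZero_coe_root i) he
  let _ : Module ℚ V := Module.compHom V (algebraMap ℚ C)
  let _ : Module ℚ G := Module.compHom G (algebraMap ℚ C)
  set g := IsNilpotent.exp (toEnd C G V e)
  obtain ⟨t, T, h1, h2, h3⟩ := gr_of_vec H c0 c1 c2 c3 (y := g y) (by
    refine ⟨i.1.toLinear, by simpa using H.isNonZero_coe_root i, ?_⟩
    obtain ⟨k, hk⟩ := n2
    have hk2 : (toEnd C G V e) ^ (k + 2) = 0 := by rw [pow_add, hk, zero_mul]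
    have hmem : ∀ n : ℕ, ((toEnd C G V e) ^ n) y ∈ wsp H V (n • i.1.toLinear) := by
      intro n
      induction n with
      | zero => simpa using hy0
      | succ n ih =>
        rw [pow_succ', succ_nsmul]
        exact wsp_lie H (l := i.1.toLinear) he ih
    have hne : i.1.toLinear ≠ 0 := by simpa using H.isNonZero_coe_root i
    simp only [g, IsNilpotent.exp_eq_sum hk2]
    rw [LinearMap.sum_apply, map_sum, Finset.sum_eq_single 1]
    · have h5 : cp i.1.toLinear (⁅e, y⁆) = ⁅e, y⁆ := c1 _ _ (by simpa using hmem 1)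
      simp [h5, hey]
    · intro n _ hn
      rw [LinearMap.smul_apply, map_rat_smul, c2 _ _ _ _ (hmem n), smul_zero]
      intro h
      apply hn
      have h6 : (((n : ℤ) - 1)) • i.1.toLinear = 0 := by rw [sub_smul, one_smul, natCast_zsmul, h, sub_self]
      rcases smul_eq_zero.1 h6 with h7 | h7
      · omega
      · exact absurd h7 hne
    · simp)
  refine ⟨t, T, h1, h2, h3.trans ?_⟩
  have : LinearMap.range (orb C (g y) : G →ₗ[C] V) ≤ (LinearMap.range (orb C y : G →ₗ[C] V)).map g := by
    rintro _ ⟨x, rfl⟩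
    refine ⟨⁅IsNilpotent.exp (-(ad C G e)) x, y⁆, ⟨_, rfl⟩, ?_⟩
    rw [exp_lie e n1 n2, ← Module.End.mul_apply, IsNilpotent.exp_mul_exp_neg_self n1]
    rfl
  exact (Submodule.finrank_mono this).trans (Submodule.finrank_map_le _ _)
theorem exists_small_irr {y : V} (hy : ∃ x : G, ⁅x, y⁆ ≠ 0) {d : ℕ} (hd4 : d ≤ 4)
    (hd : finrank C (LinearMap.range (orb C y : G →ₗ[C] V)) ≤ d) :
    ∃ (Q : Type u) (_ : AddCommGroup Q) (_ : Module C Q) (_ : Module.Finite C Q) (_ : LieRingModule G Q) (_ : LieModule C G Q),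
      (∀ N : LieSubmodule C G Q, N ≠ ⊥ → N = ⊤) ∧ (∀ x, LinearMap.trace C Q (toEnd C G Q x) = 0) ∧
      finrank C Q ≤ d ∧ ∃ (x : G) (q : Q), ⁅x, q⁆ ≠ 0 := by
  obtain ⟨x, hx⟩ := LieAlgebra.exists_isCartanSubalgebra_engel C G
  obtain ⟨t, T, h1, h2, h3⟩ := exists_gr (LieSubalgebra.engel C x) hy
  obtain ⟨U, hU, i1, i2, h4⟩ := exists_rep_of_gr _ h1 h2 (by omega)
  refine exists_irr d (C × U) ?_ h4
  rw [finrank_prod, finrank_self]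
  omega
end PartM8

theorem Sit.contra {C Ω : Type u} [Field C] [Field Ω] [Algebra C Ω] {D : Derivation C Ω Ω}
    {L : LieSubalgebra C (Derivation C Ω Ω)} {K : Subfield Ω} {d : ℕ} [CharZero C] [IsAlgClosed C]
    [CharZero Ω] [IsAlgClosed Ω] [IsAlgClosed K] (S : Sit D L K d) (hd4 : d ≤ 4)
    (y : Ω) (N : LieSubmodule C L Ω) (hN : Module.Finite C N) (hyN : y ∈ N)
    (hgy : Module.finrank C (LinearMap.range (orb C y : L →ₗ[C] Ω)) ≤ d) : y ∈ K := by
  by_contra hy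
  obtain ⟨V, hV, hR, z, hz, hzd⟩ := S.reduce y hy N hN hyN hgy
  have := LieAlgebra.HasTrivialRadical.instIsKilling (R := C) (L := gIm C L V)
  obtain ⟨Q, i1, i2, i3, i4, i5, h3, h4, h5, h6⟩ := exists_small_irr (C := C) hz hd4 hzd
  exact S.crit2 V h3 h4 h5 h6

section PartN1
open TensorProduct in
theorem der_ext {R S T : Type*} [CommRing R] [CommRing S] [CommRing T] [Algebra R S] [Algebra R T]
    [Algebra S T] [IsScalarTower R S T] [Algebra.FormallyEtale S T] (f : Derivation R S T) :
    ∃ δ : Derivation R T T, ∀ s, δ (algebraMap S T s) = f s := by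
  let g : T ⊗[S] Ω[S⁄R] →ₗ[T] T := f.liftKaehlerDifferential.liftBaseChange T
  let e := KaehlerDifferential.tensorKaehlerEquivOfFormallyEtale R S T
  refine ⟨(g ∘ₗ e.symm.toLinearMap).compDer (KaehlerDifferential.D R T), fun s => ?_⟩
  have := KaehlerDifferential.tensorKaehlerEquivOfFormallyEtale_symm_D_algebraMap R S T s
  simp [e, g, this]
open scoped IntermediateField.algebraAdjoinAdjoin in
theorem exists_der {K Ω : Type*} [Field K] [Field Ω] [CharZero K] [Algebra K Ω] (x : Ω)
    (hx : Transcendental K x) : ∃ δ : Derivation K Ω Ω, δ x ≠ 0 := by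
  have h1 : AlgebraicIndepOn K id ({x} : Set Ω) := by
    exact algebraicIndependent_unique_type_iff.2 hx
  obtain ⟨s, hxs, hs⟩ := exists_isTranscendenceBasis_superset h1
  have hv : AlgebraicIndependent K ((↑) : s → Ω) := hs.1
  let v : s → Ω := (↑)
  let x0 : s := ⟨x, hxs rfl⟩
  let A := Algebra.adjoin K (Set.range v)
  let F := IntermediateField.adjoin K (Set.range v)
  have i1 : Algebra.FormallyEtale A F := .of_isLocalization (nonZeroDivisors _)
  have i3 : Algebra.IsAlgebraic F Ω := hs.isAlgebraic_field
  have i2 : Algebra.FormallyEtale F Ω := Algebra.FormallyEtale.of_isSeparable _ Ω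
  have i4 : Algebra.FormallyEtale A Ω := .comp A F Ω
  let e := hv.aevalEquiv
  have he : ∀ a : A, MvPolynomial.aeval v (e.symm a) = (a : Ω) := by
    intro a
    have := hv.algebraMap_aevalEquiv (e.symm a)
    rw [← this]; simp [e]
  let l : A →ₗ[K] Ω := (MvPolynomial.aeval v).toLinearMap ∘ₗ
    ((MvPolynomial.pderiv (R := K) x0 : Derivation K (MvPolynomial s K) _) : _ →ₗ[K] _) ∘ₗ
      e.symm.toLinearMap
  have hl : ∀ a b : A, l (a * b) = a • l b + b • l a := by
    intro a b
    simp only [l, LinearMap.comp_apply, AlgEquiv.toLinearMap_apply, map_mul, Derivation.coeFn_coe,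
      Derivation.leibniz, AlgHom.toLinearMap_apply, map_add, smul_eq_mul, he]
    rfl
  obtain ⟨δ, hδ⟩ := der_ext (T := Ω) (Derivation.mk' l hl)
  refine ⟨δ, ?_⟩
  have hxA : x ∈ A := Algebra.subset_adjoin ⟨x0, rfl⟩
  have h2 := hδ ⟨x, hxA⟩
  have h3 : e.symm ⟨x, hxA⟩ = MvPolynomial.X x0 := by
    rw [AlgEquiv.symm_apply_eq]
    apply Subtype.ext
    have := hv.algebraMap_aevalEquiv (MvPolynomial.X x0)
    rw [MvPolynomial.aeval_X] at this
    exact this.symm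
  change δ x = l ⟨x, hxA⟩ at h2
  rw [h2]
  simp [l, h3]
variable {C Ω : Type u} [Field C] [Field Ω] [Algebra C Ω]
def derKer (δ : Derivation C Ω Ω) : Subfield Ω where
  carrier := {x | δ x = 0}
  zero_mem' := map_zero δ
  one_mem' := δ.map_one_eq_zero
  add_mem' := by intro a b ha hb; simp_all
  neg_mem' := by intro a ha; simp_all
  mul_mem' := by intro a b ha hb; simp_all
  inv_mem' := by intro a ha; simp_all [Derivation.leibniz_inv]
theorem mem_derKer (δ : Derivation C Ω Ω) (x : Ω) : x ∈ derKer δ ↔ δ x = 0 := Iff.rfl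
theorem der_alg [CharZero Ω] (δ : Derivation C Ω Ω) (F : Subfield Ω) (hF : F ≤ derKer δ) (x : Ω)
    (hx : IsAlgebraic F x) : δ x = 0 := by
  let δ' : Derivation F Ω Ω := Derivation.mk'
    { toFun := δ, map_add' := map_add δ,
      map_smul' := by
        intro c z
        have : δ (c : Ω) = 0 := hF c.2
        simp [Subfield.smul_def, this] } (by intro a b; simp)
  have h := δ'.map_aeval (minpoly F x) (x := x)
  rw [minpoly.aeval, map_zero] at h
  have h2 : Polynomial.aeval x (Polynomial.derivative (minpoly F x)) ≠ 0 :=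
    (minpoly.irreducible hx.isIntegral).separable.aeval_derivative_ne_zero (minpoly.aeval F x)
  exact (smul_eq_zero.1 h.symm).resolve_left h2
theorem const_alg [CharZero Ω] [IsAlgClosed C] (D : Derivation C Ω Ω) (F : Subfield Ω)
    (hF : ∀ x ∈ F, D x ∈ F) (hc : ∀ x ∈ F, D x = 0 → ∃ c, algebraMap C Ω c = x) (x : Ω)
    (hx : IsAlgebraic F x) (hx0 : D x = 0) : ∃ c, algebraMap C Ω c = x := by
  let p := minpoly F x
  have hp : p.Monic := minpoly.monic hx.isIntegral
  let q : Polynomial F := ∑ i ∈ Finset.range p.natDegree,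
    Polynomial.monomial i ⟨D (p.coeff i), hF _ (p.coeff i).2⟩
  have hDp : ∀ z : Ω, D z = 0 → ∀ i : ℕ, D (z ^ i) = 0 := by
    intro z hz i; simp [hz]
  have hq : Polynomial.aeval x q = 0 := by
    have h0 : D (Polynomial.aeval x p) = 0 := by rw [minpoly.aeval, map_zero]
    rw [Polynomial.aeval_eq_sum_range, map_sum, Finset.sum_range_succ] at h0
    rw [show p.coeff p.natDegree = 1 from hp, one_smul, hDp x hx0, add_zero] at h0
    rw [map_sum, ← h0]
    refine Finset.sum_congr rfl fun i _ => ?_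
    rw [Polynomial.aeval_monomial, Subfield.smul_def, smul_eq_mul, Derivation.leibniz,
      hDp x hx0]
    rw [smul_zero, zero_add, smul_eq_mul, mul_comm]; rfl
  have hq0 : q = 0 := by
    by_contra hne
    have h1 := Polynomial.natDegree_le_natDegree (minpoly.degree_le_of_ne_zero F x hne hq)
    have h3 : 0 < p.natDegree := minpoly.natDegree_pos hx.isIntegral
    have h2 : q.natDegree ≤ p.natDegree - 1 := by
      refine Polynomial.natDegree_sum_le_of_forall_le _ _ fun i hi => ?_
      have := Finset.mem_range.1 hi
      exact (Polynomial.natDegree_monomial_le _).trans (by omega)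
    change p.natDegree ≤ _ at h1
    omega
  have hcoef : ∀ i : ℕ, ∃ c, algebraMap C Ω c = (p.coeff i : Ω) := by
    intro i
    rcases lt_trichotomy i p.natDegree with h | h | h
    · refine hc _ (p.coeff i).2 ?_
      have h1 : q.coeff i = ⟨D (p.coeff i), hF _ (p.coeff i).2⟩ := by
        simp only [q, Polynomial.finsetSum_coeff, Polynomial.coeff_monomial]
        rw [Finset.sum_ite_eq' ]
        simp [h]
      rw [hq0] at h1
      exact (congrArg Subtype.val h1).symm
    · refine ⟨1, ?_⟩; rw [h, show p.coeff p.natDegree = 1 from hp]; simp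
    · refine ⟨0, ?_⟩; rw [Polynomial.coeff_eq_zero_of_natDegree_lt h]; simp
  choose c hc' using hcoef
  let r : Polynomial C := ∑ i ∈ Finset.range (p.natDegree + 1), Polynomial.monomial i (c i)
  have hr : Polynomial.aeval x r = 0 := by
    rw [map_sum, ← minpoly.aeval F x]
    change _ = Polynomial.aeval x p
    rw [Polynomial.aeval_eq_sum_range]
    refine Finset.sum_congr rfl fun i _ => ?_
    rw [Polynomial.aeval_monomial, Subfield.smul_def, smul_eq_mul, hc']
  have hr0 : r ≠ 0 := by
    intro h
    have h1 : r.coeff p.natDegree = c p.natDegree := by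
      simp only [r, Polynomial.finsetSum_coeff, Polynomial.coeff_monomial]
      rw [Finset.sum_ite_eq' ]
      simp
    rw [h] at h1
    have h2 := hc' p.natDegree
    rw [← h1, show p.coeff p.natDegree = 1 from hp] at h2
    simp at h2
  have hint : IsIntegral C x := (show IsAlgebraic C x from ⟨r, hr0, hr⟩).isIntegral
  exact minpoly.mem_range_of_degree_eq_one C x
    (IsAlgClosed.degree_eq_one_of_irreducible C (minpoly.irreducible hint))
end PartN1

section PartN2
variable {C Ω : Type u} [Field C] [Field Ω] [Algebra C Ω]
def lieOf (D : Derivation C Ω Ω) (K : Subfield Ω) : LieSubalgebra C (Derivation C Ω Ω) where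
  carrier := {δ | (∀ a, δ (D a) = D (δ a)) ∧ ∀ a ∈ K, δ a = 0}
  add_mem' := by
    rintro δ ε ⟨h1, h2⟩ ⟨h3, h4⟩
    exact ⟨fun a => by simp [h1, h3], fun a ha => by simp [h2 a ha, h4 a ha]⟩
  zero_mem' := ⟨fun a => by simp, fun a _ => by simp⟩
  smul_mem' := by
    rintro c δ ⟨h1, h2⟩
    exact ⟨fun a => by simp [h1], fun a ha => by simp [h2 a ha]⟩
  lie_mem' := by
    rintro δ ε ⟨h1, h2⟩ ⟨h3, h4⟩
    exact ⟨fun a => by simp [Derivation.commutator_apply, h1, h3],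
      fun a ha => by simp [Derivation.commutator_apply, h2 a ha, h4 a ha]⟩
variable (D : Derivation C Ω Ω) {n : ℕ} (y : Fin n → Ω)
def assocS (Q : Submodule Ω (Derivation C Ω Ω)) : Submodule Ω (Fin n × Fin n → Ω) where
  carrier := {c | ∃ δ ∈ Q, ∀ i < n, ∀ j, δ (D^[i] (y j)) = ∑ l, c (l, j) * D^[i] (y l)}
  add_mem' := by
    rintro a b ⟨δ, hδ, h⟩ ⟨ε, hε, h'⟩
    refine ⟨δ + ε, Q.add_mem hδ hε, fun i hi j => ?_⟩
    simp [h i hi, h' i hi, add_mul, Finset.sum_add_distrib]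
  zero_mem' := ⟨0, Q.zero_mem, by simp⟩
  smul_mem' := by
    rintro c a ⟨δ, hδ, h⟩
    refine ⟨c • δ, Q.smul_mem c hδ, fun i hi j => ?_⟩
    simp [h i hi, Finset.mul_sum, mul_assoc]
def killS (C : Type u) {Ω : Type u} [Field C] [Field Ω] [Algebra C Ω] (K : Set Ω) :
    Submodule Ω (Derivation C Ω Ω) where
  carrier := {δ | ∀ a ∈ K, δ a = 0}
  add_mem' := by intro δ ε h1 h2 a ha; simp [h1 a ha, h2 a ha]
  zero_mem' := by intro a _; simp
  smul_mem' := by intro c δ h a ha; simp [h a ha]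
theorem inv_lieOf [CharZero Ω] (hD : ∀ x, D x = 0 → ∃ c, algebraMap C Ω c = x)
    (K : Subfield Ω) (hKD : ∀ x ∈ K, D x ∈ K) (hCK : ∀ c, algebraMap C Ω c ∈ K)
    (hKa : ∀ x, IsAlgebraic K x → x ∈ K)
    (hy : LinearIndependent C y) (a : Fin n → Ω) (ha : ∀ i, a i ∈ K)
    (hya : ∀ j, LApply D n a (y j) = 0)
    (hgen : ∀ δ : Derivation C Ω Ω, (∀ x ∈ K, δ x = 0) →
      (∀ i < n, ∀ j, δ (D^[i] (y j)) = 0) → δ = 0)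
    (x : Ω) (hx : ∀ δ ∈ lieOf D K, δ x = 0) : x ∈ K := by
  by_contra hxK
  have hxt : Transcendental K x := fun h => hxK (hKa x h)
  obtain ⟨δ0, hδ0⟩ := exists_der x hxt
  let δ : Derivation C Ω Ω := Derivation.mk'
    { toFun := δ0, map_add' := map_add δ0,
      map_smul' := by
        intro c z
        have h := δ0.map_smul (⟨algebraMap C Ω c, hCK c⟩ : K) z
        simp only [Subfield.smul_def, smul_eq_mul] at h
        simpa [Algebra.smul_def] using h } (by intro a b; simp)
  have hδ : δ ∈ killS C (K : Set Ω) := by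
    intro z hz
    exact δ0.map_algebraMap (⟨z, hz⟩ : K)
  have hδx : δ x ≠ 0 := hδ0
  have hn : ∀ j, D^[n] (y j) = - ∑ i : Fin n, a i * D^[(i : ℕ)] (y j) := by
    intro j; have := hya j; rw [LApply] at this; exact eq_neg_of_add_eq_zero_left this
  have key : ∀ ε ∈ killS C (K : Set Ω), ∀ c : Fin n × Fin n → Ω,
      (∀ i < n, ∀ j, ε (D^[i] (y j)) = ∑ l, c (l, j) * D^[i] (y l)) →
      ∀ i < n, ∀ j, ε (D^[i + 1] (y j)) = ∑ l, c (l, j) * D^[i + 1] (y l) := by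
    intro ε hε c h i hi j
    rcases Nat.lt_or_ge (i + 1) n with h1 | h1
    · exact h _ h1 j
    · have h2 : i + 1 = n := by omega
      rw [h2, hn]
      simp only [hn, map_neg, map_sum, Derivation.leibniz, smul_eq_mul, hε _ (ha _),
        mul_zero, add_zero, h _ (Fin.is_lt _), mul_neg, Finset.sum_neg_distrib, Finset.mul_sum]
      rw [Finset.sum_comm]
      congr 1
      refine Finset.sum_congr rfl fun _ _ => Finset.sum_congr rfl fun _ _ => by ring
  have hbr : ∀ ε ∈ killS C (K : Set Ω), ⁅D, ε⁆ ∈ killS C (K : Set Ω) := by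
    intro ε hε z hz
    rw [Derivation.commutator_apply, hε z hz, hε _ (hKD z hz), map_zero, sub_zero]
  have hstep : ∀ ε ∈ killS C (K : Set Ω), ∀ c : Fin n × Fin n → Ω,
      (∀ i < n, ∀ j, ε (D^[i] (y j)) = ∑ l, c (l, j) * D^[i] (y l)) →
      ∀ i < n, ∀ j, ⁅D, ε⁆ (D^[i] (y j)) = ∑ l, D (c (l, j)) * D^[i] (y l) := by
    intro ε hε c h i hi j
    rw [Derivation.commutator_apply, h i hi, ← Function.iterate_succ_apply' D,
      key ε hε c h i hi, map_sum, ← Finset.sum_sub_distrib]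
    refine Finset.sum_congr rfl fun l _ => ?_
    rw [Derivation.leibniz, smul_eq_mul, smul_eq_mul, Function.iterate_succ_apply']
    ring
  have hdes := descent {D} (assocS D y (killS C (K : Set Ω))) (by
    rintro D' hD' c ⟨ε, hε, h⟩
    rw [Set.mem_singleton_iff.1 hD']
    exact ⟨⁅D, ε⁆, hbr ε hε, hstep ε hε c h⟩)
  have hle : assocS D y (killS C (K : Set Ω)) ≤ assocS D y (killS C (insert x (K : Set Ω))) := by
    refine hdes.trans (Submodule.span_le.2 ?_)
    rintro c ⟨⟨ε, hε, h⟩, hc⟩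
    have h0 : ⁅D, ε⁆ = 0 := by
      refine hgen _ (hbr ε hε) fun i hi j => ?_
      rw [hstep ε hε c h i hi j]
      exact Finset.sum_eq_zero fun l _ => by rw [hc _ D rfl, zero_mul]
    have hL : ε ∈ lieOf D K := ⟨fun z => by
      have := Derivation.commutator_apply (D1 := D) (D2 := ε) z
      rw [h0] at this
      exact (sub_eq_zero.1 this.symm).symm, hε⟩
    refine ⟨ε, ?_, h⟩
    intro z hz
    rcases hz with rfl | hz
    · exact hx ε hL
    · exact hε z hz
  let Φ : Matrix (Fin n) (Fin n) Ω := Matrix.of fun i j => δ (D^[(i : ℕ)] (y j))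
  let c : Fin n × Fin n → Ω := fun p => ((wrM D y)⁻¹ * Φ) p.1 p.2
  have hc : ∀ i < n, ∀ j, δ (D^[i] (y j)) = ∑ l, c (l, j) * D^[i] (y l) := by
    intro i hi j
    have h1 : wrM D y * ((wrM D y)⁻¹ * Φ) = Φ := by
      rw [← Matrix.mul_assoc, Matrix.mul_nonsing_inv _ (wrM_det D hD y hy), one_mul]
    have h2 := congrFun (congrFun h1 ⟨i, hi⟩) j
    rw [Matrix.mul_apply] at h2
    change δ (D^[i] (y j)) = _
    refine Eq.trans h2.symm (Finset.sum_congr rfl fun l _ => mul_comm _ _)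
  obtain ⟨ε, hε, h⟩ := hle ⟨δ, hδ, hc⟩
  have h0 : δ - ε = 0 := hgen _ (fun z hz => by
      rw [Derivation.sub_apply, hδ z hz, hε z (Or.inr hz), sub_zero]) (fun i hi j => by
      rw [Derivation.sub_apply, hc i hi, h i hi, sub_self])
  apply hδx
  rw [sub_eq_zero.1 h0]
  exact hε x (Or.inl rfl)
end PartN2

section PartN3
variable {C Ω : Type u} [Field C] [Field Ω] [Algebra C Ω]
section
variable (D : Ω → Ω) (F : Subfield Ω) (S : Set Ω)
theorem dg_le : F ≤ diffGen D F S := le_sInf fun _ h => h.1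
theorem dg_sub : S ⊆ diffGen D F S := fun _ hx => Subfield.mem_sInf.2 fun _ h => h.2.1 hx
theorem dg_stab : ∀ x ∈ diffGen D F S, D x ∈ diffGen D F S := fun x hx =>
  Subfield.mem_sInf.2 fun G h => h.2.2 x (Subfield.mem_sInf.1 hx G h)
theorem dg_min {D : Ω → Ω} {F : Subfield Ω} {S : Set Ω} (G : Subfield Ω) (h1 : F ≤ G) (h2 : S ⊆ G) (h3 : ∀ x ∈ G, D x ∈ G) :
    diffGen D F S ≤ G := sInf_le ⟨h1, h2, h3⟩
end
theorem closure_stab (D : Derivation C Ω Ω) (T : Set Ω) (hT : ∀ x ∈ T, D x ∈ Subfield.closure T) :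
    ∀ x ∈ Subfield.closure T, D x ∈ Subfield.closure T := by
  intro x hx
  induction hx using Subfield.closure_induction with
  | mem x hx => exact hT x hx
  | one => rw [D.map_one_eq_zero]; exact Subfield.zero_mem _
  | add x y _ _ h1 h2 => rw [map_add]; exact Subfield.add_mem _ h1 h2
  | neg x _ h => rw [map_neg]; exact Subfield.neg_mem _ h
  | inv x hx h =>
    rw [Derivation.leibniz_inv, smul_eq_mul]
    exact Subfield.mul_mem _ (Subfield.neg_mem _ (Subfield.pow_mem _ (Subfield.inv_mem _ hx) 2)) h
  | mul x y hx hy h1 h2 =>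
    rw [Derivation.leibniz]
    exact Subfield.add_mem _ (Subfield.mul_mem _ hx h2) (Subfield.mul_mem _ hy h1)
def GoodS (D : Derivation C Ω Ω) (d : ℕ) (F : Subfield Ω) (S : Set Ω) : Prop :=
  (∃ x, IsAlgebraic F x ∧ S = {x}) ∨
  (∃ m ≤ d, ∃ (a w : Fin m → Ω), (∀ i, a i ∈ F) ∧ LinearIndependent C w ∧
    (∀ j, LApply D m a (w j) = 0) ∧ S = Set.range w) ∨
  (d = 1 ∧ ∃ z, D z ∈ F ∧ S = {z})
theorem isAlg_mono {F H : Subfield Ω} (hFH : F ≤ H) {x : Ω} (hx : IsAlgebraic F x) :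
    IsAlgebraic H x := by
  let := (Subfield.inclusion hFH).toAlgebra
  have : IsScalarTower F H Ω := IsScalarTower.of_algebraMap_eq fun _ => rfl
  exact hx.tower_top H
theorem GoodS.mono {D : Derivation C Ω Ω} {d : ℕ} {F H : Subfield Ω} {S : Set Ω}
    (h : GoodS D d F S) (hFH : F ≤ H) : GoodS D d H S := by
  rcases h with ⟨x, hx, rfl⟩ | ⟨m, hm, a, w, ha, hw, hs, rfl⟩ | ⟨hd, z, hz, rfl⟩
  · exact Or.inl ⟨x, isAlg_mono hFH hx, rfl⟩
  · exact Or.inr (Or.inl ⟨m, hm, a, w, fun i => hFH (ha i), hw, hs, rfl⟩)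
  · exact Or.inr (Or.inr ⟨hd, z, hFH hz, rfl⟩)
def stepR (D : Derivation C Ω Ω) (d : ℕ) (F G : Subfield Ω) : Prop :=
  ∃ S, GoodS D d F S ∧ G = diffGen D F S
abbrev Tow (D : Derivation C Ω Ω) (d : ℕ) := Relation.ReflTransGen (stepR D d)
variable {D : Derivation C Ω Ω} {d : ℕ} {k0 : Subfield Ω}
theorem Tow.le {F G : Subfield Ω} (h : Tow D d F G) : F ≤ G := by
  induction h with
  | refl => exact le_rfl
  | tail _ h2 ih => obtain ⟨S, -, rfl⟩ := h2; exact ih.trans (dg_le _ _ _)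
theorem Tow.stab {F G : Subfield Ω} (h : Tow D d F G) (hF : ∀ x ∈ F, D x ∈ F) :
    ∀ x ∈ G, D x ∈ G := by
  induction h with
  | refl => exact hF
  | tail _ h2 ih => obtain ⟨S, -, rfl⟩ := h2; exact dg_stab _ _ _
theorem Tow.lift {F G H : Subfield Ω} (h : Tow D d F G) (hFH : F ≤ H) :
    ∃ H', Tow D d H H' ∧ G ≤ H' ∧ H ≤ H' := by
  induction h with
  | refl => exact ⟨H, .refl, hFH, le_rfl⟩
  | tail _ h2 ih =>
    obtain ⟨H1, t1, h3, h4⟩ := ih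
    obtain ⟨S, hS, rfl⟩ := h2
    refine ⟨diffGen D H1 S, t1.tail ⟨S, hS.mono h3, rfl⟩, ?_, h4.trans (dg_le _ _ _)⟩
    exact dg_min (diffGen D H1 S) (h3.trans (dg_le _ _ _)) (dg_sub _ _ _) (dg_stab _ _ _)
theorem Tow.dir {F G H : Subfield Ω} (h1 : Tow D d F G) (h2 : Tow D d F H) :
    ∃ M, Tow D d F M ∧ G ≤ M ∧ H ≤ M := by
  obtain ⟨M, h, h3, h4⟩ := h1.lift h2.le
  exact ⟨M, h2.trans h, h3, h4⟩
def towK (D : Derivation C Ω Ω) (d : ℕ) (k0 : Subfield Ω) : Subfield Ω where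
  carrier := {x | ∃ G, Tow D d k0 G ∧ x ∈ G}
  zero_mem' := ⟨k0, .refl, k0.zero_mem⟩
  one_mem' := ⟨k0, .refl, k0.one_mem⟩
  add_mem' := by
    rintro a b ⟨G, hG, ha⟩ ⟨H, hH, hb⟩
    obtain ⟨M, hM, h1, h2⟩ := hG.dir hH
    exact ⟨M, hM, M.add_mem (h1 ha) (h2 hb)⟩
  mul_mem' := by
    rintro a b ⟨G, hG, ha⟩ ⟨H, hH, hb⟩
    obtain ⟨M, hM, h1, h2⟩ := hG.dir hH
    exact ⟨M, hM, M.mul_mem (h1 ha) (h2 hb)⟩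
  neg_mem' := by rintro a ⟨G, hG, ha⟩; exact ⟨G, hG, G.neg_mem ha⟩
  inv_mem' := by rintro a ⟨G, hG, ha⟩; exact ⟨G, hG, G.inv_mem ha⟩
theorem mem_towK {x : Ω} : x ∈ towK D d k0 ↔ ∃ G, Tow D d k0 G ∧ x ∈ G := Iff.rfl
theorem towK_fin {ι : Type*} (s : Finset ι) (f : ι → Ω) (h : ∀ i ∈ s, f i ∈ towK D d k0) :
    ∃ G, Tow D d k0 G ∧ ∀ i ∈ s, f i ∈ G := by
  classical
  induction s using Finset.induction_on with
  | empty => exact ⟨k0, .refl, by simp⟩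
  | insert i s _ ih =>
    obtain ⟨G, hG, h1⟩ := ih fun j hj => h j (Finset.mem_insert_of_mem hj)
    obtain ⟨H, hH, h2⟩ := h i (Finset.mem_insert_self _ _)
    obtain ⟨M, hM, h3, h4⟩ := hG.dir hH
    refine ⟨M, hM, fun j hj => ?_⟩
    rcases Finset.mem_insert.1 hj with rfl | hj
    · exact h4 h2
    · exact h3 (h1 j hj)
theorem towK_step {G : Subfield Ω} (hG : Tow D d k0 G) {S : Set Ω} (hS : GoodS D d G S) :
    ∀ x ∈ S, x ∈ towK D d k0 := fun _ hx =>
  ⟨diffGen D G S, hG.tail ⟨S, hS, rfl⟩, dg_sub _ _ _ hx⟩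
theorem towK_alg (x : Ω) (hx : IsAlgebraic (towK D d k0) x) : x ∈ towK D d k0 := by
  obtain ⟨p, hp, hpx⟩ := hx
  obtain ⟨G, hG, h⟩ := towK_fin (Finset.range (p.natDegree + 1)) (fun i => (p.coeff i : Ω))
    fun i _ => (p.coeff i).2
  have h' : ∀ i : ℕ, (p.coeff i : Ω) ∈ G := by
    intro i
    by_cases hi : i < p.natDegree + 1
    · exact h i (Finset.mem_range.2 hi)
    · rw [Polynomial.coeff_eq_zero_of_natDegree_lt (by omega)]; exact G.zero_mem
  refine towK_step hG (Or.inl ⟨x, ?_, rfl⟩) x rfl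
  let q : Polynomial Ω := p.map (algebraMap _ Ω)
  have hq : ∀ i : ℕ, q.coeff i ∈ G := fun i => by
    rw [Polynomial.coeff_map]; exact h' i
  have hlift : q ∈ Polynomial.lifts (algebraMap G Ω) := by
    rw [Polynomial.lifts_iff_coeff_lifts]
    exact fun i => ⟨⟨q.coeff i, hq i⟩, rfl⟩
  obtain ⟨r, hr⟩ := (Polynomial.mem_lifts q).1 hlift
  refine ⟨r, ?_, ?_⟩
  · rintro rfl
    rw [Polynomial.map_zero] at hr
    exact hp (Polynomial.map_injective _ (algebraMap _ Ω).injective (by rw [Polynomial.map_zero, hr]))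
  · rw [← Polynomial.eval_map_algebraMap, hr, Polynomial.eval_map_algebraMap, hpx]
theorem towK_algClosed [IsAlgClosed Ω] : IsAlgClosed (towK D d k0) := by
  refine IsAlgClosed.of_exists_root _ fun p hm hp => ?_
  obtain ⟨x, hx⟩ := IsAlgClosed.exists_aeval_eq_zero Ω p (Polynomial.degree_pos_of_irreducible hp).ne'
  have hxK : x ∈ towK D d k0 := towK_alg x ⟨p, hp.ne_zero, hx⟩
  refine ⟨⟨x, hxK⟩, ?_⟩
  apply (algebraMap (towK D d k0) Ω).injective
  rw [map_zero, ← hx, ← Polynomial.aeval_algebraMap_apply_eq_algebraMap_eval]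
  rfl
theorem towK_cl : ∀ m ≤ d, ∀ a : Fin m → Ω, (∀ i, a i ∈ towK D d k0) → ∀ w : Fin m → Ω,
    LinearIndependent C w → (∀ j, LApply D m a (w j) = 0) → ∀ j, w j ∈ towK D d k0 := by
  intro m hm a ha w hw hs j
  obtain ⟨G, hG, h⟩ := towK_fin Finset.univ a fun i _ => ha i
  exact towK_step hG (Or.inr (Or.inl ⟨m, hm, a, w, fun i => h i (Finset.mem_univ i), hw, hs, rfl⟩))
    _ ⟨j, rfl⟩
theorem towK_cl1 : d = 1 → ∀ z, D z ∈ towK D d k0 → z ∈ towK D d k0 := by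
  rintro hd z ⟨G, hG, h⟩
  exact towK_step hG (Or.inr (Or.inr ⟨hd, z, h, rfl⟩)) _ rfl
theorem towK_stab (hk : ∀ x ∈ k0, D x ∈ k0) : ∀ x ∈ towK D d k0, D x ∈ towK D d k0 := by
  rintro x ⟨G, hG, h⟩
  exact ⟨G, hG, hG.stab hk x h⟩
theorem le_towK : k0 ≤ towK D d k0 := fun _ hx => ⟨k0, .refl, hx⟩
theorem finExt_alg [CharZero Ω] {F : Subfield Ω} (hF : ∀ x ∈ F, D x ∈ F) {x : Ω}
    (hx : IsAlgebraic F x) : FinExt F (diffGen D F {x}) := by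
  let M := IntermediateField.adjoin F {x}
  have hxM : x ∈ M := IntermediateField.mem_adjoin_simple_self F x
  have hFM : ∀ z ∈ F, z ∈ M := fun z hz => M.algebraMap_mem ⟨z, hz⟩
  have hev : ∀ p : Polynomial F, Polynomial.aeval x p ∈ M := fun p =>
    (IntermediateField.algebra_adjoin_le_adjoin F {x}) (Polynomial.aeval_mem_adjoin_singleton F x)
  have hder : ∀ p : Polynomial F, ∃ v ∈ M, D (Polynomial.aeval x p) =
      v + Polynomial.aeval x (Polynomial.derivative p) * D x := by
    intro p
    induction p using Polynomial.induction_on' with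
    | add p q hp hq =>
      obtain ⟨v, hv, h1⟩ := hp
      obtain ⟨w, hw, h2⟩ := hq
      exact ⟨v + w, M.add_mem hv hw, by rw [map_add, map_add, h1, h2, map_add, map_add]; ring⟩
    | monomial n c =>
      refine ⟨x ^ n * D c, M.mul_mem (pow_mem hxM n) (hFM _ (hF c c.2)), ?_⟩
      rw [Polynomial.aeval_monomial, Polynomial.derivative_monomial, Polynomial.aeval_monomial,
        Derivation.leibniz, Derivation.leibniz_pow]
      simp only [smul_eq_mul, nsmul_eq_mul, map_mul, map_natCast]
      change c * _ + x ^ n * D c = x ^ n * D c + c * _ * _ * _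
      ring
  have hDx : D x ∈ M := by
    obtain ⟨v, hv, h⟩ := hder (minpoly F x)
    rw [minpoly.aeval, map_zero] at h
    have h2 : Polynomial.aeval x (Polynomial.derivative (minpoly F x)) ≠ 0 :=
      (minpoly.irreducible hx.isIntegral).separable.aeval_derivative_ne_zero (minpoly.aeval F x)
    have h3 : D x = (Polynomial.aeval x (Polynomial.derivative (minpoly F x)))⁻¹ * (-v) := by
      field_simp; linear_combination -h
    rw [h3]
    exact M.mul_mem (M.inv_mem (hev _)) (M.neg_mem hv)
  have hcl : M.toSubfield = Subfield.closure (insert x (F : Set Ω)) := by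
    apply le_antisymm
    · change Subfield.closure _ ≤ _
      rw [Subfield.closure_le]
      rintro z (⟨c, rfl⟩ | hz)
      · exact Subfield.subset_closure (Or.inr c.2)
      · exact Subfield.subset_closure (Or.inl hz)
    · rw [Subfield.closure_le]
      rintro z (rfl | hz)
      · exact hxM
      · exact hFM z hz
  have hst : ∀ z ∈ M.toSubfield, D z ∈ M.toSubfield := by
    rw [hcl]
    refine closure_stab D _ ?_
    rw [← hcl]
    rintro z (rfl | hz)
    · exact hDx
    · exact hFM _ (hF z hz)
  have hG : diffGen D F {x} = M.toSubfield := by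
    apply le_antisymm
    · exact dg_min M.toSubfield hFM (by rintro z rfl; exact hxM) hst
    · rw [hcl, Subfield.closure_le]
      rintro z (rfl | hz)
      · exact dg_sub _ _ _ rfl
      · exact dg_le D F {x} hz
  have hfin : FiniteDimensional F M := IntermediateField.adjoin.finiteDimensional hx.isIntegral
  rw [hG]
  exact ⟨hFM, hfin⟩
end PartN3

section PartN4
theorem tow_fin {α : Type*} {R : α → α → Prop} {a b : α} (h : Relation.ReflTransGen R a b) :
    ∃ (r : ℕ) (f : ℕ → α), f 0 = a ∧ f r = b ∧ ∀ i < r, R (f i) (f (i + 1)) := by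
  induction h with
  | refl => exact ⟨0, fun _ => a, rfl, rfl, by simp⟩
  | @tail b c _ hbc ih =>
    obtain ⟨r, f, h0, hr, hs⟩ := ih
    refine ⟨r + 1, fun i => if i ≤ r then f i else c, by simp [h0], by simp, fun i hi => ?_⟩
    rcases Nat.lt_or_ge i r with h | h
    · simpa [h.le, Nat.succ_le_of_lt h] using hs i h
    · obtain rfl : i = r := by omega
      simpa [hr] using hbc
variable {C Ω : Type u} [Field C] [Field Ω] [Algebra C Ω]
theorem inhom_step (D : Derivation C Ω Ω) (hD : ∀ x, D x = 0 → ∃ c, algebraMap C Ω c = x)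
    {F : Subfield Ω} (hF : ∀ x ∈ F, D x ∈ F) (hC : ∀ c, algebraMap C Ω c ∈ F)
    {S : Set Ω} {d m : ℕ} (hm : m ≤ d) (a w : Fin m → Ω) (ha : ∀ i, a i ∈ F)
    (hw : LinearIndependent C w) (hs : ∀ j, LApply D m a (w j) = 0) (z : Ω)
    (hz : LApply D m a z ∈ F)
    (hS : diffGen D F (insert z (Set.range w)) = diffGen D F S) :
    IsPVInhomLe D F (diffGen D F S) d := by
  have hli : ∀ c : Fin m → Ω, (∀ i, c i ∈ F ∧ D (c i) = 0) → (∑ i, c i * w i) = 0 →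
      ∀ i, c i = 0 := by
    intro c hc h i
    choose e he using fun i => hD _ (hc i).2
    have h1 := Fintype.linearIndependent_iff.1 hw e (by
      rw [← h]; exact Finset.sum_congr rfl fun i _ => by rw [Algebra.smul_def, he])
    rw [← he, h1, map_zero]
  have hsub := dg_sub D F (insert z (Set.range w))
  rw [hS] at hsub
  exact ⟨dg_le _ _ _, hF, dg_stab _ _ _, fun x _ hx => by
      obtain ⟨c, rfl⟩ := hD x hx; exact hC c, m, hm, a, _, z, w, ha, hz,
      hsub (Or.inl rfl), fun i => hsub (Or.inr ⟨i, rfl⟩), rfl, hs, hli, hS⟩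
theorem pv_step (D : Derivation C Ω Ω) (hD : ∀ x, D x = 0 → ∃ c, algebraMap C Ω c = x)
    {F : Subfield Ω} (hF : ∀ x ∈ F, D x ∈ F) (hC : ∀ c, algebraMap C Ω c ∈ F)
    {m : ℕ} (a w : Fin m → Ω) (ha : ∀ i, a i ∈ F)
    (hw : LinearIndependent C w) (hs : ∀ j, LApply D m a (w j) = 0) :
    IsPVWith D F (diffGen D F (Set.range w)) m a := by
  have hli : ∀ c : Fin m → Ω, (∀ i, c i ∈ F ∧ D (c i) = 0) → (∑ i, c i * w i) = 0 →
      ∀ i, c i = 0 := by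
    intro c hc h i
    choose e he using fun i => hD _ (hc i).2
    have h1 := Fintype.linearIndependent_iff.1 hw e (by
      rw [← h]; exact Finset.sum_congr rfl fun i _ => by rw [Algebra.smul_def, he])
    rw [← he, h1, map_zero]
  exact ⟨dg_le _ _ _, hF, dg_stab _ _ _, fun x _ hx => by
      obtain ⟨c, rfl⟩ := hD x hx; exact hC c, ha, w, fun i => dg_sub _ _ _ ⟨i, rfl⟩, hs, hli, rfl⟩
variable [CharZero Ω] (D : Derivation C Ω Ω)
def mkDF : DFld.{u} where
  carrier := Ω
  deriv := D
  deriv_add := map_add D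
  deriv_mul a b := by rw [Derivation.leibniz, smul_eq_mul, smul_eq_mul]; ring
theorem tow_solv (hD : ∀ x, D x = 0 → ∃ c, algebraMap C Ω c = x)
    {E : Type u} [Field E] (D0 : E → E) (j : E →+* Ω) (hj : ∀ x, j (D0 x) = D (j x))
    (k : Subfield E) (hk : ∀ x ∈ k, D0 x ∈ k) (hCk : ∀ c, algebraMap C Ω c ∈ k.map j)
    (d : ℕ) (hd : 1 ≤ d) (y : E) (hy : j y ∈ towK D d (k.map j)) :
    (d = 1 → IsDPlusSolvable D0 k (diffGen D0 k {y}) 1) ∧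
    (2 ≤ d → IsDSolvable D0 k (diffGen D0 k {y}) d) := by
  obtain ⟨G, hG, hyG⟩ := hy
  have hk' : ∀ x ∈ k.map j, D x ∈ k.map j := by
    rintro _ ⟨x, hx, rfl⟩
    exact ⟨D0 x, hk x hx, hj x⟩
  have htop : (diffGen D0 k {y}).map j ≤ G := by
    rw [Subfield.map_le_iff_le_comap]
    refine dg_min (G.comap j) (Subfield.map_le_iff_le_comap.1 hG.le) ?_ ?_
    · rintro _ rfl; exact hyG
    · intro x hx
      change j (D0 x) ∈ G
      rw [hj]; exact hG.stab hk' _ hx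
  obtain ⟨r, f, h0, hr, hs⟩ := tow_fin hG
  have htow : ∀ i : ℕ, i ≤ r → Tow D d (k.map j) (f i) := by
    intro i
    induction i with
    | zero => intro _; rw [h0]
    | succ i ih => intro hi; exact (ih (by omega)).tail (hs i (by omega))
  have hst : ∀ i : Fin (r + 1), ∀ x ∈ f i, D x ∈ f i := fun i =>
    (htow i (by omega)).stab hk'
  have hCf : ∀ i : Fin (r + 1), ∀ c, algebraMap C Ω c ∈ f i := fun i c =>
    (htow i (by omega)).le (hCk c)
  have htop' := htop
  rw [← hr] at htop'
  constructor
  · rintro rfl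
    refine ⟨mkDF D, j, hj, r, fun i => f i, h0, htop', hst, fun i => ?_⟩
    have hF := hst i.castSucc
    have hC := hCf i.castSucc
    obtain ⟨S, hS, hSe⟩ := hs i i.2
    change FinExt (f i) (f (i + 1)) ∨ IsPVInhomLe D (f i) (f (i + 1)) 1
    rw [hSe]
    rcases hS with ⟨x, hx, rfl⟩ | ⟨m, hm, a, w, ha, hw, hs, rfl⟩ | ⟨-, z, hz, rfl⟩
    · exact Or.inl (finExt_alg hF hx)
    · refine Or.inr (inhom_step D hD hF hC hm a w ha hw hs 0 ?_ ?_)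
      · have : LApply D m a 0 = 0 := by rw [← opL_apply, map_zero]
        rw [this]; exact Subfield.zero_mem _
      · apply le_antisymm
        · refine dg_min (diffGen D _ _) (dg_le _ _ _) ?_ (dg_stab _ _ _)
          rintro z (rfl | hz)
          · exact Subfield.zero_mem _
          · exact dg_sub _ _ _ hz
        · exact dg_min (diffGen D _ _) (dg_le _ _ _)
            (fun z hz => dg_sub _ _ _ (Or.inr hz)) (dg_stab _ _ _)
    · refine Or.inr (inhom_step D hD hF hC (m := 1) le_rfl (fun _ => 0) (fun _ => 1) ?_ ?_ ?_ z ?_ ?_)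
      · exact fun _ => Subfield.zero_mem _
      · exact LinearIndependent.of_subsingleton 0 one_ne_zero
      · intro _; simp [LApply]
      · simpa [LApply] using hz
      · apply le_antisymm
        · refine dg_min (diffGen D _ _) (dg_le _ _ _) ?_ (dg_stab _ _ _)
          rintro v (rfl | ⟨_, rfl⟩)
          · exact dg_sub _ _ _ rfl
          · exact Subfield.one_mem _
        · exact dg_min (diffGen D _ _) (dg_le _ _ _)
            (fun v hv => dg_sub _ _ _ (Or.inl hv)) (dg_stab _ _ _)
  · intro hd2
    refine ⟨mkDF D, j, hj, r, fun i => f i, h0, htop', hst, fun i => ?_⟩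
    have hF := hst i.castSucc
    have hC := hCf i.castSucc
    obtain ⟨S, hS, hSe⟩ := hs i i.2
    change FinExt (f i) (f (i + 1)) ∨ ∃ n ≤ d, ∃ a : Fin n → Ω, IsPVWith D (f i) (f (i + 1)) n a
    rw [hSe]
    rcases hS with ⟨x, hx, rfl⟩ | ⟨m, hm, a, w, ha, hw, hs, rfl⟩ | ⟨h1, z, hz, rfl⟩
    · exact Or.inl (finExt_alg hF hx)
    · exact Or.inr ⟨m, hm, a, pv_step D hD hF hC a w ha hw hs⟩
    · omega
end PartN4

section PartN5
theorem trb {E : Type u} [Field E] (k K : Subfield E) (d : ℕ) (h : trdegOf k K = d) :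
    ∃ u : Set E, Cardinal.mk u ≤ d ∧ u ⊆ K ∧ ∀ z ∈ K, IsAlgebraic (Algebra.adjoin k u) z := by
  have h0 : AlgebraicIndepOn k id (∅ : Set E) := algebraicIndependent_empty_type
  obtain ⟨u, -, hu⟩ := exists_maximal_algebraicIndependent ∅ (K : Set E) (Set.empty_subset _) h0
  refine ⟨u, ?_, hu.prop.2, fun z hz => ?_⟩
  · rw [← h, trdegOf]
    exact le_ciSup (f := fun s : {s : Set E // s ⊆ (K : Set E) ∧
      AlgebraicIndependent ↥k (fun x : ↥s => (x : E))} => Cardinal.mk ↥(s.1))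
      (Cardinal.bddAbove_range _) ⟨u, hu.prop.2, hu.prop.1⟩
  · by_contra ht
    have h1 : AlgebraicIndepOn k id (insert z u) :=
      AlgebraicIndepOn.insert hu.prop.1 (by rw [Set.image_id]; exact ht)
    have h2 : z ∈ u := hu.le_of_ge ⟨h1, Set.insert_subset hz hu.prop.2⟩ (Set.subset_insert _ _)
      (Set.mem_insert _ _)
    exact ht (isAlgebraic_algebraMap (⟨z, Algebra.subset_adjoin h2⟩ : Algebra.adjoin k u))
variable {C Ω : Type u} [Field C] [Field Ω] [Algebra C Ω] [CharZero Ω]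
theorem der_adj {E : Type u} [Field E] (j : E →+* Ω) (k : Subfield E) (u : Set E)
    (δ : Derivation C Ω Ω) (h1 : ∀ x ∈ k, δ (j x) = 0) (h2 : ∀ x ∈ u, δ (j x) = 0) (z : E)
    (hz : IsAlgebraic (Algebra.adjoin k u) z) : δ (j z) = 0 := by
  obtain ⟨p, hp, hpz⟩ := hz
  have hA : ∀ x : Algebra.adjoin k u, j x ∈ derKer δ := by
    rintro ⟨x, hx⟩
    induction hx using Algebra.adjoin_induction with
    | mem x hx => exact h2 x hx
    | algebraMap r => exact h1 r r.2
    | add x y _ _ h1 h2 => rw [map_add]; exact Subfield.add_mem _ h1 h2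
    | mul x y _ _ h1 h2 => rw [map_mul]; exact Subfield.mul_mem _ h1 h2
  let f : Algebra.adjoin k u →+* derKer δ :=
    (j.comp (algebraMap (Algebra.adjoin k u) E)).codRestrict (derKer δ) hA
  have hf : Function.Injective f := fun a b hab =>
    Subtype.ext (j.injective (congrArg Subtype.val hab))
  refine der_alg δ _ le_rfl _ ⟨p.map f, (Polynomial.map_ne_zero_iff hf).2 hp, ?_⟩
  rw [Polynomial.aeval_def, Polynomial.eval₂_map]
  have : (algebraMap (derKer δ) Ω).comp f = j.comp (algebraMap (Algebra.adjoin k u) E) := by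
    ext; rfl
  rw [this, ← Polynomial.hom_eval₂, ← Polynomial.aeval_def, hpz, map_zero]
theorem orb_le (D : Derivation C Ω Ω) (hD : ∀ x, D x = 0 → ∃ c, algebraMap C Ω c = x)
    (K : Subfield Ω) {E : Type u} [Field E] (D0 : E → E) (j : E →+* Ω)
    (hj : ∀ x, j (D0 x) = D (j x)) (k : Subfield E) (hkK : ∀ x ∈ k, j x ∈ K) (y : E) (d : ℕ)
    (hd : trdegOf k (diffGen D0 k {y}) = d) :
    Module.finrank C (LinearMap.range (orb C (j y) : lieOf D K →ₗ[C] Ω)) ≤ d := by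
  by_contra hlt
  obtain ⟨v, hv⟩ := exists_linearIndependent_of_le_finrank (R := C)
    (M := LinearMap.range (orb C (j y) : lieOf D K →ₗ[C] Ω)) (n := d + 1) (by omega)
  choose δ hδ using fun i => (v i).2
  obtain ⟨u, hu, huK, halg⟩ := trb k _ d hd
  have hufin : u.Finite := by
    rw [← Cardinal.lt_aleph0_iff_set_finite]
    exact hu.trans_lt (Cardinal.natCast_lt_aleph0)
  have := hufin.fintype
  have hcard : Fintype.card u ≤ d := by
    rw [Cardinal.mk_fintype] at hu; exact_mod_cast hu
  let M : Matrix u (Fin (d + 1)) Ω := Matrix.of fun s i => (δ i : Derivation C Ω Ω) (j s)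
  obtain ⟨c, hc0, hc⟩ : ∃ c : Fin (d + 1) → Ω, c ≠ 0 ∧ M.mulVec c = 0 := by
    have hk := LinearMap.ker_ne_bot_of_finrank_lt (f := M.mulVecLin) (by
      simp only [Module.finrank_fintype_fun_eq_card, Fintype.card_fin]; omega)
    obtain ⟨c, h1, h2⟩ := (Submodule.ne_bot_iff _).1 hk
    exact ⟨c, h2, h1⟩
  let ε : Derivation C Ω Ω := ∑ i, c i • (δ i : Derivation C Ω Ω)
  have hε : ∀ x, ε x = ∑ i, c i * (δ i : Derivation C Ω Ω) x := by
    intro x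
    have h := map_sum (⟨⟨fun e : Derivation C Ω Ω => e x, rfl⟩, fun _ _ => rfl⟩ :
      Derivation C Ω Ω →+ Ω) (fun i => c i • (δ i : Derivation C Ω Ω)) Finset.univ
    exact h
  have hz : ∀ z ∈ diffGen D0 k {y}, ε (j z) = 0 := by
    intro z hz
    refine der_adj j k u ε (fun x hx => ?_) (fun x hx => ?_) z (halg z hz)
    · rw [hε]
      exact Finset.sum_eq_zero fun i _ => by rw [(δ i).2.2 _ (hkK x hx), mul_zero]
    · rw [hε]
      have := congrFun hc ⟨x, hx⟩
      rw [Matrix.mulVec, dotProduct] at this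
      exact Eq.trans (Finset.sum_congr rfl fun i _ => mul_comm _ _) this
  have hit : ∀ l : ℕ, D0^[l] y ∈ diffGen D0 k {y} ∧ D^[l] (j y) = j (D0^[l] y) := by
    intro l
    induction l with
    | zero => exact ⟨dg_sub _ _ _ rfl, rfl⟩
    | succ l ih =>
      rw [Function.iterate_succ_apply', Function.iterate_succ_apply', ih.2, hj]
      exact ⟨dg_stab _ _ _ _ ih.1, rfl⟩
  have hcomm : ∀ i (l : ℕ), (δ i : Derivation C Ω Ω) (D^[l] (j y)) =
      D^[l] ((δ i : Derivation C Ω Ω) (j y)) := by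
    intro i l
    induction l with
    | zero => rfl
    | succ l ih => rw [Function.iterate_succ_apply', (δ i).2.1, ih, Function.iterate_succ_apply']
  apply hc0
  refine wr_aux D hD (d + 1) (fun i => (v i : Ω))
    (hv.map' (Submodule.subtype _) (Submodule.ker_subtype _)) c fun l _ => ?_
  rw [← hz _ (hit l).1, hε]
  refine Finset.sum_congr rfl fun i _ => ?_
  rw [← (hit l).2, hcomm, ← hδ i, orb_apply, lie_eq]
theorem main_alg {C Ω : Type u} [Field C] [Field Ω] [Algebra C Ω] [CharZero C] [IsAlgClosed C]
    [CharZero Ω] [IsAlgClosed Ω]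
    (D : Derivation C Ω Ω) (hD : ∀ x, D x = 0 → ∃ c, algebraMap C Ω c = x)
    {E : Type u} [Field E] (D0 : E → E) (j : E →+* Ω)
    (hj : ∀ x, j (D0 x) = D (j x)) (halg : ∀ x : Ω, IsAlgebraic j.fieldRange x)
    (k : Subfield E) (hCk : ∀ c, algebraMap C Ω c ∈ k.map j)
    (n : ℕ) (a : Fin n → E) (hPV : IsPVWith D0 k ⊤ n a)
    (y : E) (hsol : LApply D0 n a y = 0)
    (d : ℕ) (hd1 : 1 ≤ d) (hd4 : d ≤ 4) (hd : trdegOf k (diffGen D0 k {y}) = d) :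
    j y ∈ towK D d (k.map j) := by
  obtain ⟨-, hk, -, -, ha, w, -, hws, hwi, hwg⟩ := hPV
  let K := towK D d (k.map j)
  have hkK : ∀ x ∈ k, j x ∈ K := fun x hx => le_towK ⟨x, hx, rfl⟩
  have hk' : ∀ x ∈ k.map j, D x ∈ k.map j := by
    rintro _ ⟨x, hx, rfl⟩
    exact ⟨D0 x, hk x hx, hj x⟩
  have hit : ∀ (l : ℕ) x, D^[l] (j x) = j (D0^[l] x) := by
    intro l x
    induction l with
    | zero => rfl
    | succ l ih => rw [Function.iterate_succ_apply', Function.iterate_succ_apply', ih, hj]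
  have hL : ∀ x, LApply D n (fun i => j (a i)) (j x) = j (LApply D0 n a x) := by
    intro x; simp only [LApply, hit, map_add, map_sum, map_mul]
  have hws' : ∀ i, LApply D n (fun i => j (a i)) (j (w i)) = 0 := by
    intro i; rw [hL, hws, map_zero]
  have hli : LinearIndependent C (fun i => j (w i)) := by
    rw [Fintype.linearIndependent_iff]
    intro g hg
    choose e he hge using fun i => hCk (g i)
    have h1 := hwi e (fun i => ⟨he i, j.injective (by
      rw [hj, hge, D.map_algebraMap, map_zero])⟩) (j.injective (by
      rw [map_sum, map_zero, ← hg]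
      exact Finset.sum_congr rfl fun i _ => by rw [map_mul, hge, Algebra.smul_def]))
    intro i
    apply (algebraMap C Ω).injective
    rw [← hge, h1, map_zero, map_zero]
  have hgen : ∀ δ : Derivation C Ω Ω, (∀ x ∈ K, δ x = 0) →
      (∀ i < n, ∀ l, δ (D^[i] (j (w l))) = 0) → δ = 0 := by
    intro δ h1 h2
    let T : Set Ω := (K : Set Ω) ∪ {x | ∃ i < n, ∃ l, x = D^[i] (j (w l))}
    have hTk : Subfield.closure T ≤ derKer δ := by
      rw [Subfield.closure_le]
      rintro x (hx | ⟨i, hi, l, rfl⟩)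
      · exact h1 x hx
      · exact h2 i hi l
    have hTs : ∀ x ∈ Subfield.closure T, D x ∈ Subfield.closure T := by
      refine closure_stab D T ?_
      rintro x (hx | ⟨i, hi, l, rfl⟩)
      · exact Subfield.subset_closure (Or.inl (towK_stab hk' x hx))
      · rw [← Function.iterate_succ_apply' D]
        rcases Nat.lt_or_ge (i + 1) n with h | h
        · exact Subfield.subset_closure (Or.inr ⟨_, h, l, rfl⟩)
        · have hn : i + 1 = n := by omega
          have h3 := hws' l
          rw [LApply] at h3
          rw [Nat.succ_eq_add_one, hn, eq_neg_of_add_eq_zero_left h3]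
          refine Subfield.neg_mem _ (Subfield.sum_mem _ fun i _ => Subfield.mul_mem _ ?_ ?_)
          · exact Subfield.subset_closure (Or.inl (hkK _ (ha i)))
          · exact Subfield.subset_closure (Or.inr ⟨_, i.2, l, rfl⟩)
    have htop : (⊤ : Subfield E) ≤ (Subfield.closure T).comap j := by
      rw [← hwg]
      refine dg_min _ (fun x hx => Subfield.subset_closure (Or.inl (hkK x hx))) ?_ ?_
      · rintro _ ⟨l, rfl⟩
        rcases Nat.eq_zero_or_pos n with h | h
        · subst h; exact l.elim0
        · exact Subfield.subset_closure (Or.inr ⟨0, h, l, rfl⟩)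
      · intro x hx
        change j (D0 x) ∈ Subfield.closure T
        rw [hj]; exact hTs _ hx
    ext x
    refine der_alg δ j.fieldRange ?_ x (halg x)
    rintro _ ⟨z, rfl⟩
    exact hTk (htop (Subfield.mem_top z))
  have S : Sit D (lieOf D K) K d :=
    { const := hD
      comm := fun δ hδ => hδ.1
      triv := fun δ hδ => hδ.2
      inv := fun x hx => inv_lieOf D (fun i => j (w i)) hD K (towK_stab hk')
        (fun c => le_towK (hCk c)) towK_alg hli (fun i => j (a i)) (fun i => hkK _ (ha i)) hws'
        hgen x hx
      cl := towK_cl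
      cl1 := towK_cl1
      dpos := hd1 }
  have : IsAlgClosed K := towK_algClosed
  obtain ⟨hfin, -⟩ := opL_ker_fin D hD n (fun i => j (a i))
  let N : LieSubmodule C (lieOf D K) Ω :=
    { LinearMap.ker (opL D n (fun i => j (a i))) with
      lie_mem := by
        intro x m hm
        change opL D n _ _ = 0
        have hm' : LApply D n (fun i => j (a i)) m = 0 := by rw [← opL_apply]; exact hm
        have := S.der_LApply x x.2 n (fun i => j (a i)) m
        rw [hm', map_zero, Finset.sum_eq_zero (fun i _ => by
          rw [S.triv x x.2 _ (hkK _ (ha i)), zero_mul]), add_zero] at this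
        rw [opL_apply, lie_eq, ← this] }
  refine S.contra hd4 (j y) N hfin ?_ (orb_le D hD K D0 j hj k hkK y d hd)
  change opL D n _ _ = 0
  rw [opL_apply, hL, hsol, map_zero]
end PartN5
theorem stmt4 {E : Type u} [Field E] [CharZero E] (D : Derivation ℤ E E)
    (k : Subfield E) (hk : ∀ x ∈ k, D x ∈ k)
    (hC : IsAlgClosed ↥(constantsOf D k))
    (n : ℕ) (a : Fin n → E) (hPV : IsPVWith (⇑D) k ⊤ n a)
    (y : E) (hy : y ≠ 0) (hsol : LApply (⇑D) n a y = 0)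
    (d : ℕ) (hd : trdegOf k (diffGen (⇑D) k {y}) = d) :
    (d = 1 → IsDPlusSolvable (⇑D) k (diffGen (⇑D) k {y}) 1) ∧
    (2 ≤ d → d ≤ 4 → IsDSolvable (⇑D) k (diffGen (⇑D) k {y}) d) := by
  let C := constantsOf D k
  let Ω := AlgebraicClosure E
  let j : E →+* Ω := algebraMap E Ω
  have hCj : ∀ c : C, algebraMap C Ω c = j c := fun c => rfl
  have hst : IsScalarTower C E Ω := inferInstance
  have het : Algebra.FormallyEtale E Ω := Algebra.FormallyEtale.of_isSeparable _ _
  let f : Derivation C E Ω := Derivation.mk'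
    { toFun := fun x => j (D x), map_add' := by simp,
      map_smul' := by
        intro c x
        have : D (c : E) = 0 := c.2.2
        rw [Subfield.smul_def, smul_eq_mul, Derivation.leibniz, this, smul_zero, add_zero,
          smul_eq_mul, map_mul, RingHom.id_apply, ← hCj]
        exact (Algebra.smul_def c (j (D x))).symm }
    (by intro a b; simp [Algebra.smul_def, j])
  obtain ⟨DΩ, hDΩ⟩ := der_ext f
  have hj : ∀ x, j (D x) = DΩ (j x) := fun x => (hDΩ x).symm
  have halg : ∀ x : Ω, IsAlgebraic j.fieldRange x := by
    intro x
    obtain ⟨p, hp, hpx⟩ := Algebra.IsAlgebraic.isAlgebraic (R := E) x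
    refine ⟨p.map j.rangeRestrictField, (Polynomial.map_ne_zero_iff
      j.rangeRestrictField.injective).2 hp, ?_⟩
    rw [Polynomial.aeval_def, Polynomial.eval₂_map]
    exact hpx
  have hD : ∀ x, DΩ x = 0 → ∃ c, algebraMap C Ω c = x := by
    intro x hx
    refine const_alg DΩ j.fieldRange ?_ ?_ x (halg x) hx
    · rintro _ ⟨z, rfl⟩; exact ⟨D z, hj z⟩
    · rintro _ ⟨z, rfl⟩ hz
      have h1 : D z = 0 := j.injective (by rw [hj, hz, map_zero])
      exact ⟨⟨z, hPV.2.2.2.1 z (Subfield.mem_top z) h1, h1⟩, rfl⟩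
  have hCk : ∀ c, algebraMap C Ω c ∈ k.map j := fun c => ⟨c, c.2.1, rfl⟩
  have key : 1 ≤ d → d ≤ 4 → _ := fun h1 h4 => tow_solv DΩ hD D j hj k hk hCk d h1 y
    (main_alg DΩ hD D j hj halg k hCk n a hPV y hsol d h1 h4 hd)
  exact ⟨fun h => (key (by omega) (by omega)).1 h, fun h2 h4 => (key (by omega) h4).2 h2⟩
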